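/- arXiv:1603.01734 — 2 statements merged into one kernel-verified Lean document; each statement's English description precedes it below -/
import Mathlib

section
/- There exists a positive constant C such that the following holds. For every δ > 0 there exists n_0 such that for every finite Abelian group G of order n ≥ n_0, if U is a random subset of G in which each element is chosen independently with probability C (log n)^{1/3} n^{-2/3}, then with probability at least 1 − δ, every Freiman homomorphism from U to any Abelian group H can be extended to a Freiman homomorphism defined on all of G (equivalently, is the restriction to U of an affine homomorphism g ↦ ψ(g) + h for some group homomorphism ψ : G → H and some h ∈ H). -/
open scoped Classical
open Finset

noncomputable section

/-- The weight of a particular outcome `A` when each element of a finite type `G`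
is included independently with probability `p`. -/
def bernWeight {G : Type*} [Fintype G] (p : ℝ) (A : Finset G) : ℝ :=
  p ^ A.card * (1 - p) ^ (Fintype.card G - A.card)

/-- The probability that a random subset of `G`, with each element chosen independently
with probability `p`, satisfies the event `E`. -/
def randomSubsetProb (G : Type*) [Fintype G] (p : ℝ) (E : Finset G → Prop) : ℝ :=
  ∑ A : Finset G, if E A then bernWeight p A else 0

/-- `φ` is a Freiman homomorphism on `U`. -/
def FreimanHomOn {G H : Type*} [AddCommGroup G] [AddCommGroup H]
    (U : Finset G) (φ : G → H) : Prop :=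
  ∀ a ∈ U, ∀ b ∈ U, ∀ c ∈ U, ∀ d ∈ U, a + b = c + d → φ a + φ b = φ c + φ d


/-! ### Basic facts on Bernoulli random subsets -/

/-- Expectation with respect to the Bernoulli measure. -/
def Ex {Ω : Type*} [Fintype Ω] (p : ℝ) (F : Finset Ω → ℝ) : ℝ :=
  ∑ V : Finset Ω, bernWeight p V * F V

/-- Indicator of a proposition, as a real number. -/
def ind (P : Prop) : ℝ := if P then 1 else 0

lemma ind_nonneg (P : Prop) : 0 ≤ ind P := by unfold ind; split_ifs <;> norm_num
lemma ind_le_one (P : Prop) : ind P ≤ 1 := by unfold ind; split_ifs <;> norm_num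
lemma ind_true {P : Prop} (h : P) : ind P = 1 := by simp [ind, h]
lemma ind_false {P : Prop} (h : ¬ P) : ind P = 0 := by simp [ind, h]
lemma ind_mono {P Q : Prop} (h : P → Q) : ind P ≤ ind Q := by
  unfold ind; by_cases hP : P <;> by_cases hQ : Q <;> simp [hP, hQ]; exact absurd (h hP) hQ
lemma ind_and (P Q : Prop) : ind (P ∧ Q) = ind P * ind Q := by
  unfold ind; by_cases hP : P <;> by_cases hQ : Q <;> simp [hP, hQ]
lemma ind_not (P : Prop) : ind (¬ P) = 1 - ind P := by
  unfold ind; by_cases hP : P <;> simp [hP]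

lemma bernWeight_nonneg {Ω : Type*} [Fintype Ω] {p : ℝ} (h0 : 0 ≤ p) (h1 : p ≤ 1)
    (V : Finset Ω) : 0 ≤ bernWeight p V := by
  unfold bernWeight
  have : 0 ≤ 1 - p := by linarith
  positivity

lemma Ex_mono {Ω : Type*} [Fintype Ω] {p : ℝ} (h0 : 0 ≤ p) (h1 : p ≤ 1)
    {F F' : Finset Ω → ℝ} (h : ∀ V, F V ≤ F' V) : Ex p F ≤ Ex p F' :=
  Finset.sum_le_sum fun V _ => mul_le_mul_of_nonneg_left (h V) (bernWeight_nonneg h0 h1 V)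

lemma Ex_nonneg {Ω : Type*} [Fintype Ω] {p : ℝ} (h0 : 0 ≤ p) (h1 : p ≤ 1)
    {F : Finset Ω → ℝ} (h : ∀ V, 0 ≤ F V) : 0 ≤ Ex p F :=
  Finset.sum_nonneg fun V _ => mul_nonneg (bernWeight_nonneg h0 h1 V) (h V)

lemma Ex_add {Ω : Type*} [Fintype Ω] (p : ℝ) (F F' : Finset Ω → ℝ) :
    Ex p (fun V => F V + F' V) = Ex p F + Ex p F' := by
  simp [Ex, mul_add, Finset.sum_add_distrib]

lemma Ex_sub {Ω : Type*} [Fintype Ω] (p : ℝ) (F F' : Finset Ω → ℝ) :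
    Ex p (fun V => F V - F' V) = Ex p F - Ex p F' := by
  simp [Ex, mul_sub, Finset.sum_sub_distrib]

lemma Ex_const_mul {Ω : Type*} [Fintype Ω] (p c : ℝ) (F : Finset Ω → ℝ) :
    Ex p (fun V => c * F V) = c * Ex p F := by
  simp only [Ex, Finset.mul_sum]
  exact Finset.sum_congr rfl fun V _ => by ring

lemma Ex_sum {Ω ι : Type*} [Fintype Ω] (p : ℝ) (I : Finset ι) (F : ι → Finset Ω → ℝ) :
    Ex p (fun V => ∑ i ∈ I, F i V) = ∑ i ∈ I, Ex p (F i) := by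
  simp only [Ex, Finset.mul_sum]
  exact Finset.sum_comm

lemma Ex_prod {Ω : Type*} [Fintype Ω] (p : ℝ) (c : Ω → ℝ) :
    Ex p (fun V => ∏ ω ∈ V, c ω) = ∏ ω, (p * c ω + (1 - p)) := by
  rw [Finset.prod_add, Finset.powerset_univ]
  refine Finset.sum_congr rfl fun V _ => ?_
  simp [bernWeight, Finset.prod_mul_distrib, Finset.card_sdiff, Finset.card_univ]
  ring

lemma Ex_one {Ω : Type*} [Fintype Ω] (p : ℝ) : Ex p (fun _ : Finset Ω => 1) = 1 := by
  have := Ex_prod (Ω := Ω) p (fun _ => 1)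
  simpa using this

lemma Ex_const {Ω : Type*} [Fintype Ω] (p c : ℝ) : Ex p (fun _ : Finset Ω => c) = c := by
  have := Ex_const_mul (Ω := Ω) p c (fun _ => 1)
  rw [Ex_one] at this
  simpa using this

lemma Ex_pow_card {Ω : Type*} [Fintype Ω] (p c : ℝ) :
    Ex p (fun V : Finset Ω => c ^ V.card) = (p * c + (1 - p)) ^ Fintype.card Ω := by
  have := Ex_prod (Ω := Ω) p (fun _ => c)
  simpa using this

lemma bernWeight_insert {Ω : Type*} [Fintype Ω] (p : ℝ) (a : Ω) (V : Finset Ω) (h : a ∉ V) :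
    bernWeight p (insert a V) = p * (bernWeight p (insert a V) + bernWeight p V) := by
  have hlt : V.card < Fintype.card Ω := by
    rw [← Finset.card_univ]
    exact Finset.card_lt_card ⟨Finset.subset_univ _, fun h' => h (h' (Finset.mem_univ a))⟩
  obtain ⟨k, hk⟩ := Nat.exists_eq_add_of_lt hlt
  have e1 : Fintype.card Ω - (V.card + 1) = k := by omega
  have e2 : Fintype.card Ω - V.card = k + 1 := by omega
  simp only [bernWeight, Finset.card_insert_of_notMem h, e1, e2]
  ring

lemma sum_finset_split {Ω : Type*} [Fintype Ω] (a : Ω) (F : Finset Ω → ℝ) :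
    ∑ V, F V = ∑ V ∈ univ.filter (fun V : Finset Ω => a ∉ V), (F (insert a V) + F V) := by
  rw [Finset.sum_add_distrib, ← Finset.sum_filter_add_sum_filter_not univ (fun V => a ∉ V) F,
    add_comm]
  congr 1
  refine Finset.sum_bij' (fun V _ => V.erase a) (fun V _ => insert a V) ?_ ?_ ?_ ?_ ?_
  · intro V hV; simp
  · intro V hV; simp
  · intro V hV; simp at hV; simp [Finset.insert_erase hV]
  · intro V hV; simp at hV; simp [Finset.erase_insert hV]
  · intro V hV; simp at hV; simp [Finset.insert_erase hV]

lemma Ex_mem {Ω : Type*} [Fintype Ω] (p : ℝ) (a : Ω) (F : Finset Ω → ℝ)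
    (hF : ∀ V, F (insert a V) = F V) :
    Ex p (fun V => ind (a ∈ V) * F V) = p * Ex p F := by
  unfold Ex
  rw [sum_finset_split a, sum_finset_split a, Finset.mul_sum]
  refine Finset.sum_congr rfl fun V hV => ?_
  simp only [Finset.mem_filter, Finset.mem_univ, true_and] at hV
  have := bernWeight_insert p a V hV
  beta_reduce
  rw [hF, ind_true (Finset.mem_insert_self a V), ind_false hV]
  linear_combination (F V) * this

lemma Ex_subset {Ω : Type*} [Fintype Ω] (p : ℝ) (A : Finset Ω) (F : Finset Ω → ℝ)
    (hF : ∀ a ∈ A, ∀ V, F (insert a V) = F V) :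
    Ex p (fun V => ind (A ⊆ V) * F V) = p ^ A.card * Ex p F := by
  induction A using Finset.induction_on with
  | empty => simp [ind]
  | insert a A ha ih =>
    have h1 : ∀ V : Finset Ω, ind (insert a A ⊆ V) * F V
        = ind (a ∈ V) * (ind (A ⊆ V) * F V) := by
      intro V
      rw [← mul_assoc, ← ind_and, Finset.insert_subset_iff]
    simp_rw [h1]
    rw [Ex_mem, ih, Finset.card_insert_of_notMem ha]
    · ring
    · intro b hb V; exact hF b (Finset.mem_insert_of_mem hb) V
    · intro V
      rw [hF a (Finset.mem_insert_self _ _)]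
      congr 2
      exact propext (Finset.subset_insert_iff_of_notMem ha)

lemma Pr_subset {Ω : Type*} [Fintype Ω] (p : ℝ) (A : Finset Ω) :
    Ex p (fun V => ind (A ⊆ V)) = p ^ A.card := by
  have := Ex_subset p A (fun _ => 1) (by simp)
  simpa [Ex_one] using this

/-- Harris' inequality: increasing and decreasing events are negatively correlated. -/
lemma harris {Ω : Type*} [Fintype Ω] {p : ℝ} (h0 : 0 ≤ p) (h1 : p ≤ 1)
    (E D : Finset Ω → Prop) (hE : ∀ V W, V ⊆ W → E V → E W) (hD : ∀ V W, V ⊆ W → D W → D V) :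
    Ex p (fun V => ind (E V ∧ D V)) ≤ Ex p (fun V => ind (E V)) * Ex p (fun V => ind (D V)) := by
  have key := fkg (α := Finset Ω) (fun V => ind (E V)) (fun V => ind (¬ D V)) (bernWeight p)
    (fun V => bernWeight_nonneg h0 h1 V) (fun V => ind_nonneg _) (fun V => ind_nonneg _)
    (fun V W h => ind_mono (hE V W h)) (fun V W h => ind_mono (fun a b => a (hD V W h b)))
    (by
      intro a b
      apply le_of_eq
      simp only [bernWeight, Finset.inf_eq_inter, Finset.sup_eq_union]
      have := Finset.card_union_add_card_inter a b
      have ha := Finset.card_le_univ a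
      have hb := Finset.card_le_univ b
      have hi := Finset.card_le_univ (a ∩ b)
      have hu := Finset.card_le_univ (a ∪ b)
      calc _ = p ^ (a.card + b.card) * (1 - p) ^ ((Fintype.card Ω - a.card)
              + (Fintype.card Ω - b.card)) := by rw [pow_add, pow_add]; ring
        _ = p ^ ((a ∩ b).card + (a ∪ b).card) * (1 - p) ^ ((Fintype.card Ω - (a ∩ b).card)
              + (Fintype.card Ω - (a ∪ b).card)) := by
            congr 2 <;> omega
        _ = _ := by rw [pow_add, pow_add]; ring)
  change Ex p (fun V => ind (E V)) * Ex p (fun V => ind (¬ D V)) ≤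
    (∑ V, bernWeight p V) * Ex p (fun V => ind (E V) * ind (¬ D V)) at key
  have e1 : (∑ V : Finset Ω, bernWeight p V) = 1 := by
    have := Ex_one (Ω := Ω) p
    simpa [Ex] using this
  have e2 : Ex p (fun V => ind (¬ D V)) = 1 - Ex p (fun V => ind (D V)) := by
    simp_rw [ind_not]; rw [Ex_sub, Ex_one]
  have e3 : Ex p (fun V => ind (E V) * ind (¬ D V))
      = Ex p (fun V => ind (E V)) - Ex p (fun V => ind (E V ∧ D V)) := by
    simp_rw [ind_not, mul_sub, mul_one, ← ind_and]; rw [Ex_sub]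
  rw [e1, e2, e3] at key
  linarith

/-- Chernoff type bound. -/
lemma chernoff {Ω : Type*} [Fintype Ω] {p : ℝ} (h0 : 0 ≤ p) (h1 : p ≤ 1) (h : Ω → ℝ)
    (hh0 : ∀ ω, 0 ≤ h ω) (hh1 : ∀ ω, h ω ≤ 1) (l : ℝ) :
    Ex p (fun V => ind (l ≤ ∑ ω ∈ V, h ω)) ≤ Real.exp (2 * p * ∑ ω, h ω - l) := by
  have hexp : ∀ t : ℝ, 0 ≤ t → t ≤ 1 → Real.exp t ≤ 1 + 2 * t := by
    intro t ht0 ht1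
    have h2 := Real.abs_exp_sub_one_sub_id_le (x := t) (by rw [abs_of_nonneg ht0]; exact ht1)
    have := abs_le.1 h2
    nlinarith
  calc Ex p (fun V => ind (l ≤ ∑ ω ∈ V, h ω))
      ≤ Ex p (fun V => Real.exp (-l) * ∏ ω ∈ V, Real.exp (h ω)) := by
        refine Ex_mono h0 h1 fun V => ?_
        rw [← Real.exp_sum, ← Real.exp_add]
        by_cases hl : l ≤ ∑ ω ∈ V, h ω
        · rw [ind_true hl]; exact Real.one_le_exp (by linarith)
        · rw [ind_false hl]; positivity
    _ = Real.exp (-l) * ∏ ω, (p * Real.exp (h ω) + (1 - p)) := by rw [Ex_const_mul, Ex_prod]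
    _ ≤ Real.exp (-l) * ∏ ω, Real.exp (2 * p * h ω) := by
        refine mul_le_mul_of_nonneg_left ?_ (Real.exp_pos _).le
        refine Finset.prod_le_prod (fun ω _ => ?_) (fun ω _ => ?_)
        · have := Real.exp_pos (h ω)
          have : 0 ≤ 1 - p := by linarith
          positivity
        · have h2 := hexp (h ω) (hh0 ω) (hh1 ω)
          have h3 := Real.add_one_le_exp (2 * p * h ω)
          nlinarith
    _ = _ := by
        rw [← Real.exp_sum, ← Real.exp_add, ← Finset.mul_sum]
        congr 1; ring

lemma Ex_pow_card_le {Ω : Type*} [Fintype Ω] {p c : ℝ} (h0 : 0 ≤ p) (h1 : p ≤ 1) (hc : 0 ≤ c) :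
    Ex p (fun V : Finset Ω => c ^ V.card) ≤ Real.exp (p * c * Fintype.card Ω) := by
  rw [Ex_pow_card, mul_comm (p * c) (Fintype.card Ω : ℝ), Real.exp_nat_mul]
  refine pow_le_pow_left₀ (by have : 0 ≤ 1 - p := by linarith
                              positivity) ?_ _
  have := Real.add_one_le_exp (p * c)
  linarith


/-! ### Janson's inequality -/

lemma janson_basic {Ω ι : Type*} [Fintype Ω] {p : ℝ} (h0 : 0 ≤ p) (h1 : p ≤ 1)
    (A : ι → Finset Ω) (I : Finset ι) :
    Ex p (fun V => ind (∀ i ∈ I, ¬ A i ⊆ V)) ≤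
      Real.exp (-(∑ i ∈ I, p ^ (A i).card) + (1 / 2) * ∑ i ∈ I, ∑ j ∈ I,
        if i ≠ j ∧ ¬ Disjoint (A i) (A j) then p ^ (A i ∪ A j).card else 0) := by
  induction I using Finset.induction_on with
  | empty => simp [ind, Ex_one]
  | insert i I hi ih =>
    set s : ℝ := ∑ j ∈ I, if ¬ Disjoint (A i) (A j) then p ^ (A i ∪ A j).card else 0 with hs
    set P : ℝ := Ex p (fun V => ind (∀ i ∈ I, ¬ A i ⊆ V)) with hP
    set PC : ℝ := Ex p (fun V => ind (∀ j ∈ I, Disjoint (A i) (A j) → ¬ A j ⊆ V)) with hPC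
    have hP0 : 0 ≤ P := Ex_nonneg h0 h1 fun V => ind_nonneg _
    have hPPC : P ≤ PC := Ex_mono h0 h1 fun V => ind_mono fun h j hj _ => h j hj
    -- the sum over pairs
    have hsum : (∑ k ∈ insert i I, ∑ j ∈ insert i I,
        if k ≠ j ∧ ¬ Disjoint (A k) (A j) then p ^ (A k ∪ A j).card else 0)
        = (∑ k ∈ I, ∑ j ∈ I,
        if k ≠ j ∧ ¬ Disjoint (A k) (A j) then p ^ (A k ∪ A j).card else 0) + 2 * s := by
      rw [Finset.sum_insert hi, Finset.sum_insert hi]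
      have e1 : (∑ j ∈ I, if i ≠ j ∧ ¬ Disjoint (A i) (A j) then p ^ (A i ∪ A j).card else 0)
          = s := by
        refine Finset.sum_congr rfl fun j hj => ?_
        have : i ≠ j := fun h => hi (h ▸ hj)
        simp [this]
      have e2 : (∑ k ∈ I, ∑ j ∈ insert i I,
          if k ≠ j ∧ ¬ Disjoint (A k) (A j) then p ^ (A k ∪ A j).card else 0)
          = s + ∑ k ∈ I, ∑ j ∈ I,
          if k ≠ j ∧ ¬ Disjoint (A k) (A j) then p ^ (A k ∪ A j).card else 0 := by
        rw [hs, ← Finset.sum_add_distrib]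
        refine Finset.sum_congr rfl fun j hj => ?_
        rw [Finset.sum_insert hi]
        have : j ≠ i := fun h => hi (h ▸ hj)
        simp [this, disjoint_comm, Finset.union_comm]
      rw [e1, e2]; simp; ring
    -- main inequality
    have hmain : (p ^ (A i).card - s) * PC ≤ P - Ex p (fun V => ind (∀ k ∈ insert i I, ¬ A k ⊆ V)) := by
      have hAC : Ex p (fun V => ind (A i ⊆ V) *
          ind (∀ j ∈ I, Disjoint (A i) (A j) → ¬ A j ⊆ V)) = p ^ (A i).card * PC := by
        apply Ex_subset
        intro a ha V
        congr 1
        apply propext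
        refine forall_congr' fun j => forall_congr' fun hj => forall_congr' fun hd => ?_
        have : a ∉ A j := Finset.disjoint_left.1 hd ha
        rw [Finset.subset_insert_iff_of_notMem this]
      have hpair : ∀ j ∈ I, Ex p (fun V => ind ((A i ∪ A j ⊆ V) ∧
          ∀ j ∈ I, Disjoint (A i) (A j) → ¬ A j ⊆ V)) ≤ p ^ (A i ∪ A j).card * PC := by
        intro j hj
        have := harris h0 h1 (fun V => A i ∪ A j ⊆ V)
          (fun V => ∀ j ∈ I, Disjoint (A i) (A j) → ¬ A j ⊆ V)
          (fun V W h h' => h'.trans h) (fun V W h h' j hj hd hV => h' j hj hd (hV.trans h))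
        rwa [Pr_subset] at this
      have hpt : ∀ V : Finset Ω, ind (A i ⊆ V) *
          ind (∀ j ∈ I, Disjoint (A i) (A j) → ¬ A j ⊆ V)
          - ∑ j ∈ I, (if ¬ Disjoint (A i) (A j) then ind ((A i ∪ A j ⊆ V) ∧
            ∀ j ∈ I, Disjoint (A i) (A j) → ¬ A j ⊆ V) else 0) ≤
          ind (∀ i ∈ I, ¬ A i ⊆ V) - ind (∀ k ∈ insert i I, ¬ A k ⊆ V) := by
        intro V
        have hnn : ∀ j ∈ I, 0 ≤ (if ¬ Disjoint (A i) (A j) then ind ((A i ∪ A j ⊆ V) ∧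
            ∀ j ∈ I, Disjoint (A i) (A j) → ¬ A j ⊆ V) else 0) := by
          intro j hj
          split_ifs <;> first | exact ind_nonneg _ | exact le_rfl
        have hmono : ind (∀ k ∈ insert i I, ¬ A k ⊆ V) ≤ ind (∀ i ∈ I, ¬ A i ⊆ V) :=
          ind_mono fun h k hk => h k (Finset.mem_insert_of_mem hk)
        rw [← ind_and]
        by_cases hc : A i ⊆ V ∧ ∀ j ∈ I, Disjoint (A i) (A j) → ¬ A j ⊆ V
        · rw [ind_true hc]
          by_cases hn : ∀ j ∈ I, ¬ A j ⊆ V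
          · rw [ind_true hn, ind_false (P := ∀ k ∈ insert i I, ¬ A k ⊆ V)
              (fun h => h i (Finset.mem_insert_self _ _) hc.1)]
            have := Finset.sum_nonneg hnn
            linarith
          · push Not at hn
            obtain ⟨j, hj, hjV⟩ := hn
            have hnd : ¬ Disjoint (A i) (A j) := fun h => hc.2 j hj h hjV
            have := Finset.single_le_sum hnn hj
            rw [if_pos hnd, ind_true ⟨Finset.union_subset hc.1 hjV, hc.2⟩] at this
            linarith
        · rw [ind_false hc]
          have := Finset.sum_nonneg hnn
          linarith
      have h2 := Ex_mono h0 h1 hpt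
      rw [Ex_sub, Ex_sub, hAC, Ex_sum] at h2
      have h3 : ∑ j ∈ I, Ex p (fun V => if ¬ Disjoint (A i) (A j) then ind ((A i ∪ A j ⊆ V) ∧
            ∀ j ∈ I, Disjoint (A i) (A j) → ¬ A j ⊆ V) else 0) ≤ s * PC := by
        rw [hs, Finset.sum_mul]
        refine Finset.sum_le_sum fun j hj => ?_
        by_cases hd : Disjoint (A i) (A j)
        · simp [hd, Ex_const]
        · simp only [hd, not_false_eq_true, if_true]
          exact hpair j hj
      linarith
    have hle : Ex p (fun V => ind (∀ k ∈ insert i I, ¬ A k ⊆ V)) ≤ P :=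
      Ex_mono h0 h1 fun V => ind_mono fun h k hk => h k (Finset.mem_insert_of_mem hk)
    have hfin : Ex p (fun V => ind (∀ k ∈ insert i I, ¬ A k ⊆ V)) ≤
        P * Real.exp (-(p ^ (A i).card - s)) := by
      by_cases hneg : p ^ (A i).card - s ≤ 0
      · have : 1 ≤ Real.exp (-(p ^ (A i).card - s)) := Real.one_le_exp (by linarith)
        nlinarith
      · push Not at hneg
        have h4 := Real.add_one_le_exp (-(p ^ (A i).card - s))
        have h5 : (p ^ (A i).card - s) * P ≤ (p ^ (A i).card - s) * PC :=
          mul_le_mul_of_nonneg_left hPPC hneg.le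
        nlinarith [mul_le_mul_of_nonneg_left h4 hP0]
    refine hfin.trans ?_
    rw [hsum, Finset.sum_insert hi]
    refine (mul_le_mul_of_nonneg_right ih (Real.exp_pos _).le).trans ?_
    rw [← Real.exp_add]
    apply le_of_eq
    congr 1; ring

lemma janson {Ω ι : Type*} [Fintype Ω] [Fintype ι] {p : ℝ} (h0 : 0 ≤ p) (h1 : p ≤ 1)
    (A : ι → Finset Ω) (I : Finset ι) (q : ℝ) (hq0 : 0 ≤ q) (hq1 : q ≤ 1) :
    Ex p (fun V => ind (∀ i ∈ I, ¬ A i ⊆ V)) ≤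
      Real.exp (-(q * ∑ i ∈ I, p ^ (A i).card) + q ^ 2 / 2 * ∑ i ∈ I, ∑ j ∈ I,
        if i ≠ j ∧ ¬ Disjoint (A i) (A j) then p ^ (A i ∪ A j).card else 0) := by
  set Z : ι → ι → ℝ := fun i j =>
    if i ≠ j ∧ ¬ Disjoint (A i) (A j) then p ^ (A i ∪ A j).card else 0 with hZ
  set Φ : Finset ι → ℝ := fun J => -(∑ i ∈ J, p ^ (A i).card) + (1 / 2) * ∑ i ∈ J, ∑ j ∈ J, Z i j
    with hΦ
  have hb : ∀ J ⊆ I, Ex p (fun V => ind (∀ i ∈ I, ¬ A i ⊆ V)) ≤ Real.exp (Φ J) := by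
    intro J hJ
    refine le_trans (Ex_mono h0 h1 fun V => ?_) (janson_basic h0 h1 A J)
    exact ind_mono fun h i hi => h i (hJ hi)
  have hEx : Ex q (fun J => Φ (J ∩ I)) =
      -(q * ∑ i ∈ I, p ^ (A i).card) + q ^ 2 / 2 * ∑ i ∈ I, ∑ j ∈ I, Z i j := by
    have hΦ' : ∀ J : Finset ι, Φ (J ∩ I) = (∑ i ∈ I, (-(p ^ (A i).card)) * ind ({i} ⊆ J))
        + ∑ i ∈ I, ∑ j ∈ I, ((1 / 2) * Z i j) * ind ({i, j} ⊆ J) := by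
      intro J
      have hs : ∀ f : ι → ℝ, ∑ i ∈ J ∩ I, f i = ∑ i ∈ I, f i * ind (i ∈ J) := by
        intro f
        rw [Finset.inter_comm, ← Finset.filter_mem_eq_inter, Finset.sum_filter]
        refine Finset.sum_congr rfl fun i _ => ?_
        unfold ind; split_ifs <;> simp
      simp only [hΦ, hs]
      rw [← Finset.sum_neg_distrib, Finset.mul_sum]
      congr 1
      · refine Finset.sum_congr rfl fun i _ => ?_
        simp
      · refine Finset.sum_congr rfl fun i _ => ?_
        rw [Finset.sum_mul, Finset.mul_sum]
        refine Finset.sum_congr rfl fun j _ => ?_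
        rw [Finset.insert_subset_iff, Finset.singleton_subset_iff, ind_and]
        ring
    simp_rw [hΦ']
    rw [Ex_add, Ex_sum, Ex_sum, Finset.mul_sum, ← Finset.sum_neg_distrib, Finset.mul_sum]
    congr 1
    · refine Finset.sum_congr rfl fun i _ => ?_
      rw [Ex_const_mul, Pr_subset]; simp; ring
    · refine Finset.sum_congr rfl fun i _ => ?_
      rw [Ex_sum, Finset.mul_sum]
      refine Finset.sum_congr rfl fun j _ => ?_
      rw [Ex_const_mul, Pr_subset]
      by_cases hij : i = j
      · simp [hZ, hij]
      · rw [Finset.card_pair hij]; ring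
  obtain ⟨J, hJ⟩ : ∃ J : Finset ι, Φ (J ∩ I) ≤ Ex q (fun J => Φ (J ∩ I)) := by
    by_contra hcon
    push Not at hcon
    set m := Ex q (fun J => Φ (J ∩ I)) with hm
    have hpos : 0 < Ex q (fun J => Φ (J ∩ I) - m) := by
      have hw : ∃ J : Finset ι, 0 < bernWeight q J := by
        by_contra hw
        push Not at hw
        have h1' := Ex_one (Ω := ι) q
        have : Ex q (fun _ : Finset ι => 1) ≤ 0 :=
          Finset.sum_nonpos fun J _ => by simpa using hw J
        linarith
      obtain ⟨J, hJ⟩ := hw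
      refine Finset.sum_pos' (fun K _ => ?_) ⟨J, Finset.mem_univ _, ?_⟩
      · exact mul_nonneg (bernWeight_nonneg hq0 hq1 K) (by linarith [hcon K])
      · exact mul_pos hJ (by linarith [hcon J])
    rw [Ex_sub, Ex_const] at hpos
    linarith
  refine (hb (J ∩ I) Finset.inter_subset_right).trans ?_
  rw [← hEx]
  exact Real.exp_le_exp.2 hJ


/-! ### Janson's inequality for families of tuples -/

/-- The graph of a tuple, with the indices embedded in `Fin 4`. -/
def gr {G : Type*} {r : ℕ} (e : Fin r → Fin 4) (v : Fin r → G) : Finset (G × Fin 4) :=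
  univ.image fun i => (v i, e i)

lemma mem_gr {G : Type*} {r : ℕ} {e : Fin r → Fin 4} {v : Fin r → G} {x : G × Fin 4} :
    x ∈ gr e v ↔ ∃ i, (v i, e i) = x := by simp [gr]

lemma card_gr {G : Type*} {r : ℕ} {e : Fin r → Fin 4} (he : Function.Injective e)
    (v : Fin r → G) : (gr e v).card = r := by
  unfold gr
  rw [Finset.card_image_of_injective]
  · simp
  · intro i j h
    simp only [Prod.mk.injEq] at h
    exact he h.2

lemma inter_gr {G : Type*} {r : ℕ} {e : Fin r → Fin 4} (he : Function.Injective e)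
    (v v' : Fin r → G) :
    gr e v ∩ gr e v' = (univ.filter fun i => v i = v' i).image fun i => (v i, e i) := by
  ext x
  simp only [Finset.mem_inter, mem_gr, Finset.mem_image, Finset.mem_filter, Finset.mem_univ,
    true_and]
  constructor
  · rintro ⟨⟨i, rfl⟩, ⟨j, hj⟩⟩
    simp only [Prod.mk.injEq] at hj
    have := he hj.2
    subst this
    exact ⟨j, hj.1.symm, rfl⟩
  · rintro ⟨i, hi, rfl⟩
    exact ⟨⟨i, rfl⟩, ⟨i, by rw [hi]⟩⟩

lemma card_inter_gr {G : Type*} {r : ℕ} {e : Fin r → Fin 4} (he : Function.Injective e)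
    (v v' : Fin r → G) :
    (gr e v ∩ gr e v').card = (univ.filter fun i => v i = v' i).card := by
  rw [inter_gr he, Finset.card_image_of_injOn]
  intro i _ j _ h
  simp only [Prod.mk.injEq] at h
  exact he h.2

lemma pair_bound {G : Type*} {r : ℕ} {e : Fin r → Fin 4} (he : Function.Injective e)
    {p : ℝ} (h0 : 0 ≤ p) (v v' : Fin r → G)
    (h3 : 3 ≤ (univ.filter fun i => v i = v' i).card → v = v') :
    (if v ≠ v' ∧ ¬ Disjoint (gr e v) (gr e v') then p ^ (gr e v ∪ gr e v').card else 0) ≤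
      (∑ i, ind (v i = v' i)) * p ^ (2 * r - 1) +
      (∑ i, ∑ j, ind (i ≠ j ∧ v i = v' i ∧ v j = v' j)) * p ^ (2 * r - 2) := by
  have hn1 : 0 ≤ ∑ i, ind (v i = v' i) := Finset.sum_nonneg fun i _ => ind_nonneg _
  have hn2 : 0 ≤ ∑ i, ∑ j, ind (i ≠ j ∧ v i = v' i ∧ v j = v' j) :=
    Finset.sum_nonneg fun i _ => Finset.sum_nonneg fun j _ => ind_nonneg _
  split_ifs with h
  · obtain ⟨hne, hnd⟩ := h
    have hcu := Finset.card_union_add_card_inter (gr e v) (gr e v')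
    rw [card_gr he, card_gr he, card_inter_gr he] at hcu
    have hpos : 0 < (univ.filter fun i => v i = v' i).card := by
      rw [← card_inter_gr he, Finset.card_pos, Finset.nonempty_iff_ne_empty]
      rwa [Finset.disjoint_iff_inter_eq_empty] at hnd
    have hlt : (univ.filter fun i => v i = v' i).card < 3 := by
      by_contra hge
      exact hne (h3 (by omega))
    obtain hc | hc : (univ.filter fun i => v i = v' i).card = 1 ∨
      (univ.filter fun i => v i = v' i).card = 2 := by omega
    · rw [show (gr e v ∪ gr e v').card = 2 * r - 1 by omega]
      obtain ⟨i, hi⟩ := Finset.card_pos.1 hpos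
      simp only [Finset.mem_filter, Finset.mem_univ, true_and] at hi
      have h1 : 1 ≤ ∑ i, ind (v i = v' i) := by
        rw [← ind_true hi]
        exact Finset.single_le_sum (f := fun i => ind (v i = v' i)) (fun i _ => ind_nonneg _) (Finset.mem_univ i)
      have : 0 ≤ p ^ (2 * r - 1) := by positivity
      have : 0 ≤ p ^ (2 * r - 2) := by positivity
      nlinarith [mul_nonneg hn2 this]
    · rw [show (gr e v ∪ gr e v').card = 2 * r - 2 by omega]
      obtain ⟨i, hi, j, hj, hij⟩ := Finset.one_lt_card.1 (show 1 < (univ.filter fun i => v i = v' i).card by omega)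
      simp only [Finset.mem_filter, Finset.mem_univ, true_and] at hi hj
      have h1 : 1 ≤ ∑ i, ∑ j, ind (i ≠ j ∧ v i = v' i ∧ v j = v' j) := by
        calc (1 : ℝ) = ind (i ≠ j ∧ v i = v' i ∧ v j = v' j) := (ind_true ⟨hij, hi, hj⟩).symm
          _ ≤ ∑ j, ind (i ≠ j ∧ v i = v' i ∧ v j = v' j) :=
            Finset.single_le_sum (f := fun j => ind (i ≠ j ∧ v i = v' i ∧ v j = v' j))
              (fun j _ => ind_nonneg _) (Finset.mem_univ j)
          _ ≤ _ := Finset.single_le_sum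
              (f := fun i => ∑ j, ind (i ≠ j ∧ v i = v' i ∧ v j = v' j))
              (fun i _ => Finset.sum_nonneg fun j _ => ind_nonneg _) (Finset.mem_univ i)
      have h2 : 0 ≤ p ^ (2 * r - 1) := by positivity
      have : 0 ≤ p ^ (2 * r - 2) := by positivity
      nlinarith [mul_nonneg hn1 h2]
  · positivity

lemma count_collisions {ι κ : Type*} [Fintype κ] (I : Finset ι) (f : ι → κ) (M : ℝ)
    (hM : ∀ c, ((I.filter fun v => f v = c).card : ℝ) ≤ M) :
    ∑ v ∈ I, ∑ v' ∈ I, ind (f v = f v') ≤ Fintype.card κ * M ^ 2 := by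
  have h1 : ∑ v ∈ I, ∑ v' ∈ I, ind (f v = f v')
      = ∑ c : κ, ((I.filter fun v => f v = c).card : ℝ) ^ 2 := by
    have h2 : ∀ v ∈ I, ∀ v' ∈ I, ind (f v = f v') = ∑ c : κ, ind (f v = c) * ind (f v' = c) := by
      intro v _ v' _
      rw [Finset.sum_eq_single (f v)]
      · rw [ind_true rfl, one_mul]; congr 1; exact propext eq_comm
      · intro c _ hc; rw [ind_false (fun h => hc h.symm), zero_mul]
      · simp
    rw [Finset.sum_congr rfl fun v hv => Finset.sum_congr rfl fun v' hv' => h2 v hv v' hv']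
    have h3 : ∀ c, ((I.filter fun v => f v = c).card : ℝ) = ∑ v ∈ I, ind (f v = c) := by
      intro c; rw [Finset.card_filter]; push_cast; rfl
    simp_rw [h3, sq, Finset.sum_mul_sum]
    rw [Finset.sum_congr rfl fun v _ => Finset.sum_comm]
    rw [Finset.sum_comm]
  rw [h1]
  calc ∑ c : κ, ((I.filter fun v => f v = c).card : ℝ) ^ 2 ≤ ∑ c : κ, M ^ 2 :=
        Finset.sum_le_sum fun c _ => pow_le_pow_left₀ (by positivity) (hM c) 2
    _ = _ := by simp

lemma family_bound {G : Type*} [Fintype G] {r : ℕ} {e : Fin r → Fin 4}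
    (he : Function.Injective e) {p : ℝ} (h0 : 0 ≤ p) (h1 : p ≤ 1) (I : Finset (Fin r → G))
    (M1 M2 : ℝ) (hM1 : ∀ i c, ((I.filter fun v => v i = c).card : ℝ) ≤ M1)
    (hM2 : ∀ i j, i ≠ j → ∀ c d, ((I.filter fun v => v i = c ∧ v j = d).card : ℝ) ≤ M2)
    (h3 : ∀ v ∈ I, ∀ v' ∈ I, 3 ≤ (univ.filter fun i => v i = v' i).card → v = v')
    (q : ℝ) (hq0 : 0 ≤ q) (hq1 : q ≤ 1) :
    Ex p (fun V => ind (∀ v ∈ I, ¬ gr e v ⊆ V)) ≤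
      Real.exp (-(q * (I.card * p ^ r)) + q ^ 2 / 2 *
        (r * (Fintype.card G * M1 ^ 2) * p ^ (2 * r - 1) +
          r ^ 2 * ((Fintype.card G) ^ 2 * M2 ^ 2) * p ^ (2 * r - 2))) := by
  refine (janson h0 h1 (gr e) I q hq0 hq1).trans (Real.exp_le_exp.2 ?_)
  have e1 : ∑ i ∈ I, p ^ (gr e i).card = I.card * p ^ r := by
    simp [card_gr he]
  rw [e1]
  gcongr
  refine le_trans (Finset.sum_le_sum fun v hv => Finset.sum_le_sum fun v' hv' =>
    (le_of_eq (by congr!)).trans (pair_bound he h0 v v' (h3 v hv v' hv'))) ?_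
  calc _ = (∑ v ∈ I, ∑ v' ∈ I, ∑ i, ind (v i = v' i)) * p ^ (2 * r - 1) +
        (∑ v ∈ I, ∑ v' ∈ I, ∑ i, ∑ j, ind (i ≠ j ∧ v i = v' i ∧ v j = v' j))
          * p ^ (2 * r - 2) := by
        simp only [Finset.sum_add_distrib, Finset.sum_mul]
    _ ≤ _ := by
        gcongr
        · have : ∑ v ∈ I, ∑ v' ∈ I, ∑ i, ind (v i = v' i)
              = ∑ i : Fin r, ∑ v ∈ I, ∑ v' ∈ I, ind (v i = v' i) := by
            rw [Finset.sum_congr rfl fun v _ => Finset.sum_comm]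
            rw [Finset.sum_comm]
          rw [this]
          calc _ ≤ ∑ i : Fin r, (Fintype.card G * M1 ^ 2 : ℝ) :=
                Finset.sum_le_sum fun i _ => count_collisions I (fun v => v i) M1 (hM1 i)
            _ = _ := by simp
        · have : ∑ v ∈ I, ∑ v' ∈ I, ∑ i, ∑ j, ind (i ≠ j ∧ v i = v' i ∧ v j = v' j)
              = ∑ i : Fin r, ∑ j : Fin r, ∑ v ∈ I, ∑ v' ∈ I,
                ind (i ≠ j ∧ v i = v' i ∧ v j = v' j) := by
            rw [Finset.sum_congr rfl fun v _ => Finset.sum_comm]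
            rw [Finset.sum_comm]
            refine Finset.sum_congr rfl fun i _ => ?_
            rw [Finset.sum_congr rfl fun v _ => Finset.sum_comm]
            rw [Finset.sum_comm]
          rw [this]
          calc _ ≤ ∑ i : Fin r, ∑ j : Fin r, ((Fintype.card G) ^ 2 * M2 ^ 2 : ℝ) := by
                refine Finset.sum_le_sum fun i _ => Finset.sum_le_sum fun j _ => ?_
                by_cases hij : i = j
                · calc _ = (0 : ℝ) := Finset.sum_eq_zero fun v _ => Finset.sum_eq_zero
                          fun v' _ => ind_false (by simp [hij])
                    _ ≤ _ := by positivity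
                · have := count_collisions I (fun v => (v i, v j)) M2 (by
                    rintro ⟨c, d⟩
                    simpa using hM2 i j hij c d)
                  simpa [hij, sq] using this
            _ = _ := by simp; ring


/-! ### The two families: additive quadruples and triples -/

lemma agree_of_ne {G : Type*} {r : ℕ} (v v' : Fin r → G)
    (h : r - 1 ≤ (univ.filter fun i => v i = v' i).card) (i : Fin r) (hi : v i ≠ v' i) :
    ∀ j, j ≠ i → v j = v' j := by
  intro j hj
  by_contra hne
  have hsub : (univ.filter fun i => v i = v' i) ⊆ (univ \ {i, j}) := by
    intro k hk
    simp only [Finset.mem_filter, Finset.mem_univ, true_and] at hk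
    simp only [Finset.mem_sdiff, Finset.mem_univ, true_and, Finset.mem_insert,
      Finset.mem_singleton, not_or]
    exact ⟨fun h => hi (h ▸ hk), fun h => hne (h ▸ hk)⟩
  have h2 := Finset.card_le_card hsub
  rw [Finset.card_sdiff_of_subset (Finset.subset_univ _), Finset.card_pair (Ne.symm hj)] at h2
  simp at h2
  have := i.2
  have := j.2
  have : (i : ℕ) ≠ j := fun h => hj (Fin.ext h.symm)
  omega

lemma quad_three {G : Type*} [AddCommGroup G] (v v' : Fin 4 → G)
    (hv : v 0 + v 1 = v 2 + v 3) (hv' : v' 0 + v' 1 = v' 2 + v' 3)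
    (h : 3 ≤ (univ.filter fun i => v i = v' i).card) : v = v' := by
  by_contra hne
  obtain ⟨i, hi⟩ := Function.ne_iff.1 hne
  have hj := agree_of_ne v v' h i hi
  apply hi
  fin_cases i
  · have h1 := hj 1 (by decide); have h2 := hj 2 (by decide); have h3 := hj 3 (by decide)
    rw [h1, h2, h3, ← hv'] at hv
    exact add_right_cancel hv
  · have h1 := hj 0 (by decide); have h2 := hj 2 (by decide); have h3 := hj 3 (by decide)
    rw [h1, h2, h3, ← hv'] at hv
    exact add_left_cancel hv
  · have h1 := hj 0 (by decide); have h2 := hj 1 (by decide); have h3 := hj 3 (by decide)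
    rw [h1, h2, h3, hv'] at hv
    exact (add_right_cancel hv).symm
  · have h1 := hj 0 (by decide); have h2 := hj 1 (by decide); have h3 := hj 2 (by decide)
    rw [h1, h2, h3, hv'] at hv
    exact (add_left_cancel hv).symm

lemma three_agree {G : Type*} {r : ℕ} (v v' : Fin r → G) (i j k : Fin r) (hij : i ≠ j)
    (hik : i ≠ k) (hjk : j ≠ k) (h1 : v i = v' i) (h2 : v j = v' j) (h3 : v k = v' k) :
    3 ≤ (univ.filter fun i => v i = v' i).card := by
  have : ({i, j, k} : Finset (Fin r)) ⊆ univ.filter fun i => v i = v' i := by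
    intro l hl
    simp only [Finset.mem_insert, Finset.mem_singleton] at hl
    rcases hl with rfl | rfl | rfl <;> simp [*]
  have h := Finset.card_le_card this
  rwa [Finset.card_eq_three.2 ⟨i, j, k, hij, hik, hjk, rfl⟩] at h

lemma quad_bound {G : Type*} [AddCommGroup G] [Fintype G] {p : ℝ} (h0 : 0 ≤ p) (h1 : p ≤ 1)
    (I : Finset (Fin 4 → G)) (hI : ∀ v ∈ I, v 0 + v 1 = v 2 + v 3) {ε : ℝ} (hε0 : 0 < ε)
    (hε1 : ε ≤ 1) (hcard : ε * (Fintype.card G : ℝ) ^ 3 ≤ I.card)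
    (hnp : 1 ≤ Fintype.card G * p) (hD : 1 ≤ (Fintype.card G : ℝ) ^ 2 * p ^ 3) :
    Ex p (fun V => ind (∀ v ∈ I, ¬ gr id v ⊆ V)) ≤
      Real.exp (-(ε ^ 2 * (Fintype.card G * p) / 40)) := by
  set n : ℝ := (Fintype.card G : ℝ) with hn
  have hq1 : ε / (20 * (n ^ 2 * p ^ 3)) ≤ 1 := by
    rw [div_le_one (by positivity)]; linarith
  refine (family_bound (e := id) Function.injective_id h0 h1 I (n ^ 2) n ?_ ?_ ?_
    (ε / (20 * (n ^ 2 * p ^ 3))) (by positivity) hq1).trans ?_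
  · intro i c
    have : (I.filter fun v => v i = c).card ≤ (univ : Finset (G × G)).card := by
      refine Finset.card_le_card_of_injOn (fun v => (v (i.succAbove 0), v (i.succAbove 1)))
        (fun _ _ => Finset.mem_coe.2 (Finset.mem_univ _)) ?_
      intro v hv v' hv' h
      simp only [Finset.coe_filter, Set.mem_ofPred_eq, Prod.mk.injEq] at hv hv' h
      exact quad_three v v' (hI v hv.1) (hI v' hv'.1)
        (three_agree v v' i (i.succAbove 0) (i.succAbove 1) (Fin.succAbove_ne i 0).symm
          (Fin.succAbove_ne i 1).symm (by simp) (by rw [hv.2, hv'.2]) h.1 h.2)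
    rw [hn]
    rw [Finset.card_univ, Fintype.card_prod] at this
    calc _ ≤ ((Fintype.card G * Fintype.card G : ℕ) : ℝ) := by exact_mod_cast this
      _ = _ := by push_cast; ring
  · intro i j hij c d
    obtain ⟨k, hk⟩ : ∃ k : Fin 4, k ≠ i ∧ k ≠ j := by
      revert i j; decide
    have : (I.filter fun v => v i = c ∧ v j = d).card ≤ (univ : Finset G).card := by
      refine Finset.card_le_card_of_injOn (fun v => v k)
        (fun _ _ => Finset.mem_coe.2 (Finset.mem_univ _)) ?_
      intro v hv v' hv' h
      simp only [Finset.coe_filter, Set.mem_ofPred_eq] at hv hv' h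
      exact quad_three v v' (hI v hv.1) (hI v' hv'.1)
        (three_agree v v' i j k hij hk.1.symm hk.2.symm (by rw [hv.2.1, hv'.2.1])
          (by rw [hv.2.2, hv'.2.2]) h)
    rw [hn]; exact_mod_cast this
  · intro v hv v' hv' h
    exact quad_three v v' (hI v hv) (hI v' hv') h
  · apply Real.exp_le_exp.2
    set D := n ^ 2 * p ^ 3 with hDd
    have hD0 : 0 < D := by linarith
    have e1 : ε / (20 * D) * (ε * n ^ 3 * p ^ 4) = ε ^ 2 * (n * p) / 20 := by
      have : ε * n ^ 3 * p ^ 4 = ε * (n * p) * D := by rw [hDd]; ring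
      rw [this]; field_simp
    have e2 : ε / (20 * D) * (ε * n ^ 3 * p ^ 4) ≤ ε / (20 * D) * (I.card * p ^ 4) := by
      gcongr
    have e3 : ((4 : ℕ) : ℝ) * (n * (n ^ 2) ^ 2) * p ^ (2 * 4 - 1) + ((4 : ℕ) : ℝ) ^ 2 * (n ^ 2 * n ^ 2) * p ^ (2 * 4 - 2)
        ≤ 20 * (n * p) * D ^ 2 := by
      have : ((4 : ℕ) : ℝ) * (n * (n ^ 2) ^ 2) * p ^ (2 * 4 - 1) + ((4 : ℕ) : ℝ) ^ 2 * (n ^ 2 * n ^ 2) * p ^ (2 * 4 - 2) = 4 * (n * p) * D ^ 2 + 16 * D ^ 2 := by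
        rw [hDd]; norm_num; ring
      rw [this]
      nlinarith [sq_nonneg D, mul_le_mul_of_nonneg_right hnp (sq_nonneg D)]
    have e4 : (ε / (20 * D)) ^ 2 / 2 * (20 * (n * p) * D ^ 2) = ε ^ 2 * (n * p) / 40 := by
      field_simp; ring
    have e5 := mul_le_mul_of_nonneg_left e3 (show 0 ≤ (ε / (20 * D)) ^ 2 / 2 by positivity)
    rw [e4] at e5
    linarith

/-- The family of triples. -/
def tri {G : Type*} [AddCommGroup G] [Fintype G] (B X : Finset G) : Finset (Fin 3 → G) :=
  univ.filter fun v => v 0 + v 1 - v 2 ∈ B ∧ ∀ i, v i ∉ X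

lemma card_tri {G : Type*} [AddCommGroup G] [Fintype G] (B X : Finset G)
    (hX : (X.card : ℝ) ≤ Fintype.card G / 6) :
    (B.card : ℝ) * (Fintype.card G : ℝ) ^ 2 / 2 ≤ (tri B X).card := by
  set n := Fintype.card G with hn
  set T : Finset (G × G × G) := B ×ˢ (univ : Finset G) ×ˢ (univ : Finset G) with hT
  set T1 := B ×ˢ X ×ˢ (univ : Finset G)
  set T2 := B ×ˢ (univ : Finset G) ×ˢ X
  set T3 := T.filter fun t => t.2.1 + t.2.2 - t.1 ∈ X with hT3
  have c0 : T.card = B.card * n ^ 2 := by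
    simp [hT, Finset.card_product, Finset.card_univ, sq, hn]
  have c1 : T1.card = B.card * X.card * n := by
    simp [T1, Finset.card_product, Finset.card_univ, hn]; ring
  have c2 : T2.card = B.card * X.card * n := by
    simp [T2, Finset.card_product, Finset.card_univ, hn]; ring
  have c3 : T3.card ≤ B.card * X.card * n := by
    rw [← c2]
    refine Finset.card_le_card_of_injOn (fun t => (t.1, t.2.1, t.2.1 + t.2.2 - t.1)) ?_ ?_
    · intro t ht
      simp only [hT3, hT, Finset.coe_filter, Set.mem_ofPred_eq, Finset.mem_product] at ht
      simp [T2, ht.1.1, ht.2]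
    · rintro ⟨a, b, c⟩ _ ⟨a', b', c'⟩ _ h
      simp only [Prod.mk.injEq] at h
      obtain ⟨rfl, rfl, h⟩ := h
      simpa using h
  have c4 : (T \ (T1 ∪ T2 ∪ T3)).card ≤ (tri B X).card := by
    refine Finset.card_le_card_of_injOn (fun t => ![t.2.1, t.2.2, t.2.1 + t.2.2 - t.1]) ?_ ?_
    · rintro ⟨b, x, y⟩ ht
      simp only [hT, T1, T2, hT3, Finset.coe_sdiff, Set.mem_sdiff, Finset.mem_coe,
        Finset.mem_product, Finset.mem_univ, Finset.mem_union, Finset.mem_filter, and_true,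
        true_and, not_or, not_and] at ht
      obtain ⟨hb, ⟨h1, h2⟩, h3⟩ := ht
      simp only [tri, Finset.coe_filter, Set.mem_ofPred_eq, Finset.mem_univ, true_and]
      refine ⟨by simpa using hb, ?_⟩
      intro i
      fin_cases i
      · simpa using h1 hb
      · simpa using h2 hb
      · simpa using h3 hb
    · rintro ⟨a, b, c⟩ _ ⟨a', b', c'⟩ _ h
      have h0 := congrFun h 0
      have h1 := congrFun h 1
      have h2 := congrFun h 2
      simp at h0 h1 h2
      subst h0 h1
      simp at h2
      simp [h2]
  have c5 : T.card ≤ (tri B X).card + (T1.card + T2.card + T3.card) := by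
    have h1 := Finset.card_le_card_sdiff_add_card (s := T) (t := T1 ∪ T2 ∪ T3)
    have h2 := Finset.card_union_le (T1 ∪ T2) T3
    have h3 := Finset.card_union_le T1 T2
    omega
  have c6 : (B.card * n ^ 2 : ℝ) ≤ (tri B X).card + 3 * (B.card * X.card * n) := by
    have : B.card * n ^ 2 ≤ (tri B X).card + 3 * (B.card * X.card * n) := by omega
    exact_mod_cast this
  have c7 : (B.card : ℝ) * X.card * n ≤ B.card * (n / 6) * n := by gcongr
  nlinarith

lemma tri_bound {G : Type*} [AddCommGroup G] [Fintype G] {p : ℝ} (h0 : 0 ≤ p) (h1 : p ≤ 1)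
    (B X : Finset G) (hB : B.Nonempty) (hX : (X.card : ℝ) ≤ Fintype.card G / 6)
    (hnp : 1 ≤ Fintype.card G * p) :
    Ex p (fun V => ind (∀ v ∈ tri B X, ¬ gr Fin.castSucc v ⊆ V)) ≤
      Real.exp (-(B.card * ((Fintype.card G : ℝ) ^ 2 * p ^ 3) / 4)) +
      Real.exp (-(Fintype.card G * p / 96)) := by
  set n : ℝ := (Fintype.card G : ℝ) with hn
  set b : ℝ := (B.card : ℝ) with hb
  have hb1 : 1 ≤ b := by rw [hb]; exact_mod_cast hB.card_pos
  have hn0 : 0 ≤ n := by rw [hn]; positivity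
  have hp0 : 0 < p := by
    rcases h0.lt_or_eq with h | h
    · exact h
    · rw [← h] at hnp; norm_num at hnp
  have hn0' : 0 < n := by
    rcases hn0.lt_or_eq with h | h
    · exact h
    · rw [← h] at hnp; norm_num at hnp
  have hinj : ∀ v v' : Fin 3 → G, ∀ i j : Fin 3, i ≠ j → v i = v' i → v j = v' j →
      v 0 + v 1 - v 2 = v' 0 + v' 1 - v' 2 → v = v' := by
    intro v v' i j hij hi hj hs
    funext k
    fin_cases i <;> fin_cases j <;> fin_cases k <;> simp_all
  have key : ∀ q : ℝ, 0 ≤ q → q ≤ 1 →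
      Ex p (fun V => ind (∀ v ∈ tri B X, ¬ gr Fin.castSucc v ⊆ V)) ≤
      Real.exp (-(q * (b * (n ^ 2 * p ^ 3) / 2)) + q ^ 2 * (6 * b ^ 2 * n ^ 3 * p ^ 5)) := by
    intro q hq0 hq1
    refine (family_bound (e := Fin.castSucc) (Fin.castSucc_injective 3) h0 h1 (tri B X)
      (n * b) b ?_ ?_ ?_ q hq0 hq1).trans ?_
    · intro i c
      have : ((tri B X).filter fun v => v i = c).card ≤ ((univ : Finset G) ×ˢ B).card := by
        refine Finset.card_le_card_of_injOn (fun v => (v (i.succAbove 0), v 0 + v 1 - v 2)) ?_ ?_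
        · intro v hv
          simp only [tri, Finset.coe_filter, Set.mem_ofPred_eq, Finset.mem_filter] at hv
          simp [hv.1.2.1]
        · intro v hv v' hv' h
          simp only [Finset.coe_filter, Set.mem_ofPred_eq, Prod.mk.injEq] at hv hv' h
          exact hinj v v' i (i.succAbove 0) (Fin.succAbove_ne i 0).symm (by rw [hv.2, hv'.2])
            h.1 h.2
      rw [Finset.card_product, Finset.card_univ] at this
      rw [hn, hb]; exact_mod_cast this
    · intro i j hij c d
      have : ((tri B X).filter fun v => v i = c ∧ v j = d).card ≤ B.card := by
        refine Finset.card_le_card_of_injOn (fun v => v 0 + v 1 - v 2) ?_ ?_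
        · intro v hv
          simp only [tri, Finset.coe_filter, Set.mem_ofPred_eq, Finset.mem_filter] at hv
          simp [hv.1.2.1]
        · intro v hv v' hv' h
          simp only [Finset.coe_filter, Set.mem_ofPred_eq] at hv hv' h
          exact hinj v v' i j hij (by rw [hv.2.1, hv'.2.1]) (by rw [hv.2.2, hv'.2.2]) h
      rw [hb]; exact_mod_cast this
    · intro v hv v' hv' h
      have h2 : (univ.filter fun i => v i = v' i) = univ := by
        apply Finset.eq_univ_of_card
        have := Finset.card_le_univ (univ.filter fun i => v i = v' i)
        simp only [Fintype.card_fin] at this ⊢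
        omega
      funext i
      have := Finset.mem_univ i
      rw [← h2] at this
      exact (Finset.mem_filter.1 this).2
    · apply Real.exp_le_exp.2
      have e0 := card_tri B X hX
      rw [← hn, ← hb] at e0
      have e2 : q * (b * (n ^ 2 * p ^ 3) / 2) ≤ q * ((tri B X).card * p ^ 3) := by
        have : b * (n ^ 2 * p ^ 3) / 2 = (b * n ^ 2 / 2) * p ^ 3 := by ring
        rw [this]
        gcongr
      have e3 : ((3 : ℕ) : ℝ) * (n * (n * b) ^ 2) * p ^ (2 * 3 - 1)
          + ((3 : ℕ) : ℝ) ^ 2 * (n ^ 2 * b ^ 2) * p ^ (2 * 3 - 2) ≤ 12 * b ^ 2 * n ^ 3 * p ^ 5 := by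
        have : ((3 : ℕ) : ℝ) * (n * (n * b) ^ 2) * p ^ (2 * 3 - 1)
          + ((3 : ℕ) : ℝ) ^ 2 * (n ^ 2 * b ^ 2) * p ^ (2 * 3 - 2) =
            3 * b ^ 2 * n ^ 3 * p ^ 5 + 9 * (n ^ 2 * b ^ 2 * p ^ 4) := by norm_num; ring
        rw [this]
        have h := mul_le_mul_of_nonneg_right hnp (show 0 ≤ n ^ 2 * b ^ 2 * p ^ 4 by positivity)
        nlinarith
      have e5 := mul_le_mul_of_nonneg_left e3 (show 0 ≤ q ^ 2 / 2 by positivity)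
      nlinarith
  by_cases hc : 24 * b * n * p ^ 2 ≤ 1
  · refine (key 1 zero_le_one le_rfl).trans ?_
    refine le_trans (Real.exp_le_exp.2 ?_) (le_add_of_nonneg_right (Real.exp_pos _).le)
    have h := mul_le_mul_of_nonneg_right hc (show 0 ≤ b * n ^ 2 * p ^ 3 by positivity)
    nlinarith
  · push Not at hc
    have hpos : 0 < 24 * b * n * p ^ 2 := by linarith
    refine (key (1 / (24 * b * n * p ^ 2)) (by positivity)
      (by rw [div_le_one hpos]; exact hc.le)).trans ?_
    refine le_trans (Real.exp_le_exp.2 ?_) (le_add_of_nonneg_left (Real.exp_pos _).le)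
    apply le_of_eq
    field_simp
    norm_num


/-! ### The coupling -/

lemma eq_of_sum_powerset {G : Type*} (μ ν : Finset G → ℝ)
    (h : ∀ A : Finset G, ∑ B ∈ A.powerset, μ B = ∑ B ∈ A.powerset, ν B) (A : Finset G) :
    μ A = ν A := by
  induction A using Finset.strongInduction with
  | _ A ih =>
    have h1 := h A
    have hA : A ∈ A.powerset := Finset.mem_powerset_self A
    rw [← Finset.add_sum_erase _ _ hA, ← Finset.add_sum_erase _ _ hA] at h1
    have h2 : ∑ B ∈ A.powerset.erase A, μ B = ∑ B ∈ A.powerset.erase A, ν B := by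
      refine Finset.sum_congr rfl fun B hB => ih B ?_
      rw [Finset.mem_erase, Finset.mem_powerset] at hB
      exact Finset.ssubset_iff_subset_ne.2 ⟨hB.2, hB.1⟩
    linarith

/-- The union of the projections. -/
def UU {G : Type*} (S R : Finset (G × Fin 4)) : Finset G := S.image Prod.fst ∪ R.image Prod.fst

lemma mem_UU {G : Type*} {S R : Finset (G × Fin 4)} {u : G} :
    u ∈ UU S R ↔ (∃ i, (u, i) ∈ S) ∨ ∃ i, (u, i) ∈ R := by
  simp [UU]

lemma ind_forall_mem {Ω : Type*} (V : Finset Ω) (P : Ω → Prop) :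
    ind (∀ ω ∈ V, P ω) = ∏ ω ∈ V, ind (P ω) := by
  by_cases h : ∀ ω ∈ V, P ω
  · rw [ind_true h, Finset.prod_eq_one]
    intro ω hω; exact ind_true (h ω hω)
  · rw [ind_false h]
    push Not at h
    obtain ⟨ω, hω, h⟩ := h
    exact (Finset.prod_eq_zero hω (ind_false h)).symm

lemma coupling {G : Type*} [Fintype G] {p p1 p2 : ℝ}
    (hp : (1 - p1) ^ 4 * (1 - p2) ^ 4 = 1 - p) (F : Finset G → ℝ) :
    Ex p F = Ex p1 (fun S : Finset (G × Fin 4) => Ex p2 (fun R : Finset (G × Fin 4) =>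
      F (UU S R))) := by
  have key : ∀ A : Finset G, bernWeight p A = Ex p1 (fun S : Finset (G × Fin 4) =>
      Ex p2 (fun R : Finset (G × Fin 4) => ind (UU S R = A))) := by
    apply eq_of_sum_powerset
    intro A
    have e1 : ∑ B ∈ A.powerset, bernWeight p B = Ex p (fun V => ind (∀ u ∈ V, u ∈ A)) := by
      unfold Ex ind
      simp only [mul_ite, mul_one, mul_zero]
      rw [← Finset.sum_filter]
      refine Finset.sum_congr ?_ fun _ _ => rfl
      ext B
      simp [Finset.subset_iff]
    have e2 : ∀ S R : Finset (G × Fin 4), ∑ B ∈ A.powerset, ind (UU S R = B) =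
        (∏ ω ∈ S, ind (ω.1 ∈ A)) * ∏ ω ∈ R, ind (ω.1 ∈ A) := by
      intro S R
      rw [← ind_forall_mem, ← ind_forall_mem, ← ind_and]
      have hh : ∑ B ∈ A.powerset, ind (UU S R = B) = ind (UU S R ∈ A.powerset) := by
        by_cases hm : UU S R ∈ A.powerset
        · rw [Finset.sum_eq_single (UU S R), ind_true rfl, ind_true hm]
          · exact fun B _ hB => ind_false (Ne.symm hB)
          · exact fun h => absurd hm h
        · rw [ind_false hm]
          refine Finset.sum_eq_zero fun B hB => ind_false ?_
          rintro rfl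
          exact hm hB
      rw [hh]
      congr 1
      apply propext
      rw [Finset.mem_powerset, UU, Finset.union_subset_iff, Finset.image_subset_iff,
        Finset.image_subset_iff]
    have e3 : ∀ q : ℝ, Ex q (fun S : Finset (G × Fin 4) => ∏ ω ∈ S, ind (ω.1 ∈ A)) =
        ∏ u : G, (q * ind (u ∈ A) + (1 - q)) ^ 4 := by
      intro q
      rw [Ex_prod, Fintype.prod_prod_type]
      refine Finset.prod_congr rfl fun u _ => ?_
      simp
    rw [e1]
    simp_rw [ind_forall_mem]
    rw [Ex_prod]
    rw [← Ex_sum]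
    simp_rw [← Ex_sum, e2, Ex_const_mul]
    have : ∀ S : Finset (G × Fin 4), (∏ ω ∈ S, ind (ω.1 ∈ A)) *
        Ex p2 (fun R : Finset (G × Fin 4) => ∏ ω ∈ R, ind (ω.1 ∈ A)) =
        Ex p2 (fun R : Finset (G × Fin 4) => ∏ ω ∈ R, ind (ω.1 ∈ A)) *
        (∏ ω ∈ S, ind (ω.1 ∈ A)) := fun S => mul_comm _ _
    simp_rw [this]
    rw [Ex_const_mul, e3, e3, ← Finset.prod_mul_distrib]
    refine Finset.prod_congr rfl fun u _ => ?_
    by_cases hu : u ∈ A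
    · simp [ind_true hu]
    · simp [ind_false hu, ← hp, mul_comm]
  have e : Ex p F = ∑ A : Finset G, F A * bernWeight p A :=
    Finset.sum_congr rfl fun A _ => mul_comm _ _
  rw [e]
  simp_rw [key, ← Ex_const_mul]
  rw [← Ex_sum]
  simp_rw [← Ex_sum]
  congr 1
  funext S
  congr 1
  funext R
  unfold ind
  simp

lemma randomSubsetProb_eq {G : Type*} [Fintype G] (p : ℝ) (E : Finset G → Prop) :
    randomSubsetProb G p E = Ex p (fun V => ind (E V)) := by
  unfold randomSubsetProb Ex ind
  refine Finset.sum_congr rfl fun V _ => ?_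
  by_cases h : E V <;> simp [h]


/-! ### Linearity testing -/

lemma card_filter_pair {G : Type*} [Fintype G] (P : G → G → Prop)
    [∀ a b, Decidable (P a b)] :
    ((univ.filter fun q : G × G => P q.1 q.2).card : ℝ) =
      ∑ y : G, ((univ.filter fun y' : G => P y y').card : ℝ) := by
  rw [← Nat.cast_sum]
  congr 1
  simp only [Finset.card_filter]
  rw [Fintype.sum_prod_type]

lemma card_compl_filter {α : Type*} [Fintype α] (P : α → Prop) :
    ((univ.filter fun a => ¬ P a).card : ℝ) =
      Fintype.card α - ((univ.filter fun a => P a).card : ℝ) := by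
  have := Finset.card_filter_add_card_filter_not (s := (univ : Finset α)) P
  rw [Finset.card_univ] at this
  rw [← this]
  push_cast
  ring

lemma blr0 {G H : Type*} [AddCommGroup G] [Fintype G] [AddCommGroup H] (k : G → H) {ε : ℝ}
    (hε : 6 * ε < 1)
    (hM : ((univ.filter fun q : G × G => ¬ k (q.1 + q.2) = k q.1 + k q.2).card : ℝ) ≤
      ε * (Fintype.card G : ℝ) ^ 2) :
    ∃ K : G →+ H, ((univ.filter fun x => ¬ k x = K x).card : ℝ) ≤ 2 * ε * Fintype.card G := by
  set n : ℝ := (Fintype.card G : ℝ) with hn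
  set M := univ.filter fun q : G × G => ¬ k (q.1 + q.2) = k q.1 + k q.2 with hMd
  have hn0 : 0 < n := by rw [hn]; exact_mod_cast Fintype.card_pos
  have hε0 : 0 ≤ ε := by
    have h1 : (0 : ℝ) ≤ M.card := by positivity
    have h2 : 0 < n ^ 2 := by positivity
    by_contra h
    push Not at h
    nlinarith
  have pop : ∀ x, ∃ c : H, ((univ.filter fun y => ¬ k (x + y) - k y = c).card : ℝ) ≤ 2 * ε * n := by
    intro x
    have hD : ((univ.filter fun q : G × G =>
        ¬ k (x + q.2) - k q.2 = k (x + q.1) - k q.1).card : ℝ) ≤ 2 * ε * n ^ 2 := by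
      have hsub : (univ.filter fun q : G × G =>
        ¬ k (x + q.2) - k q.2 = k (x + q.1) - k q.1) ⊆
          (univ.filter fun q : G × G => (x + q.1, q.2) ∈ M) ∪
          (univ.filter fun q : G × G => (x + q.2, q.1) ∈ M) := by
        intro q hq
        simp only [hMd, Finset.mem_filter, Finset.mem_univ, true_and, Finset.mem_union] at hq ⊢
        by_contra hcon
        push Not at hcon
        apply hq
        rw [sub_eq_sub_iff_add_eq_add, ← hcon.1, ← hcon.2]
        congr 1
        abel
      have c1 : (univ.filter fun q : G × G => (x + q.1, q.2) ∈ M).card ≤ M.card := by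
        refine Finset.card_le_card_of_injOn (fun q => (x + q.1, q.2)) ?_ ?_
        · intro q hq; simpa using hq
        · rintro ⟨a, b⟩ _ ⟨a', b'⟩ _ h; simpa using h
      have c2 : (univ.filter fun q : G × G => (x + q.2, q.1) ∈ M).card ≤ M.card := by
        refine Finset.card_le_card_of_injOn (fun q => (x + q.2, q.1)) ?_ ?_
        · intro q hq; simpa using hq
        · rintro ⟨a, b⟩ _ ⟨a', b'⟩ _ h; simpa [and_comm] using h
      have c3 := (Finset.card_le_card hsub).trans (Finset.card_union_le _ _)
      have c4 : ((univ.filter fun q : G × G =>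
        ¬ k (x + q.2) - k q.2 = k (x + q.1) - k q.1).card : ℝ) ≤ M.card + M.card := by
        exact_mod_cast c3.trans (add_le_add c1 c2)
      linarith
    rw [card_filter_pair (fun y y' => ¬ k (x + y') - k y' = k (x + y) - k y)] at hD
    have : ∑ y : G, ((univ.filter fun y' : G => ¬ k (x + y') - k y' = k (x + y) - k y).card : ℝ)
        ≤ ∑ _y : G, 2 * ε * n := by
      refine hD.trans (le_of_eq ?_)
      rw [Finset.sum_const, Finset.card_univ, nsmul_eq_mul, ← hn]; ring
    obtain ⟨y, _, hy⟩ := Finset.exists_le_of_sum_le Finset.univ_nonempty this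
    exact ⟨_, hy⟩
  choose K hK using pop
  have hadd : ∀ x x', K (x + x') = K x + K x' := by
    intro x x'
    by_contra hne
    have hcov : (univ : Finset G) ⊆ (univ.filter fun y => ¬ k (x + y) - k y = K x) ∪
        (univ.filter fun y => ¬ k (x' + (x + y)) - k (x + y) = K x') ∪
        (univ.filter fun y => ¬ k ((x + x') + y) - k y = K (x + x')) := by
      intro y _
      simp only [Finset.mem_union, Finset.mem_filter, Finset.mem_univ, true_and]
      by_contra hcon
      push Not at hcon
      apply hne
      rw [← hcon.1.1, ← hcon.1.2, ← hcon.2, show x + x' + y = x' + (x + y) by abel]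
      abel
    have c1 : (univ.filter fun y => ¬ k (x' + (x + y)) - k (x + y) = K x').card ≤
        (univ.filter fun y => ¬ k (x' + y) - k y = K x').card := by
      refine Finset.card_le_card_of_injOn (fun y => x + y) ?_ ?_
      · intro q hq; simpa using hq
      · intro a _ b _ h; simpa using h
    have c2 := (Finset.card_le_card hcov).trans ((Finset.card_union_le _ _).trans
      (Nat.add_le_add_right (Finset.card_union_le _ _) _))
    rw [Finset.card_univ] at c2
    have c3 : n ≤ ((univ.filter fun y => ¬ k (x + y) - k y = K x).card : ℝ) +
      ((univ.filter fun y => ¬ k (x' + y) - k y = K x').card : ℝ) +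
      ((univ.filter fun y => ¬ k ((x + x') + y) - k y = K (x + x')).card : ℝ) := by
      rw [hn]
      exact_mod_cast c2.trans (by omega)
    have d1 := hK x
    have d2 := hK x'
    have d3 := hK (x + x')
    nlinarith
  refine ⟨AddMonoidHom.mk' K hadd, ?_⟩
  simp only [AddMonoidHom.mk'_apply]
  set W := univ.filter fun x => ¬ k x = K x with hW
  have hM2 : (M.card : ℝ) = ∑ x : G, ((univ.filter fun y => ¬ k (x + y) = k x + k y).card : ℝ) :=
    card_filter_pair (fun x y => ¬ k (x + y) = k x + k y)
  have hM3 : (W.card : ℝ) * ((1 - 2 * ε) * n) ≤ M.card := by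
    rw [hM2]
    calc (W.card : ℝ) * ((1 - 2 * ε) * n) = ∑ x ∈ W, (1 - 2 * ε) * n := by
          rw [Finset.sum_const, nsmul_eq_mul]
      _ ≤ ∑ x ∈ W, ((univ.filter fun y => ¬ k (x + y) = k x + k y).card : ℝ) := by
          refine Finset.sum_le_sum fun x hx => ?_
          rw [hW, Finset.mem_filter] at hx
          have h1 := hK x
          rw [card_compl_filter, ← hn] at h1
          have h2 : (univ.filter fun y => k (x + y) - k y = K x).card ≤
              (univ.filter fun y => ¬ k (x + y) = k x + k y).card := by
            refine Finset.card_le_card fun y hy => ?_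
            simp only [Finset.mem_filter, Finset.mem_univ, true_and] at hy ⊢
            intro h
            apply hx.2
            rw [← hy, h]; abel
          have h3 : ((univ.filter fun y => k (x + y) - k y = K x).card : ℝ) ≤
              ((univ.filter fun y => ¬ k (x + y) = k x + k y).card : ℝ) := by exact_mod_cast h2
          linarith
      _ ≤ _ := Finset.sum_le_sum_of_subset_of_nonneg (Finset.subset_univ _)
          (fun _ _ _ => by positivity)
  have h4 : (W.card : ℝ) * (1 - 2 * ε) ≤ ε * n := by
    have : ((W.card : ℝ) * (1 - 2 * ε)) * n ≤ (ε * n) * n := by nlinarith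
    exact le_of_mul_le_mul_right this hn0
  have h5 : (0 : ℝ) ≤ W.card := by positivity
  nlinarith

lemma blr {G H : Type*} [AddCommGroup G] [Fintype G] [AddCommGroup H] (g : G → H) {ε : ℝ}
    (hε : 6 * ε < 1)
    (hQ : ((univ.filter fun v : Fin 4 → G => v 0 + v 1 = v 2 + v 3 ∧
      ¬ g (v 0) + g (v 1) = g (v 2) + g (v 3)).card : ℝ) ≤ ε * (Fintype.card G : ℝ) ^ 3) :
    ∃ (ψ : G →+ H) (h : H),
      ((univ.filter fun x => ¬ g x = ψ x + h).card : ℝ) ≤ 2 * ε * Fintype.card G := by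
  set Q := univ.filter fun v : Fin 4 → G => v 0 + v 1 = v 2 + v 3 ∧
      ¬ g (v 0) + g (v 1) = g (v 2) + g (v 3) with hQd
  set n : ℝ := (Fintype.card G : ℝ) with hn
  have hz : ∃ z : G, ((univ.filter fun q : G × G =>
      ¬ g (q.1 + q.2 + z) - g z = (g (q.1 + z) - g z) + (g (q.2 + z) - g z)).card : ℝ) ≤
      ε * n ^ 2 := by
    have h1 : ((univ.filter fun t : G × (G × G) =>
      ¬ g (t.2.1 + t.2.2 + t.1) - g t.1 =
        (g (t.2.1 + t.1) - g t.1) + (g (t.2.2 + t.1) - g t.1)).card : ℝ) ≤ Q.card := by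
      refine Nat.cast_le.2 (Finset.card_le_card_of_injOn
        (fun t => ![t.2.1 + t.1, t.2.2 + t.1, t.2.1 + t.2.2 + t.1, t.1]) ?_ ?_)
      · rintro ⟨z, x, y⟩ ht
        simp only [Finset.coe_filter, Finset.mem_univ, true_and, Set.mem_ofPred_eq] at ht
        simp only [hQd, Finset.coe_filter, Finset.mem_univ, true_and, Set.mem_ofPred_eq]
        simp only [Matrix.cons_val]
        refine ⟨by abel, fun h => ht ?_⟩
        rw [sub_add_sub_comm, h]; abel
      · rintro ⟨a, b, c⟩ _ ⟨a', b', c'⟩ _ h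
        have h0 := congrFun h 0
        have h1 := congrFun h 1
        have h3 := congrFun h 3
        simp only [Matrix.cons_val] at h0 h1 h3
        subst h3
        simp only [add_left_inj] at h0 h1
        simp [h0, h1]
    have h2 : ((univ.filter fun t : G × (G × G) =>
      ¬ g (t.2.1 + t.2.2 + t.1) - g t.1 =
        (g (t.2.1 + t.1) - g t.1) + (g (t.2.2 + t.1) - g t.1)).card : ℝ) =
        ∑ z : G, ((univ.filter fun q : G × G =>
      ¬ g (q.1 + q.2 + z) - g z = (g (q.1 + z) - g z) + (g (q.2 + z) - g z)).card : ℝ) := by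
      rw [← Nat.cast_sum]
      congr 1
      simp only [Finset.card_filter]
      rw [Fintype.sum_prod_type]
    have h3 : ∑ z : G, ((univ.filter fun q : G × G =>
      ¬ g (q.1 + q.2 + z) - g z = (g (q.1 + z) - g z) + (g (q.2 + z) - g z)).card : ℝ) ≤
      ∑ _z : G, ε * n ^ 2 := by
      rw [← h2, Finset.sum_const, Finset.card_univ, nsmul_eq_mul, ← hn]
      calc _ ≤ _ := h1.trans hQ
        _ = _ := by ring
    obtain ⟨z, _, hz⟩ := Finset.exists_le_of_sum_le Finset.univ_nonempty h3
    exact ⟨z, hz⟩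
  obtain ⟨z, hz⟩ := hz
  obtain ⟨K, hK⟩ := blr0 (fun x => g (x + z) - g z) hε hz
  refine ⟨K, g z - K z, le_trans (Nat.cast_le.2 ?_) hK⟩
  refine Finset.card_le_card_of_injOn (fun x => x - z) ?_ ?_
  · intro x hx
    simp only [Finset.coe_filter, Finset.mem_univ, true_and, Set.mem_ofPred_eq] at hx ⊢
    intro h
    apply hx
    rw [sub_add_cancel, map_sub] at h
    rw [sub_eq_iff_eq_add.1 h]; abel
  · intro a _ b _ h; simpa using h


/-! ### Deterministic part: finite target -/

lemma char_average {H : Type*} [AddCommGroup H] [Fintype H] (a : H) (ha : a ≠ 0)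
    (P : AddChar H ℂ → Prop) (hP : ∀ ξ, ¬ P ξ → ‖ξ a - 1‖ ≤ 1 / 2) :
    (Fintype.card (AddChar H ℂ) : ℝ) ≤ 3 * ∑ ξ : AddChar H ℂ, ind (P ξ) := by
  have h0 : ∑ ξ : AddChar H ℂ, ξ a = 0 := by
    rw [AddChar.sum_apply_eq_ite, if_neg ha]
  have h1 : ∑ ξ : AddChar H ℂ, (ξ a).re = 0 := by
    rw [← Complex.re_sum, h0]; simp
  have h2 : ∀ ξ : AddChar H ℂ, 1 / 2 - 3 / 2 * ind (P ξ) ≤ (ξ a).re := by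
    intro ξ
    by_cases h : P ξ
    · rw [ind_true h]
      have h3 : ‖ξ a‖ = 1 := AddChar.norm_apply ξ a
      have := Complex.abs_re_le_norm (ξ a)
      rw [h3] at this
      linarith [abs_le.1 this]
    · rw [ind_false h]
      have := (Complex.abs_re_le_norm (ξ a - 1)).trans (hP ξ h)
      simp only [Complex.sub_re, Complex.one_re] at this
      linarith [abs_le.1 this]
  have h3 := Finset.sum_le_sum (fun ξ (_ : ξ ∈ (univ : Finset (AddChar H ℂ))) => h2 ξ)
  rw [h1, Finset.sum_sub_distrib, ← Finset.mul_sum, Finset.sum_const, Finset.card_univ,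
    nsmul_eq_mul] at h3
  linarith

lemma mul_approx {a b a' b' : ℂ} {r s : ℝ} (hb : ‖b‖ = 1) (ha' : ‖a'‖ = 1)
    (h1 : ‖a - a'‖ ≤ r) (h2 : ‖b - b'‖ ≤ s) : ‖a * b - a' * b'‖ ≤ r + s := by
  have : a * b - a' * b' = (a - a') * b + a' * (b - b') := by ring
  rw [this]
  refine (norm_add_le _ _).trans ?_
  rw [norm_mul, norm_mul, hb, ha']
  linarith

lemma conj_approx {a a' : ℂ} {r : ℝ} (h1 : ‖a - a'‖ ≤ r) :
    ‖starRingEnd ℂ a - starRingEnd ℂ a'‖ ≤ r := by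
  rw [← map_sub, RCLike.norm_conj]; exact h1

/-- A chosen representation of `x` by elements of `S`. -/
def trip {G : Type*} [AddCommGroup G] [Fintype G] (S : Finset (G × Fin 4)) (x : G) : Fin 3 → G :=
  if h : ∃ v ∈ tri {x} ∅, gr Fin.castSucc v ⊆ S then h.choose else 0

lemma trip_spec {G : Type*} [AddCommGroup G] [Fintype G] {S : Finset (G × Fin 4)} {x : G}
    (h : ∃ v ∈ tri {x} ∅, gr Fin.castSucc v ⊆ S) :
    trip S x 0 + trip S x 1 - trip S x 2 = x ∧ (trip S x 0, 0) ∈ S ∧ (trip S x 1, 1) ∈ S ∧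
      (trip S x 2, 2) ∈ S := by
  have h1 : trip S x = h.choose := by unfold trip; rw [dif_pos h]
  have h2 := h.choose_spec
  rw [← h1] at h2
  obtain ⟨h3, h4⟩ := h2
  simp only [tri, Finset.mem_filter, Finset.mem_singleton] at h3
  exact ⟨h3.2.1, h4 (mem_gr.2 ⟨0, rfl⟩), h4 (mem_gr.2 ⟨1, rfl⟩), h4 (mem_gr.2 ⟨2, rfl⟩)⟩

/-- The approximate function associated with a labelling. -/
def gl {G : Type*} [AddCommGroup G] [Fintype G] (S : Finset (G × Fin 4)) (l : G × Fin 4 → ℂ)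
    (x : G) : ℂ :=
  l (trip S x 0, 0) * l (trip S x 1, 1) * starRingEnd ℂ (l (trip S x 2, 2))

/-- Quadruples that are bad for a labelling. -/
def Ql {G : Type*} [AddCommGroup G] [Fintype G] (S : Finset (G × Fin 4)) (l : G × Fin 4 → ℂ) :
    Finset (Fin 4 → G) :=
  univ.filter fun v => v 0 + v 1 = v 2 + v 3 ∧
    1 / 4 < ‖gl S l (v 0) * gl S l (v 1) * starRingEnd ℂ (gl S l (v 2)) *
      starRingEnd ℂ (gl S l (v 3)) - 1‖

/-- Normalised degree in a family of quadruples. -/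
def dg {G : Type*} [Fintype G] (Q : Finset (Fin 4 → G)) (u : G) : ℝ :=
  (Q.filter fun v => v 0 = u).card / (Fintype.card G : ℝ) ^ 2

/-- The labellings of `S`. -/
def labels {G : Type*} [Fintype G] (T : Finset ℂ) (t0 : ℂ) (S : Finset (G × Fin 4)) :
    Finset (G × Fin 4 → ℂ) :=
  Fintype.piFinset fun ω => if ω ∈ S then T else {t0}

/-- The property of the random sets from which the extension property is deduced. -/
structure Good {G : Type*} [AddCommGroup G] [Fintype G] (T : Finset ℂ) (t0 : ℂ) (ε ε3 η N : ℝ)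
    (S R : Finset (G × Fin 4)) : Prop where
  a : ∀ x, ∃ v ∈ tri {x} ∅, gr Fin.castSucc v ⊆ S
  b1 : ∀ l ∈ labels T t0 S, ε * (Fintype.card G : ℝ) ^ 3 ≤ (Ql S l).card →
    ∃ v ∈ Ql S l, gr id v ⊆ R
  b2 : ∀ l ∈ labels T t0 S, ¬ ε * (Fintype.card G : ℝ) ^ 3 ≤ (Ql S l).card →
    ∑ ω ∈ R, dg (Ql S l) ω.1 ≤ 9 * ε * N
  c : (S.card : ℝ) ≤ 9 * η * N
  d : ∀ B, B ⊆ UU S R → B.Nonempty → (B.card : ℝ) ≤ ε3 * N →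
    ∃ v ∈ tri B B, gr Fin.castSucc v ⊆ R

lemma label_exists {G : Type*} [AddCommGroup G] [Fintype G] {H : Type*} [AddCommGroup H]
    [Fintype H] {T : Finset ℂ} {t0 : ℂ}
    (hT1 : ∀ t ∈ T, ‖t‖ = 1) (hT : ∀ z : ℂ, ‖z‖ = 1 → ∃ t ∈ T, ‖z - t‖ ≤ 1 / 48)
    {S : Finset (G × Fin 4)} (ha : ∀ x, ∃ v ∈ tri {x} ∅, gr Fin.castSucc v ⊆ S)
    (φ : G → H) (ξ : AddChar H ℂ) :
    ∃ l ∈ labels T t0 S, ∀ v : Fin 4 → G,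
      ‖ξ ((φ (trip S (v 0) 0) + φ (trip S (v 0) 1) - φ (trip S (v 0) 2)) +
        (φ (trip S (v 1) 0) + φ (trip S (v 1) 1) - φ (trip S (v 1) 2)) -
        (φ (trip S (v 2) 0) + φ (trip S (v 2) 1) - φ (trip S (v 2) 2)) -
        (φ (trip S (v 3) 0) + φ (trip S (v 3) 1) - φ (trip S (v 3) 2))) -
        gl S l (v 0) * gl S l (v 1) * starRingEnd ℂ (gl S l (v 2)) *
      starRingEnd ℂ (gl S l (v 3))‖ ≤ 1 / 4 := by
  have hex : ∀ ω : G × Fin 4, ∃ t ∈ T, ‖ξ (φ ω.1) - t‖ ≤ 1 / 48 := fun ω =>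
    hT _ (AddChar.norm_apply ξ _)
  choose f hf1 hf2 using hex
  refine ⟨fun ω => if ω ∈ S then f ω else t0, ?_, ?_⟩
  · rw [labels, Fintype.mem_piFinset]
    intro ω
    by_cases h : ω ∈ S
    · simp [h, hf1]
    · simp [h]
  set l : G × Fin 4 → ℂ := fun ω => if ω ∈ S then f ω else t0 with hl
  have hl1 : ∀ ω ∈ S, ‖l ω‖ = 1 := fun ω h => by rw [hl]; simp only [if_pos h]; exact hT1 _ (hf1 ω)
  have hl2 : ∀ ω ∈ S, ‖ξ (φ ω.1) - l ω‖ ≤ 1 / 48 := fun ω h => by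
    rw [hl]; simp only [if_pos h]; exact hf2 ω
  clear_value l
  have hξ1 : ∀ h, ‖ξ h‖ = 1 := fun h => AddChar.norm_apply ξ h
  have hsub : ∀ a b : H, ξ (a - b) = ξ a * starRingEnd ℂ (ξ b) := by
    intro a b
    rw [sub_eq_add_neg, AddChar.map_add_eq_mul, AddChar.map_neg_eq_conj]
  have hg1 : ∀ x, ‖gl S l x‖ = 1 := by
    intro x
    obtain ⟨_, h0, h1, h2⟩ := trip_spec (ha x)
    simp [gl, hl1 _ h0, hl1 _ h1, hl1 _ h2]
  have hg2 : ∀ x, ‖ξ (φ (trip S x 0) + φ (trip S x 1) - φ (trip S x 2)) - gl S l x‖ ≤ 3 / 48 := by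
    intro x
    obtain ⟨_, h0, h1, h2⟩ := trip_spec (ha x)
    rw [hsub, AddChar.map_add_eq_mul, gl]
    have k0 : ‖ξ (φ (trip S x 0)) - l (trip S x 0, 0)‖ ≤ 1 / 48 := hl2 (trip S x 0, 0) h0
    have k1 : ‖ξ (φ (trip S x 1)) - l (trip S x 1, 1)‖ ≤ 1 / 48 := hl2 (trip S x 1, 1) h1
    have k2 : ‖ξ (φ (trip S x 2)) - l (trip S x 2, 2)‖ ≤ 1 / 48 := hl2 (trip S x 2, 2) h2
    have e1 := mul_approx (hξ1 (φ (trip S x 1))) (hl1 _ h0) k0 k1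
    have e2 := mul_approx (b := starRingEnd ℂ (ξ (φ (trip S x 2))))
      (by rw [RCLike.norm_conj]; exact hξ1 _) (by rw [norm_mul, hl1 _ h0, hl1 _ h1, mul_one]) e1
      (conj_approx k2)
    refine e2.trans (by norm_num)
  intro v
  generalize gl S l = gg at hg1 hg2 ⊢
  rw [hsub, hsub, AddChar.map_add_eq_mul]
  have e1 := mul_approx (hξ1 _) (hg1 _) (hg2 (v 0)) (hg2 (v 1))
  have e2 := mul_approx (by rw [RCLike.norm_conj]; exact hξ1 _)
    (by rw [norm_mul, hg1, hg1, mul_one]) e1 (conj_approx (hg2 (v 2)))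
  have e3 := mul_approx (by rw [RCLike.norm_conj]; exact hξ1 _)
    (by rw [norm_mul, norm_mul, RCLike.norm_conj, hg1, hg1, hg1, mul_one, mul_one]) e2
    (conj_approx (hg2 (v 3)))
  refine e3.trans (by norm_num)


lemma card_filter_ind {α : Type*} (s : Finset α) (P : α → Prop) [DecidablePred P] :
    ((s.filter P).card : ℝ) = ∑ v ∈ s, ind (P v) := by
  rw [Finset.card_filter, Nat.cast_sum]
  refine Finset.sum_congr rfl fun v _ => ?_
  by_cases h : P v
  · rw [ind_true h, if_pos h]; simp
  · rw [ind_false h, if_neg h]; simp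

lemma card_eq_sum_ind {α : Type*} [Fintype α] (Q : Finset α) :
    (Q.card : ℝ) = ∑ v : α, ind (v ∈ Q) := by
  rw [← card_filter_ind, Finset.filter_univ_mem]

lemma dg_eq_sum {G : Type*} [Fintype G] (Q : Finset (Fin 4 → G)) (u : G) :
    dg Q u = (∑ v : Fin 4 → G, ind (v ∈ Q) * ind (v 0 = u)) / (Fintype.card G : ℝ) ^ 2 := by
  unfold dg
  congr 1
  rw [card_eq_sum_ind]
  simp_rw [Finset.mem_filter, ind_and]

lemma finite_ext {G : Type*} [AddCommGroup G] [Fintype G] {H : Type*} [AddCommGroup H]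
    [Fintype H] {T : Finset ℂ} {t0 : ℂ}
    (hT1 : ∀ t ∈ T, ‖t‖ = 1) (hT : ∀ z : ℂ, ‖z‖ = 1 → ∃ t ∈ T, ‖z - t‖ ≤ 1 / 48)
    {ε ε3 η N : ℝ} (hε : 36 * ε ≤ 1) (hε0 : 0 < ε) (h3 : 54 * ε + 9 * η ≤ ε3) (hN : 0 ≤ N)
    {S R : Finset (G × Fin 4)} (hg : Good T t0 ε ε3 η N S R) (φ : G → H)
    (hφ : FreimanHomOn (UU S R) φ) :
    ∃ (ψ : G →+ H) (h : H), ∀ u ∈ UU S R, φ u = ψ u + h := by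
  set n : ℝ := (Fintype.card G : ℝ) with hn
  have hn0 : 0 < n := by rw [hn]; exact_mod_cast Fintype.card_pos
  set g : G → H := fun x => φ (trip S x 0) + φ (trip S x 1) - φ (trip S x 2) with hgd
  have hgφ : ∀ u ∈ UU S R, φ u = g u := by
    intro u hu
    obtain ⟨e, h0, h1, h2⟩ := trip_spec (hg.a u)
    have := hφ u hu _ (mem_UU.2 (Or.inl ⟨_, h2⟩)) _ (mem_UU.2 (Or.inl ⟨_, h0⟩)) _
      (mem_UU.2 (Or.inl ⟨_, h1⟩)) (by rw [← sub_eq_iff_eq_add.1 e])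
    rw [hgd]
    exact eq_sub_of_add_eq this
  have hlab := fun ξ => label_exists (t0 := t0) hT1 hT hg.a φ ξ
  choose l hl1 hl2 using hlab
  -- every labelling has few bad quadruples
  have hQ : ∀ ξ, ¬ ε * n ^ 3 ≤ (Ql S (l ξ)).card := by
    intro ξ hcon
    obtain ⟨v, hv, hvR⟩ := hg.b1 (l ξ) (hl1 ξ) hcon
    simp only [Ql, Finset.mem_filter, Finset.mem_univ, true_and] at hv
    have hU : ∀ i, v i ∈ UU S R := fun i =>
      mem_UU.2 (Or.inr ⟨i, hvR (mem_gr.2 ⟨i, rfl⟩)⟩)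
    have h1 : g (v 0) + g (v 1) - g (v 2) - g (v 3) = 0 := by
      rw [← hgφ _ (hU 0), ← hgφ _ (hU 1), ← hgφ _ (hU 2), ← hgφ _ (hU 3),
        hφ _ (hU 0) _ (hU 1) _ (hU 2) _ (hU 3) hv.1]
      abel
    have h2 := hl2 ξ v
    change ‖ξ (g (v 0) + g (v 1) - g (v 2) - g (v 3)) - _‖ ≤ _ at h2
    rw [h1, AddChar.map_zero_eq_one, norm_sub_rev] at h2
    linarith [hv.2]
  have hR : ∀ ξ, ∑ ω ∈ R, dg (Ql S (l ξ)) ω.1 ≤ 9 * ε * N := fun ξ => hg.b2 _ (hl1 ξ) (hQ ξ)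
  set Bad := univ.filter fun v : Fin 4 → G => v 0 + v 1 = v 2 + v 3 ∧
      ¬ g (v 0) + g (v 1) = g (v 2) + g (v 3) with hBad
  set h : ℝ := (Fintype.card (AddChar H ℂ) : ℝ) with hh
  have hh0 : 0 < h := by rw [hh]; exact_mod_cast Fintype.card_pos
  have hkey : ∀ v, ind (v ∈ Bad) * h ≤ 3 * ∑ ξ : AddChar H ℂ, ind (v ∈ Ql S (l ξ)) := by
    intro v
    by_cases hv : v ∈ Bad
    · rw [ind_true hv, one_mul]
      simp only [hBad, Finset.mem_filter, Finset.mem_univ, true_and] at hv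
      refine char_average (g (v 0) + g (v 1) - g (v 2) - g (v 3)) ?_ _ ?_
      · intro h0
        apply hv.2
        rw [sub_sub, sub_eq_zero] at h0
        exact h0
      · intro ξ hξ
        simp only [Ql, Finset.mem_filter, Finset.mem_univ, true_and, not_and, not_lt] at hξ
        have e1 := hξ hv.1
        have e2 := hl2 ξ v
        change ‖ξ (g (v 0) + g (v 1) - g (v 2) - g (v 3)) - _‖ ≤ _ at e2
        have e3 := norm_sub_le_norm_sub_add_norm_sub (ξ (g (v 0) + g (v 1) - g (v 2) - g (v 3)))
          (gl S (l ξ) (v 0) * gl S (l ξ) (v 1) * starRingEnd ℂ (gl S (l ξ) (v 2)) *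
            starRingEnd ℂ (gl S (l ξ) (v 3))) 1
        linarith
    · rw [ind_false hv, zero_mul]
      have := Finset.sum_nonneg (fun ξ (_ : ξ ∈ (univ : Finset (AddChar H ℂ))) =>
        ind_nonneg (v ∈ Ql S (l ξ)))
      linarith
  have hBadcard : (Bad.card : ℝ) ≤ 3 * ε * n ^ 3 := by
    have e1 : (Bad.card : ℝ) * h ≤ 3 * ∑ ξ : AddChar H ℂ, ((Ql S (l ξ)).card : ℝ) := by
      calc (Bad.card : ℝ) * h = ∑ v, ind (v ∈ Bad) * h := by
            rw [card_eq_sum_ind, Finset.sum_mul]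
        _ ≤ ∑ v, 3 * ∑ ξ : AddChar H ℂ, ind (v ∈ Ql S (l ξ)) :=
            Finset.sum_le_sum fun v _ => hkey v
        _ = _ := by
            rw [← Finset.mul_sum, Finset.sum_comm]
            simp_rw [card_eq_sum_ind]
    have e2 : ∑ ξ : AddChar H ℂ, ((Ql S (l ξ)).card : ℝ) ≤ ∑ _ξ : AddChar H ℂ, ε * n ^ 3 :=
      Finset.sum_le_sum fun ξ _ => (not_le.1 (hQ ξ)).le
    rw [Finset.sum_const, Finset.card_univ, nsmul_eq_mul, ← hh] at e2
    have e3 : (Bad.card : ℝ) * h ≤ (3 * ε * n ^ 3) * h := by nlinarith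
    exact le_of_mul_le_mul_right e3 hh0
  have hdg : ∀ u, dg Bad u * h ≤ 3 * ∑ ξ : AddChar H ℂ, dg (Ql S (l ξ)) u := by
    intro u
    simp_rw [dg_eq_sum]
    rw [← Finset.sum_div, Finset.sum_comm, div_mul_eq_mul_div, ← mul_div_assoc]
    refine div_le_div_of_nonneg_right ?_ (by positivity)
    rw [Finset.sum_mul, Finset.mul_sum]
    refine Finset.sum_le_sum fun v _ => ?_
    rw [← Finset.sum_mul]
    have := mul_le_mul_of_nonneg_right (hkey v) (ind_nonneg (v 0 = u))
    linarith
  have hBadR : ∑ ω ∈ R, dg Bad ω.1 ≤ 27 * ε * N := by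
    have e1 : (∑ ω ∈ R, dg Bad ω.1) * h ≤ 3 * ∑ ξ : AddChar H ℂ, 9 * ε * N := by
      rw [Finset.sum_mul]
      calc _ ≤ ∑ ω ∈ R, 3 * ∑ ξ : AddChar H ℂ, dg (Ql S (l ξ)) ω.1 :=
            Finset.sum_le_sum fun ω _ => hdg ω.1
        _ = 3 * ∑ ξ : AddChar H ℂ, ∑ ω ∈ R, dg (Ql S (l ξ)) ω.1 := by
            rw [← Finset.mul_sum, Finset.sum_comm]
        _ ≤ _ := by
            have := Finset.sum_le_sum (fun ξ (_ : ξ ∈ (univ : Finset (AddChar H ℂ))) => hR ξ)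
            linarith
    rw [Finset.sum_const, Finset.card_univ, nsmul_eq_mul, ← hh] at e1
    have e3 : (∑ ω ∈ R, dg Bad ω.1) * h ≤ (27 * ε * N) * h := by nlinarith
    exact le_of_mul_le_mul_right e3 hh0
  obtain ⟨ψ, c, hW⟩ := blr g (ε := 3 * ε) (by linarith) (by
    rw [← hn]; exact hBadcard)
  rw [← hn] at hW
  set W := univ.filter fun x => ¬ g x = ψ x + c with hWd
  have hWdg : ∀ u ∈ W, 1 / 2 ≤ dg Bad u := by
    intro u hu
    have hu' : ¬ g u = ψ u + c := by simpa [hWd] using hu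
    unfold dg
    rw [← hn, le_div_iff₀ (by positivity)]
    -- pairs
    have e1 : (univ : Finset (G × G)) ⊆ ((univ.filter fun q : G × G =>
        ![u, q.1, q.2, u + q.1 - q.2] ∈ Bad) ∪ (W ×ˢ univ)) ∪ (univ ×ˢ W) ∪
        (univ.filter fun q : G × G => u + q.1 - q.2 ∈ W) := by
      rintro ⟨y, z⟩ _
      simp only [Finset.mem_union, Finset.mem_filter, Finset.mem_univ, true_and,
        Finset.mem_product, and_true]
      by_contra hcon
      push Not at hcon
      obtain ⟨⟨⟨hb, hy⟩, hz⟩, hw⟩ := hcon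
      simp only [hWd, Finset.mem_filter, Finset.mem_univ, true_and, not_not] at hy hz hw
      apply hb
      simp only [hBad, Finset.mem_filter, Finset.mem_univ, true_and, Matrix.cons_val]
      refine ⟨by abel, fun hq => hu' ?_⟩
      rw [hy, hz, hw] at hq
      rw [eq_sub_of_add_eq hq]
      simp only [map_sub, map_add]
      abel
    have e2 : (univ.filter fun q : G × G => u + q.1 - q.2 ∈ W).card ≤
        ((univ : Finset G) ×ˢ W).card := by
      refine Finset.card_le_card_of_injOn (fun q => (q.1, u + q.1 - q.2)) ?_ ?_
      · intro q hq
        simpa using hq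
      · rintro ⟨a, b⟩ _ ⟨a', b'⟩ _ h
        simp only [Prod.mk.injEq] at h
        obtain ⟨rfl, h⟩ := h
        simpa using h
    have e3 : (univ.filter fun q : G × G => ![u, q.1, q.2, u + q.1 - q.2] ∈ Bad).card ≤
        (Bad.filter fun v => v 0 = u).card := by
      refine Finset.card_le_card_of_injOn (fun q => ![u, q.1, q.2, u + q.1 - q.2]) ?_ ?_
      · intro q hq
        simp only [Finset.coe_filter, Finset.mem_univ, true_and, Set.mem_ofPred_eq] at hq ⊢
        exact ⟨hq, rfl⟩
      · rintro ⟨a, b⟩ _ ⟨a', b'⟩ _ h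
        have h1 := congrFun h 1
        have h2 := congrFun h 2
        simp only [Matrix.cons_val] at h1 h2
        rw [h1, h2]
    have e4 := Finset.card_le_card e1
    have e5 := Finset.card_union_le (((univ.filter fun q : G × G =>
        ![u, q.1, q.2, u + q.1 - q.2] ∈ Bad) ∪ (W ×ˢ univ)) ∪ (univ ×ˢ W))
        (univ.filter fun q : G × G => u + q.1 - q.2 ∈ W)
    have e6 := Finset.card_union_le ((univ.filter fun q : G × G =>
        ![u, q.1, q.2, u + q.1 - q.2] ∈ Bad) ∪ (W ×ˢ univ)) (univ ×ˢ W)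
    have e7 := Finset.card_union_le (univ.filter fun q : G × G =>
        ![u, q.1, q.2, u + q.1 - q.2] ∈ Bad) (W ×ˢ univ)
    simp only [Finset.card_product, Finset.card_univ, Fintype.card_prod] at e2 e4 e6 e7
    have e8 : Fintype.card G * Fintype.card G ≤ (Bad.filter fun v => v 0 = u).card +
        3 * (W.card * Fintype.card G) := by
      have := mul_comm (Fintype.card G) W.card
      omega
    have e9 : n * n ≤ ((Bad.filter fun v => v 0 = u).card : ℝ) + 3 * (W.card * n) := by
      rw [hn]; exact_mod_cast e8
    have e10 : (W.card : ℝ) * n ≤ (2 * (3 * ε) * n) * n := by gcongr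
    have e11 : 36 * ε * (n * n) ≤ 1 * (n * n) := by gcongr
    nlinarith
  -- the exceptional set
  set B := (UU S R).filter fun u => ¬ φ u = ψ u + c with hB
  have hRW : ((R.filter fun ω => ω.1 ∈ W).card : ℝ) ≤ 54 * ε * N := by
    have e1 : ((R.filter fun ω => ω.1 ∈ W).card : ℝ) * (1 / 2) ≤ ∑ ω ∈ R, dg Bad ω.1 := by
      calc _ = ∑ ω ∈ R.filter fun ω => ω.1 ∈ W, (1 / 2 : ℝ) := by
            rw [Finset.sum_const, nsmul_eq_mul]
        _ ≤ ∑ ω ∈ R.filter fun ω => ω.1 ∈ W, dg Bad ω.1 :=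
            Finset.sum_le_sum fun ω hω => hWdg _ (Finset.mem_filter.1 hω).2
        _ ≤ _ := Finset.sum_le_sum_of_subset_of_nonneg (Finset.filter_subset _ _)
            (fun _ _ _ => by unfold dg; positivity)
    linarith
  have hBc : (B.card : ℝ) ≤ ε3 * N := by
    have e1 : B ⊆ S.image Prod.fst ∪ (R.filter fun ω => ω.1 ∈ W).image Prod.fst := by
      intro u hu
      rw [hB, Finset.mem_filter] at hu
      have hu1 := mem_UU.1 hu.1
      rw [Finset.mem_union]
      rcases hu1 with ⟨i, hi⟩ | ⟨i, hi⟩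
      · left
        exact Finset.mem_image.2 ⟨_, hi, rfl⟩
      · right
        refine Finset.mem_image.2 ⟨_, Finset.mem_filter.2 ⟨hi, ?_⟩, rfl⟩
        simp only [hWd, Finset.mem_filter, Finset.mem_univ, true_and]
        rw [← hgφ u hu.1]
        exact hu.2
    have e2 := (Finset.card_le_card e1).trans (Finset.card_union_le _ _)
    have e3 := e2.trans (add_le_add Finset.card_image_le Finset.card_image_le)
    have e4 : (B.card : ℝ) ≤ S.card + ((R.filter fun ω => ω.1 ∈ W).card : ℝ) := by
      exact_mod_cast e3
    have := hg.c
    nlinarith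
  have hBe : ¬ B.Nonempty := by
    intro hne
    obtain ⟨v, hv, hvR⟩ := hg.d B (Finset.filter_subset _ _) hne hBc
    simp only [tri, Finset.mem_filter, Finset.mem_univ, true_and] at hv
    obtain ⟨hb, hvB⟩ := hv
    have hU : ∀ i, v i ∈ UU S R := fun i =>
      mem_UU.2 (Or.inr ⟨i.castSucc, hvR (mem_gr.2 ⟨i, rfl⟩)⟩)
    have hv' : ∀ i, φ (v i) = ψ (v i) + c := by
      intro i
      by_contra hcon
      exact hvB i (Finset.mem_filter.2 ⟨hU i, hcon⟩)
    rw [hB, Finset.mem_filter] at hb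
    apply hb.2
    have := hφ _ hb.1 _ (hU 2) _ (hU 0) _ (hU 1) (by abel)
    rw [eq_sub_of_add_eq this, hv', hv', hv']
    simp only [map_sub, map_add]
    abel
  refine ⟨ψ, c, fun u hu => ?_⟩
  by_contra hcon
  exact hBe ⟨u, Finset.mem_filter.2 ⟨hu, hcon⟩⟩


/-! ### Deterministic part: general target -/

lemma addCircle_torsion (x : AddCircle (1 : ℚ)) : ∃ m : ℕ, 0 < m ∧ m • x = 0 := by
  induction x using QuotientAddGroup.induction_on with
  | H q =>
    refine ⟨q.den, q.den_pos, ?_⟩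
    have h : ((q.den • q : ℚ) : AddCircle (1 : ℚ)) = 0 := by
      rw [AddCircle.coe_eq_zero_iff]
      refine ⟨q.num, ?_⟩
      rw [nsmul_eq_mul, mul_comm, Rat.mul_den_eq_num]
      simp
    exact h

lemma finite_closure {G : Type*} [Finite G] (f : G → AddCircle (1 : ℚ)) :
    Finite (AddSubgroup.closure (Set.range f)) := by
  apply AddCommGroup.finite_of_fg_isAddTorsion
  intro x
  obtain ⟨m, hm, h⟩ := addCircle_torsion x
  rw [isOfFinAddOrder_iff_nsmul_eq_zero]
  exact ⟨m, hm, Subtype.ext (by simpa using h)⟩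

lemma general_ext {G : Type*} [AddCommGroup G] [Fintype G] {H : Type*} [AddCommGroup H]
    {T : Finset ℂ} {t0 : ℂ}
    (hT1 : ∀ t ∈ T, ‖t‖ = 1) (hT : ∀ z : ℂ, ‖z‖ = 1 → ∃ t ∈ T, ‖z - t‖ ≤ 1 / 48)
    {ε ε3 η N : ℝ} (hε : 36 * ε ≤ 1) (hε0 : 0 < ε) (h3 : 54 * ε + 9 * η ≤ ε3) (hN : 0 ≤ N)
    {S R : Finset (G × Fin 4)} (hg : Good T t0 ε ε3 η N S R) (φ : G → H)
    (hφ : FreimanHomOn (UU S R) φ) :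
    ∃ (ψ : G →+ H) (h : H), ∀ u ∈ UU S R, φ u = ψ u + h := by
  set g : G → H := fun x => φ (trip S x 0) + φ (trip S x 1) - φ (trip S x 2) with hgd
  have hgφ : ∀ u ∈ UU S R, φ u = g u := by
    intro u hu
    obtain ⟨e, h0, h1, h2⟩ := trip_spec (hg.a u)
    have := hφ u hu _ (mem_UU.2 (Or.inl ⟨_, h2⟩)) _ (mem_UU.2 (Or.inl ⟨_, h0⟩)) _
      (mem_UU.2 (Or.inl ⟨_, h1⟩)) (by rw [← sub_eq_iff_eq_add.1 e])
    rw [hgd]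
    exact eq_sub_of_add_eq this
  have hadd : ∀ x y, g (x + y) + g 0 = g x + g y := by
    intro x y
    rw [← sub_eq_zero]
    apply CharacterModule.eq_zero_of_character_apply
    intro χ0
    let χ : H →+ AddCircle (1 : ℚ) := χ0
    change χ _ = 0
    haveI := finite_closure (fun x => χ (φ x))
    set A := AddSubgroup.closure (Set.range fun x => χ (φ x)) with hA
    letI := Fintype.ofFinite A
    let φ' : G → A := fun x => ⟨χ (φ x), AddSubgroup.subset_closure ⟨x, rfl⟩⟩
    have hφ' : FreimanHomOn (UU S R) φ' := by
      intro a ha b hb c hc d hd h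
      apply Subtype.ext
      change χ (φ a) + χ (φ b) = χ (φ c) + χ (φ d)
      rw [← map_add, ← map_add, hφ a ha b hb c hc d hd h]
    obtain ⟨ψ, h, hψ⟩ := finite_ext hT1 hT hε hε0 h3 hN hg φ' hφ'
    have hψ' : ∀ u ∈ UU S R, χ (φ u) = ((ψ u + h : A) : AddCircle (1 : ℚ)) := by
      intro u hu
      rw [← hψ u hu]
    have hgx : ∀ x, χ (g x) = ((ψ x + h : A) : AddCircle (1 : ℚ)) := by
      intro x
      obtain ⟨e, h0, h1, h2⟩ := trip_spec (hg.a x)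
      rw [hgd]
      simp only [map_sub, map_add]
      rw [hψ' _ (mem_UU.2 (Or.inl ⟨_, h0⟩)), hψ' _ (mem_UU.2 (Or.inl ⟨_, h1⟩)),
        hψ' _ (mem_UU.2 (Or.inl ⟨_, h2⟩)), ← AddSubgroup.coe_add, ← AddSubgroup.coe_sub]
      congr 1
      nth_rewrite 4 [← e]
      simp only [map_sub, map_add]
      abel
    rw [map_sub, map_add, map_add, hgx, hgx, hgx, hgx, sub_eq_zero, ← AddSubgroup.coe_add,
      ← AddSubgroup.coe_add]
    congr 1
    simp only [map_add, map_zero]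
    abel
  refine ⟨AddMonoidHom.mk' (fun x => g x - g 0) ?_, g 0, ?_⟩
  · intro x y
    rw [eq_sub_of_add_eq (hadd x y)]
    abel
  · intro u hu
    simp [hgφ u hu]


/-! ### Probability estimates -/

lemma ind_exists_le {ι : Type*} (I : Finset ι) (P : ι → Prop) :
    ind (∃ i ∈ I, P i) ≤ ∑ i ∈ I, ind (P i) := by
  by_cases h : ∃ i ∈ I, P i
  · obtain ⟨i, hi, hP⟩ := h
    calc ind (∃ i ∈ I, P i) ≤ 1 := ind_le_one _
      _ = ind (P i) := (ind_true hP).symm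
      _ ≤ _ := Finset.single_le_sum (f := fun i => ind (P i)) (fun j _ => ind_nonneg _) hi
  · rw [ind_false h]
    exact Finset.sum_nonneg fun j _ => ind_nonneg _

lemma bound_a {G : Type*} [AddCommGroup G] [Fintype G] {p : ℝ} (h0 : 0 ≤ p) (h1 : p ≤ 1)
    (hnp : 1 ≤ Fintype.card G * p) :
    Ex p (fun S => ind (¬ ∀ x : G, ∃ v ∈ tri {x} ∅, gr Fin.castSucc v ⊆ S)) ≤
      Fintype.card G * (Real.exp (-(((Fintype.card G : ℝ) ^ 2 * p ^ 3) / 4)) +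
      Real.exp (-(Fintype.card G * p / 96))) := by
  calc _ ≤ Ex p (fun S => ∑ x : G, ind (∀ v ∈ tri {x} ∅, ¬ gr Fin.castSucc v ⊆ S)) := by
        refine Ex_mono h0 h1 fun S => ?_
        refine le_trans (ind_mono ?_) (ind_exists_le univ _)
        intro h
        push Not at h
        obtain ⟨x, hx⟩ := h
        exact ⟨x, Finset.mem_univ x, hx⟩
    _ = ∑ x : G, Ex p (fun S => ind (∀ v ∈ tri {x} ∅, ¬ gr Fin.castSucc v ⊆ S)) := Ex_sum _ _ _
    _ ≤ ∑ _x : G, (Real.exp (-(((Fintype.card G : ℝ) ^ 2 * p ^ 3) / 4)) +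
      Real.exp (-(Fintype.card G * p / 96))) := by
        refine Finset.sum_le_sum fun x _ => ?_
        have := tri_bound h0 h1 {x} ∅ (Finset.singleton_nonempty x) (by simp; positivity) hnp
        simpa using this
    _ = _ := by rw [Finset.sum_const, Finset.card_univ, nsmul_eq_mul]

lemma card_labels {G : Type*} [Fintype G] (T : Finset ℂ) (t0 : ℂ) (S : Finset (G × Fin 4)) :
    ((labels T t0 S).card : ℝ) = (T.card : ℝ) ^ S.card := by
  rw [labels, Fintype.card_piFinset]
  have : ∀ ω : G × Fin 4, (if ω ∈ S then T else {t0}).card = if ω ∈ S then T.card else 1 := by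
    intro ω; split_ifs <;> simp
  simp_rw [this]
  rw [Finset.prod_ite_mem, Finset.univ_inter, Finset.prod_const]
  push_cast; rfl

lemma Ex_labels {G : Type*} [Fintype G] (T : Finset ℂ) {p1 : ℝ} (h0 : 0 ≤ p1) (h1 : p1 ≤ 1)
    (t0 : ℂ) (c : ℝ) (hc : 0 ≤ c) :
    Ex p1 (fun S : Finset (G × Fin 4) => ((labels T t0 S).card : ℝ) * c) ≤
      Real.exp (4 * T.card * (Fintype.card G * p1)) * c := by
  simp_rw [card_labels, mul_comm _ c]
  rw [Ex_const_mul]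
  refine mul_le_mul_of_nonneg_left ?_ hc
  refine (Ex_pow_card_le h0 h1 (by positivity)).trans (le_of_eq ?_)
  congr 1
  rw [Fintype.card_prod, Fintype.card_fin]
  push_cast; ring

lemma bound_b1 {G : Type*} [AddCommGroup G] [Fintype G] (T : Finset ℂ) (t0 : ℂ) {p1 p2 ε : ℝ}
    (h0 : 0 ≤ p1) (h1 : p1 ≤ 1) (h0' : 0 ≤ p2) (h1' : p2 ≤ 1) (hε0 : 0 < ε)
    (hε1 : ε ≤ 1) (hnp : 1 ≤ Fintype.card G * p2) (hD : 1 ≤ (Fintype.card G : ℝ) ^ 2 * p2 ^ 3) :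
    Ex p1 (fun S : Finset (G × Fin 4) => Ex p2 (fun R : Finset (G × Fin 4) =>
      ind (¬ ∀ l ∈ labels T t0 S, ε * (Fintype.card G : ℝ) ^ 3 ≤ (Ql S l).card →
        ∃ v ∈ Ql S l, gr id v ⊆ R))) ≤
      Real.exp (4 * T.card * (Fintype.card G * p1)) *
        Real.exp (-(ε ^ 2 * (Fintype.card G * p2) / 40)) := by
  refine le_trans (Ex_mono h0 h1 fun S => ?_) (Ex_labels T h0 h1 t0 _ (Real.exp_pos _).le)
  calc _ ≤ Ex p2 (fun R : Finset (G × Fin 4) => ∑ l ∈ labels T t0 S,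
        ind (ε * (Fintype.card G : ℝ) ^ 3 ≤ (Ql S l).card ∧ ∀ v ∈ Ql S l, ¬ gr id v ⊆ R)) := by
        refine Ex_mono h0' h1' fun R => ?_
        refine le_trans (ind_mono ?_) (ind_exists_le _ _)
        intro h
        push Not at h
        exact h
    _ = ∑ l ∈ labels T t0 S, Ex p2 (fun R : Finset (G × Fin 4) =>
        ind (ε * (Fintype.card G : ℝ) ^ 3 ≤ (Ql S l).card ∧ ∀ v ∈ Ql S l, ¬ gr id v ⊆ R)) :=
        Ex_sum _ _ _
    _ ≤ ∑ l ∈ labels T t0 S, Real.exp (-(ε ^ 2 * (Fintype.card G * p2) / 40)) := by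
        refine Finset.sum_le_sum fun l _ => ?_
        by_cases hc : ε * (Fintype.card G : ℝ) ^ 3 ≤ (Ql S l).card
        · refine le_trans (Ex_mono h0' h1' fun R => ind_mono fun h => h.2)
            (quad_bound h0' h1' (Ql S l) ?_ hε0 hε1 hc hnp hD)
          intro v hv
          simp only [Ql, Finset.mem_filter] at hv
          exact hv.2.1
        · have : ∀ R : Finset (G × Fin 4), ind (ε * (Fintype.card G : ℝ) ^ 3 ≤ (Ql S l).card ∧
              ∀ v ∈ Ql S l, ¬ gr id v ⊆ R) = 0 := fun R => ind_false fun h => hc h.1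
          simp_rw [this]
          rw [Ex_const]
          exact (Real.exp_pos _).le
    _ = _ := by rw [Finset.sum_const, nsmul_eq_mul]

lemma dg_nonneg {G : Type*} [Fintype G] (Q : Finset (Fin 4 → G)) (u : G) : 0 ≤ dg Q u := by
  unfold dg; positivity

lemma dg_le_one {G : Type*} [AddCommGroup G] [Fintype G] (Q : Finset (Fin 4 → G))
    (hQ : ∀ v ∈ Q, v 0 + v 1 = v 2 + v 3) (u : G) : dg Q u ≤ 1 := by
  unfold dg
  apply div_le_one_of_le₀ _ (by positivity)
  have : (Q.filter fun v => v 0 = u).card ≤ (univ : Finset (G × G)).card := by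
    refine Finset.card_le_card_of_injOn (fun v => (v 1, v 2))
      (fun _ _ => Finset.mem_coe.2 (Finset.mem_univ _)) ?_
    intro v hv v' hv' h
    simp only [Finset.coe_filter, Set.mem_ofPred_eq, Prod.mk.injEq] at hv hv' h
    exact quad_three v v' (hQ v hv.1) (hQ v' hv'.1)
      (three_agree v v' 0 1 2 (by decide) (by decide) (by decide) (by rw [hv.2, hv'.2]) h.1 h.2)
  rw [Finset.card_univ, Fintype.card_prod] at this
  calc _ ≤ ((Fintype.card G * Fintype.card G : ℕ) : ℝ) := by exact_mod_cast this
    _ = _ := by push_cast; ring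

lemma sum_dg {G : Type*} [AddCommGroup G] [Fintype G] (Q : Finset (Fin 4 → G)) :
    ∑ ω : G × Fin 4, dg Q ω.1 = 4 * (Q.card / (Fintype.card G : ℝ) ^ 2) := by
  rw [Fintype.sum_prod_type]
  simp only [Finset.sum_const, Finset.card_univ, Fintype.card_fin, nsmul_eq_mul]
  rw [← Finset.mul_sum]
  unfold dg
  rw [← Finset.sum_div, ← Nat.cast_sum]
  rw [← Finset.card_eq_sum_card_fiberwise (f := fun v : Fin 4 → G => v 0) (s := Q) (t := univ)
    (fun _ _ => by simp)]
  norm_num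

lemma bound_b2 {G : Type*} [AddCommGroup G] [Fintype G] (T : Finset ℂ) (t0 : ℂ) {p p1 p2 ε : ℝ}
    (h0 : 0 ≤ p1) (h1 : p1 ≤ 1) (h0' : 0 ≤ p2) (h1' : p2 ≤ 1) (hε0 : 0 < ε) (hp : p2 ≤ p) :
    Ex p1 (fun S : Finset (G × Fin 4) => Ex p2 (fun R : Finset (G × Fin 4) =>
      ind (¬ ∀ l ∈ labels T t0 S, ¬ ε * (Fintype.card G : ℝ) ^ 3 ≤ (Ql S l).card →
        ∑ ω ∈ R, dg (Ql S l) ω.1 ≤ 9 * ε * (Fintype.card G * p)))) ≤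
      Real.exp (4 * T.card * (Fintype.card G * p1)) *
        Real.exp (-(ε * (Fintype.card G * p))) := by
  refine le_trans (Ex_mono h0 h1 fun S => ?_) (Ex_labels T h0 h1 t0 _ (Real.exp_pos _).le)
  set n : ℝ := (Fintype.card G : ℝ) with hn
  have hn0 : 0 < n := by rw [hn]; exact_mod_cast Fintype.card_pos
  calc _ ≤ Ex p2 (fun R : Finset (G × Fin 4) => ∑ l ∈ labels T t0 S,
        ind ((Ql S l).card < ε * n ^ 3 ∧ 9 * ε * (n * p) < ∑ ω ∈ R, dg (Ql S l) ω.1)) := by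
        refine Ex_mono h0' h1' fun R => ?_
        refine le_trans (ind_mono ?_) (ind_exists_le _ _)
        intro h
        push Not at h
        exact h
    _ = ∑ l ∈ labels T t0 S, Ex p2 (fun R : Finset (G × Fin 4) =>
        ind ((Ql S l).card < ε * n ^ 3 ∧ 9 * ε * (n * p) < ∑ ω ∈ R, dg (Ql S l) ω.1)) :=
        Ex_sum _ _ _
    _ ≤ ∑ l ∈ labels T t0 S, Real.exp (-(ε * (n * p))) := by
        refine Finset.sum_le_sum fun l _ => ?_
        by_cases hc : (Ql S l).card < ε * n ^ 3
        · have hq : ∀ v ∈ Ql S l, v 0 + v 1 = v 2 + v 3 := by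
            intro v hv
            simp only [Ql, Finset.mem_filter] at hv
            exact hv.2.1
          refine le_trans (Ex_mono h0' h1' fun R => ind_mono fun h => h.2.le)
            ((chernoff h0' h1' (fun ω : G × Fin 4 => dg (Ql S l) ω.1) (fun ω => dg_nonneg _ _)
              (fun ω => dg_le_one _ hq _) (9 * ε * (n * p))).trans ?_)
          apply Real.exp_le_exp.2
          rw [sum_dg, ← hn]
          have e1 : (Ql S l).card / n ^ 2 ≤ ε * n := by
            rw [div_le_iff₀ (by positivity)]; nlinarith
          have e2 : p2 * ((Ql S l).card / n ^ 2) ≤ p * (ε * n) := by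
            apply mul_le_mul hp e1 (by positivity) (by linarith)
          nlinarith
        · have : ∀ R : Finset (G × Fin 4), ind ((Ql S l).card < ε * n ^ 3 ∧
              9 * ε * (n * p) < ∑ ω ∈ R, dg (Ql S l) ω.1) = 0 := fun R => ind_false fun h => hc h.1
          simp_rw [this]
          rw [Ex_const]
          exact (Real.exp_pos _).le
    _ = _ := by rw [Finset.sum_const, nsmul_eq_mul]

lemma bound_c {G : Type*} [Fintype G] {p η : ℝ} (h0 : 0 ≤ η * p) (h1 : η * p ≤ 1) :
    Ex (η * p) (fun S : Finset (G × Fin 4) =>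
      ind (¬ (S.card : ℝ) ≤ 9 * η * (Fintype.card G * p))) ≤
      Real.exp (-(η * (Fintype.card G * p))) := by
  refine le_trans (Ex_mono h0 h1 fun S => ind_mono fun h => ?_)
    ((chernoff h0 h1 (fun _ : G × Fin 4 => 1) (fun _ => zero_le_one) (fun _ => le_rfl)
      (9 * η * (Fintype.card G * p))).trans (le_of_eq ?_))
  · push Not at h
    simpa using h.le
  · congr 1
    simp
    ring


lemma sum_pow_card_le {G : Type*} [Fintype G] {a : ℝ} (ha : 0 ≤ a) :
    ∑ B : Finset G, a ^ B.card ≤ Real.exp (Fintype.card G * a) := by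
  have h := Fintype.sum_pow_mul_eq_add_pow G a 1
  simp only [one_pow, mul_one] at h
  rw [h, Real.exp_nat_mul]
  exact pow_le_pow_left₀ (by linarith) (Real.add_one_le_exp a) _

lemma exp_neg_nine : Real.exp (-9) ≤ 1 / 3072 := by
  rw [Real.exp_neg, ← one_div]
  apply one_div_le_one_div_of_le (by norm_num)
  have h1 : (2.7 : ℝ) ≤ Real.exp 1 := by linarith [Real.exp_one_gt_d9]
  have h2 : Real.exp 9 = Real.exp 1 ^ 9 := by rw [← Real.exp_nat_mul]; norm_num
  rw [h2]
  calc (3072 : ℝ) ≤ 2.7 ^ 9 := by norm_num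
    _ ≤ _ := pow_le_pow_left₀ (by norm_num) h1 9

lemma bound_d1 {G : Type*} [AddCommGroup G] [Fintype G] {p p1 p2 : ℝ}
    (h0 : 0 ≤ p1) (h1 : p1 ≤ 1) (h0' : 0 ≤ p2) (h1' : p2 ≤ 1)
    (hp : (1 - p1) ^ 4 * (1 - p2) ^ 4 = 1 - p) (B : Finset G) (hB : B.Nonempty)
    (hBc : (B.card : ℝ) ≤ Fintype.card G / 6) (hnp : 1 ≤ Fintype.card G * p2) :
    Ex p1 (fun S : Finset (G × Fin 4) => Ex p2 (fun R : Finset (G × Fin 4) =>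
      ind (B ⊆ UU S R ∧ ∀ v ∈ tri B B, ¬ gr Fin.castSucc v ⊆ R))) ≤
      p ^ B.card * (Real.exp (-(B.card * ((Fintype.card G : ℝ) ^ 2 * p2 ^ 3) / 4)) +
      Real.exp (-(Fintype.card G * p2 / 96))) := by
  set c := Real.exp (-(B.card * ((Fintype.card G : ℝ) ^ 2 * p2 ^ 3) / 4)) +
      Real.exp (-(Fintype.card G * p2 / 96)) with hc
  have hc0 : 0 ≤ c := by rw [hc]; positivity
  calc _ ≤ Ex p1 (fun S : Finset (G × Fin 4) => c * Ex p2 (fun R : Finset (G × Fin 4) =>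
      ind (B ⊆ UU S R))) := by
        refine Ex_mono h0 h1 fun S => ?_
        refine (harris h0' h1' (fun R => B ⊆ UU S R)
          (fun R => ∀ v ∈ tri B B, ¬ gr Fin.castSucc v ⊆ R) ?_ ?_).trans ?_
        · intro R R' hRR' h u hu
          rcases mem_UU.1 (h hu) with h | ⟨i, hi⟩
          · exact mem_UU.2 (Or.inl h)
          · exact mem_UU.2 (Or.inr ⟨i, hRR' hi⟩)
        · intro R R' hRR' h v hv hv'
          exact h v hv (hv'.trans hRR')
        · rw [mul_comm]
          exact mul_le_mul_of_nonneg_right (tri_bound h0' h1' B B hB hBc hnp)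
            (Ex_nonneg h0' h1' fun R => ind_nonneg _)
    _ = c * Ex p (fun V => ind (B ⊆ V)) := by
        rw [Ex_const_mul, coupling hp (fun V => ind (B ⊆ V))]
    _ = _ := by rw [Pr_subset, mul_comm]

lemma bound_d {G : Type*} [AddCommGroup G] [Fintype G] {p p1 p2 ε3 : ℝ}
    (h0 : 0 ≤ p1) (h1 : p1 ≤ 1) (h0' : 0 ≤ p2) (h1' : p2 ≤ 1) (hp1 : p ≤ 1)
    (hp : (1 - p1) ^ 4 * (1 - p2) ^ 4 = 1 - p) (hp8 : p / 8 ≤ p2) (hp0 : 0 ≤ p)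
    (hε3 : ε3 = 1 / 30000) (hnp : 1 ≤ Fintype.card G * p2) :
    Ex p1 (fun S : Finset (G × Fin 4) => Ex p2 (fun R : Finset (G × Fin 4) =>
      ind (¬ ∀ B, B ⊆ UU S R → B.Nonempty → (B.card : ℝ) ≤ ε3 * (Fintype.card G * p) →
    ∃ v ∈ tri B B, gr Fin.castSucc v ⊆ R))) ≤
      (Real.exp (Fintype.card G * p * Real.exp (-((Fintype.card G : ℝ) ^ 2 * p ^ 3 / 2048))) - 1) +
      Real.exp (-(Fintype.card G * p / 1536)) := by
  set n : ℝ := (Fintype.card G : ℝ) with hn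
  have hn0 : 0 < n := by rw [hn]; exact_mod_cast Fintype.card_pos
  set D : ℝ := n ^ 2 * p ^ 3 with hD
  set I : Finset (Finset G) :=
    univ.filter fun B => B.Nonempty ∧ (B.card : ℝ) ≤ ε3 * (n * p) with hI
  have hN0 : 0 ≤ n * p := by positivity
  have hD2 : D / 512 ≤ n ^ 2 * p2 ^ 3 := by
    have : (p / 8) ^ 3 ≤ p2 ^ 3 := pow_le_pow_left₀ (by positivity) hp8 3
    have h2 : n ^ 2 * (p / 8) ^ 3 ≤ n ^ 2 * p2 ^ 3 := by gcongr
    rw [hD]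
    calc _ = n ^ 2 * (p / 8) ^ 3 := by ring
      _ ≤ _ := h2
  have hN2 : n * p / 8 ≤ n * p2 := by
    calc n * p / 8 = n * (p / 8) := by ring
      _ ≤ _ := by gcongr
  set x : ℝ := Real.exp (-(D / 2048)) with hx
  calc _ ≤ Ex p1 (fun S : Finset (G × Fin 4) => Ex p2 (fun R : Finset (G × Fin 4) =>
        ∑ B ∈ I, ind (B ⊆ UU S R ∧ ∀ v ∈ tri B B, ¬ gr Fin.castSucc v ⊆ R))) := by
        refine Ex_mono h0 h1 fun S => Ex_mono h0' h1' fun R => ?_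
        refine le_trans (ind_mono ?_) (ind_exists_le _ _)
        intro h
        push Not at h
        obtain ⟨B, hB1, hB2, hB3, hB4⟩ := h
        exact ⟨B, Finset.mem_filter.2 ⟨Finset.mem_univ _, hB2, hB3⟩, hB1, hB4⟩
    _ = ∑ B ∈ I, Ex p1 (fun S : Finset (G × Fin 4) => Ex p2 (fun R : Finset (G × Fin 4) =>
        ind (B ⊆ UU S R ∧ ∀ v ∈ tri B B, ¬ gr Fin.castSucc v ⊆ R))) := by
        simp_rw [Ex_sum]
    _ ≤ ∑ B ∈ I, ((p * x) ^ B.card + (p * Real.exp (-9)) ^ B.card *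
          Real.exp (9 * (ε3 * (n * p)) - n * p / 768)) := by
        refine Finset.sum_le_sum fun B hB => ?_
        rw [hI, Finset.mem_filter] at hB
        refine (bound_d1 h0 h1 h0' h1' hp B hB.2.1 ?_ hnp).trans ?_
        · refine hB.2.2.trans ?_
          rw [← hn, hε3]
          have : n * p ≤ n * 1 := by gcongr
          linarith
        · rw [mul_add, mul_pow, mul_pow, mul_assoc, ← hn]
          have hpp : 0 ≤ p ^ B.card := by positivity
          refine add_le_add (mul_le_mul_of_nonneg_left ?_ hpp) (mul_le_mul_of_nonneg_left ?_ hpp)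
          · rw [hx, ← Real.exp_nat_mul]
            apply Real.exp_le_exp.2
            have : (B.card : ℝ) * (D / 512) ≤ B.card * (n ^ 2 * p2 ^ 3) := by gcongr
            linarith
          · rw [← Real.exp_nat_mul, ← Real.exp_add]
            apply Real.exp_le_exp.2
            have := hB.2.2
            linarith
    _ = ∑ B ∈ I, (p * x) ^ B.card + (∑ B ∈ I, (p * Real.exp (-9)) ^ B.card) *
          Real.exp (9 * (ε3 * (n * p)) - n * p / 768) := by
        rw [Finset.sum_add_distrib, Finset.sum_mul]
    _ ≤ _ := by
        refine add_le_add ?_ ?_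
        · have e1 := sum_pow_card_le (G := G) (a := p * x) (by positivity)
          have e2 : ∑ B ∈ I, (p * x) ^ B.card ≤
              ∑ B ∈ (univ : Finset (Finset G)).erase ∅, (p * x) ^ B.card := by
            refine Finset.sum_le_sum_of_subset_of_nonneg ?_ (fun _ _ _ => by positivity)
            intro B hB
            rw [hI, Finset.mem_filter] at hB
            exact Finset.mem_erase.2 ⟨hB.2.1.ne_empty, Finset.mem_univ _⟩
          have e3 := Finset.add_sum_erase (univ : Finset (Finset G))
            (fun B => (p * x) ^ B.card) (Finset.mem_univ ∅)
          simp only [Finset.card_empty, pow_zero] at e3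
          rw [← hn] at e1
          have e4 : n * (p * x) = n * p * x := by ring
          rw [e4] at e1
          linarith
        · have e1 := sum_pow_card_le (G := G) (a := p * Real.exp (-9)) (by positivity)
          have e2 : ∑ B ∈ I, (p * Real.exp (-9)) ^ B.card ≤
              ∑ B : Finset G, (p * Real.exp (-9)) ^ B.card :=
            Finset.sum_le_sum_of_subset_of_nonneg (Finset.subset_univ _)
              (fun _ _ _ => by positivity)
          refine (mul_le_mul_of_nonneg_right (e2.trans e1) (Real.exp_pos _).le).trans ?_
          rw [← Real.exp_add]
          apply Real.exp_le_exp.2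
          rw [← hn, hε3]
          have := mul_le_mul_of_nonneg_left exp_neg_nine hN0
          linarith

/-- The total failure probability. -/
def failB (m ε η n N D : ℝ) : ℝ :=
  n * (Real.exp (-(η ^ 3 * D / 4)) + Real.exp (-(η * N / 96))) +
  Real.exp (4 * m * (η * N) - ε ^ 2 * N / 320) + Real.exp (4 * m * (η * N) - ε * N) +
  Real.exp (-(η * N)) + ((Real.exp (N * Real.exp (-(D / 2048))) - 1) + Real.exp (-(N / 1536)))

lemma prob_good {G : Type*} [AddCommGroup G] [Fintype G] (T : Finset ℂ) (t0 : ℂ)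
    {p p2 ε ε3 η : ℝ} (hη0 : 0 < η) (hη1 : η ≤ 1) (hp0 : 0 < p) (hp1 : p ≤ 1)
    (hp : (1 - η * p) ^ 4 * (1 - p2) ^ 4 = 1 - p) (hp8 : p / 8 ≤ p2) (hp2 : p2 ≤ p)
    (hε3 : ε3 = 1 / 30000) (hε0 : 0 < ε) (hε1 : ε ≤ 1)
    (hN1 : 1 ≤ Fintype.card G * (η * p)) (hN2 : 1 ≤ Fintype.card G * p2)
    (hD : 1 ≤ (Fintype.card G : ℝ) ^ 2 * p2 ^ 3) :
    1 - failB T.card ε η (Fintype.card G) (Fintype.card G * p)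
        ((Fintype.card G : ℝ) ^ 2 * p ^ 3) ≤
      Ex (η * p) (fun S : Finset (G × Fin 4) => Ex p2 (fun R : Finset (G × Fin 4) =>
        ind (Good T t0 ε ε3 η (Fintype.card G * p) S R))) := by
  have h0 : 0 ≤ η * p := by positivity
  have h1 : η * p ≤ 1 := by nlinarith
  have h0' : 0 ≤ p2 := by linarith
  have h1' : p2 ≤ 1 := by linarith
  set n : ℝ := (Fintype.card G : ℝ) with hn
  have ba := bound_a (G := G) h0 h1 hN1
  have b1 := bound_b1 (G := G) T t0 h0 h1 h0' h1' hε0 hε1 hN2 hD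
  have b2 := bound_b2 (G := G) T t0 h0 h1 h0' h1' hε0 hp2
  have bc := bound_c (G := G) h0 h1
  have bd := bound_d (G := G) h0 h1 h0' h1' hp1 hp hp8 hp0.le hε3 hN2
  have e : ∀ S R : Finset (G × Fin 4), 1 -
      (((ind (¬ ∀ x : G, ∃ v ∈ tri {x} ∅, gr Fin.castSucc v ⊆ S) +
       ind (¬ (S.card : ℝ) ≤ 9 * η * (Fintype.card G * p))) +
       ind (¬ ∀ l ∈ labels T t0 S, ε * (Fintype.card G : ℝ) ^ 3 ≤ (Ql S l).card →
        ∃ v ∈ Ql S l, gr id v ⊆ R)) +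
       (ind (¬ ∀ l ∈ labels T t0 S, ¬ ε * (Fintype.card G : ℝ) ^ 3 ≤ (Ql S l).card →
        ∑ ω ∈ R, dg (Ql S l) ω.1 ≤ 9 * ε * (Fintype.card G * p)) +
       ind (¬ ∀ B, B ⊆ UU S R → B.Nonempty → (B.card : ℝ) ≤ ε3 * (Fintype.card G * p) →
    ∃ v ∈ tri B B, gr Fin.castSucc v ⊆ R))) ≤
      ind (Good T t0 ε ε3 η (Fintype.card G * p) S R) := by
    intro S R
    by_cases hg : Good T t0 ε ε3 η (Fintype.card G * p) S R
    · rw [ind_true hg]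
      have := ind_nonneg (¬ ∀ x : G, ∃ v ∈ tri {x} ∅, gr Fin.castSucc v ⊆ S)
      have := ind_nonneg (¬ (S.card : ℝ) ≤ 9 * η * (Fintype.card G * p))
      have := ind_nonneg (¬ ∀ l ∈ labels T t0 S, ε * (Fintype.card G : ℝ) ^ 3 ≤ (Ql S l).card →
        ∃ v ∈ Ql S l, gr id v ⊆ R)
      have := ind_nonneg (¬ ∀ l ∈ labels T t0 S,
        ¬ ε * (Fintype.card G : ℝ) ^ 3 ≤ (Ql S l).card →
        ∑ ω ∈ R, dg (Ql S l) ω.1 ≤ 9 * ε * (Fintype.card G * p))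
      have := ind_nonneg (¬ ∀ B, B ⊆ UU S R → B.Nonempty →
        (B.card : ℝ) ≤ ε3 * (Fintype.card G * p) → ∃ v ∈ tri B B, gr Fin.castSucc v ⊆ R)
      linarith
    · rw [ind_false hg]
      by_contra hcon
      rw [not_le] at hcon
      simp only [ind_not] at hcon
      have q1 := ind_le_one (∀ x : G, ∃ v ∈ tri {x} ∅, gr Fin.castSucc v ⊆ S)
      have q2 := ind_le_one ((S.card : ℝ) ≤ 9 * η * (Fintype.card G * p))
      have q3 := ind_le_one (∀ l ∈ labels T t0 S, ε * (Fintype.card G : ℝ) ^ 3 ≤ (Ql S l).card →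
        ∃ v ∈ Ql S l, gr id v ⊆ R)
      have q4 := ind_le_one (∀ l ∈ labels T t0 S,
        ¬ ε * (Fintype.card G : ℝ) ^ 3 ≤ (Ql S l).card →
        ∑ ω ∈ R, dg (Ql S l) ω.1 ≤ 9 * ε * (Fintype.card G * p))
      have q5 := ind_le_one (∀ B, B ⊆ UU S R → B.Nonempty →
        (B.card : ℝ) ≤ ε3 * (Fintype.card G * p) → ∃ v ∈ tri B B, gr Fin.castSucc v ⊆ R)
      have aux : ∀ P : Prop, 0 < ind P → P := by
        intro P h
        by_contra h'
        rw [ind_false h'] at h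
        exact lt_irrefl _ h
      exact hg ⟨aux _ (by linarith), aux _ (by linarith), aux _ (by linarith),
        aux _ (by linarith), aux _ (by linarith)⟩
  refine le_trans ?_ (Ex_mono h0 h1 fun S => Ex_mono h0' h1' fun R => e S R)
  simp only [Ex_sub, Ex_add, Ex_const]
  have k1 : Real.exp (4 * T.card * (n * (η * p))) * Real.exp (-(ε ^ 2 * (n * p2) / 40)) ≤
      Real.exp (4 * T.card * (η * (n * p)) - ε ^ 2 * (n * p) / 320) := by
    rw [← Real.exp_add]
    apply Real.exp_le_exp.2
    have : ε ^ 2 * (n * (p / 8)) ≤ ε ^ 2 * (n * p2) := by gcongr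
    nlinarith
  have k2 : Real.exp (4 * T.card * (n * (η * p))) * Real.exp (-(ε * (n * p))) =
      Real.exp (4 * T.card * (η * (n * p)) - ε * (n * p)) := by
    rw [← Real.exp_add]
    congr 1
    ring
  have k3 : n ^ 2 * (η * p) ^ 3 / 4 = η ^ 3 * (n ^ 2 * p ^ 3) / 4 := by ring
  have k4 : n * (η * p) / 96 = η * (n * p) / 96 := by ring
  rw [← hn, k3, k4] at ba
  rw [k2] at b2
  unfold failB
  linarith


/-! ### Parameters and asymptotics -/

lemma exists_p2 {p η : ℝ} (hp0 : 0 < p) (hp1 : p ≤ 1 / 2) (hη0 : 0 < η) (hη1 : η ≤ 1 / 8) :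
    ∃ p2 : ℝ, (1 - η * p) ^ 4 * (1 - p2) ^ 4 = 1 - p ∧ p / 8 ≤ p2 ∧ p2 ≤ p := by
  obtain ⟨r, hr0, hr⟩ : ∃ r : ℝ, 0 ≤ r ∧ r ^ 4 = 1 - p := by
    refine ⟨Real.sqrt (Real.sqrt (1 - p)), Real.sqrt_nonneg _, ?_⟩
    rw [show 4 = 2 * 2 by norm_num, pow_mul, Real.sq_sqrt (Real.sqrt_nonneg _),
      Real.sq_sqrt (by linarith)]
  have hηp : η * p ≤ p / 8 := by nlinarith
  have hηp0 : 0 < η * p := by positivity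
  have hq : 0 < 1 - η * p := by linarith
  have hr1 : r ≤ 1 := by
    by_contra h
    push Not at h
    have := one_lt_pow₀ h (n := 4) (by norm_num)
    linarith
  have hr2 : 1 - p ≤ r := by
    rw [← hr]
    exact pow_le_of_le_one hr0 hr1 (by norm_num)
  have hr3 : r ≤ 1 - p / 4 := by
    by_contra h
    push Not at h
    have h1 : (1 - p / 4) ^ 4 < r ^ 4 := pow_lt_pow_left₀ h (by linarith) (by norm_num)
    have h2 := one_add_mul_le_pow (a := -(p / 4)) (by linarith) 4
    push_cast at h2
    have h3 : (1 - p / 4) ^ 4 = (1 + -(p / 4)) ^ 4 := by ring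
    linarith
  refine ⟨1 - r / (1 - η * p), ?_, ?_, ?_⟩
  · rw [← hr]
    field_simp
    ring
  · have : r / (1 - η * p) ≤ 1 - p / 8 := by
      rw [div_le_iff₀ hq]
      nlinarith
    linarith
  · have : 1 - p ≤ r / (1 - η * p) := by
      rw [le_div_iff₀ hq]
      nlinarith
    linarith

lemma param_facts {C n : ℝ} (hC : 1 ≤ C) (hn : 3 ≤ n) {p : ℝ}
    (hp : p = C * Real.log n ^ ((1 : ℝ) / 3) * n ^ (-(2 : ℝ) / 3)) :
    0 < p ∧ n ^ 2 * p ^ 3 = C ^ 3 * Real.log n ∧ n ^ ((1 : ℝ) / 3) ≤ n * p ∧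
      p ≤ C * n ^ (-((1 : ℝ) / 3)) ∧ 1 ≤ Real.log n := by
  have hn0 : 0 < n := by linarith
  have hL1 : 1 ≤ Real.log n := by
    rw [Real.le_log_iff_exp_le hn0]
    linarith [Real.exp_one_lt_d9]
  have hL0 : 0 < Real.log n := by linarith
  have hLp : 0 < Real.log n ^ ((1 : ℝ) / 3) := Real.rpow_pos_of_pos hL0 _
  have hLp1 : 1 ≤ Real.log n ^ ((1 : ℝ) / 3) := Real.one_le_rpow hL1 (by norm_num)
  have hnp : 0 < n ^ (-(2 : ℝ) / 3) := Real.rpow_pos_of_pos hn0 _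
  have hnp3 : 0 < n ^ ((1 : ℝ) / 3) := Real.rpow_pos_of_pos hn0 _
  refine ⟨by rw [hp]; positivity, ?_, ?_, ?_, hL1⟩
  · have e1 : (Real.log n ^ ((1 : ℝ) / 3)) ^ 3 = Real.log n := by
      rw [← Real.rpow_natCast, ← Real.rpow_mul hL0.le]; norm_num
    have e2 : (n ^ (-(2 : ℝ) / 3)) ^ 3 = (n ^ 2)⁻¹ := by
      rw [← Real.rpow_natCast, ← Real.rpow_mul hn0.le, ← Real.rpow_natCast, ← Real.rpow_neg hn0.le]
      norm_num
    rw [hp, mul_pow, mul_pow, e1, e2]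
    field_simp
  · have e1 : n * n ^ (-(2 : ℝ) / 3) = n ^ ((1 : ℝ) / 3) := by
      rw [← Real.rpow_one_add' hn0.le (by norm_num)]; norm_num
    calc n ^ ((1 : ℝ) / 3) = 1 * 1 * n ^ ((1 : ℝ) / 3) := by ring
      _ ≤ C * Real.log n ^ ((1 : ℝ) / 3) * n ^ ((1 : ℝ) / 3) := by gcongr
      _ = n * p := by rw [← e1, hp]; ring
  · have e1 : Real.log n ≤ n := (Real.log_le_sub_one_of_pos hn0).trans (by linarith)
    have e2 : Real.log n ^ ((1 : ℝ) / 3) ≤ n ^ ((1 : ℝ) / 3) :=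
      Real.rpow_le_rpow hL0.le e1 (by norm_num)
    have e3 : n ^ ((1 : ℝ) / 3) * n ^ (-(2 : ℝ) / 3) = n ^ (-((1 : ℝ) / 3)) := by
      rw [← Real.rpow_add hn0]; norm_num
    rw [hp, ← e3, ← mul_assoc]
    gcongr

open Filter Topology in
lemma cube_exp_tendsto {c : ℝ} (hc : 0 < c) :
    Tendsto (fun y : ℝ => y ^ 3 * Real.exp (-(c * y))) atTop (𝓝 0) := by
  have h1 := (Real.tendsto_pow_mul_exp_neg_atTop_nhds_zero 3).comp
    (tendsto_id.const_mul_atTop hc)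
  have h2 := h1.const_mul (c ^ 3)⁻¹
  rw [mul_zero] at h2
  refine h2.congr fun y => ?_
  simp only [Function.comp, id]
  rw [mul_pow]
  field_simp

open Filter Topology in
lemma exp_neg_tendsto {c : ℝ} (hc : 0 < c) :
    Tendsto (fun y : ℝ => Real.exp (-(c * y))) atTop (𝓝 0) :=
  Real.tendsto_exp_neg_atTop_nhds_zero.comp (tendsto_id.const_mul_atTop hc)

/-- The bound for the failure probability in terms of `y = n ^ (1/3)` . -/
def failY (C η c y : ℝ) : ℝ :=
  y ^ 3 * Real.exp (-((η / 96) * y)) + 2 * Real.exp (-(c * y)) + Real.exp (-(η * y)) +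
    Real.exp (-(1 / 1536 * y)) + (Real.exp (C * y⁻¹) - 1) + y⁻¹ ^ 3

open Filter Topology in
lemma failY_tendsto {C η c : ℝ} (hη : 0 < η) (hc : 0 < c) :
    Tendsto (failY C η c) atTop (𝓝 0) := by
  have h1 := cube_exp_tendsto (c := η / 96) (by positivity)
  have h2 := (exp_neg_tendsto hc).const_mul 2
  have h3 := exp_neg_tendsto hη
  have h4 := exp_neg_tendsto (c := 1 / 1536) (by norm_num)
  have h5 : Tendsto (fun y : ℝ => Real.exp (C * y⁻¹) - 1) atTop (𝓝 0) := by
    have h := (tendsto_inv_atTop_zero (𝕜 := ℝ)).const_mul C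
    have h' := ((Real.continuous_exp.tendsto _).comp h).sub_const 1
    simpa using h'
  have h6 := (tendsto_inv_atTop_zero (𝕜 := ℝ)).pow 3
  have := ((((h1.add h2).add h3).add h4).add h5).add h6
  have e : Tendsto (fun y : ℝ => failY C η c y) atTop (𝓝 0) := by
    unfold failY
    convert this using 1
    norm_num
  exact e

lemma failB_le {m ε η C n p : ℝ} (hm : 1 ≤ m) (hε0 : 0 < ε) (hε1 : ε ≤ 1)
    (hη : η = ε ^ 2 / (2560 * m)) (hC : C = 2 / η) (hn : 3 ≤ n)
    (hp : p = C * Real.log n ^ ((1 : ℝ) / 3) * n ^ (-(2 : ℝ) / 3)) :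
    failB m ε η n (n * p) (n ^ 2 * p ^ 3) ≤ failY C η (ε ^ 2 / 640) (n ^ ((1 : ℝ) / 3)) := by
  have hε2 : ε ^ 2 ≤ 1 := pow_le_one₀ hε0.le hε1
  have hη0 : 0 < η := by rw [hη]; positivity
  have hη8 : η ≤ 1 / 8 := by
    rw [hη, div_le_iff₀ (by positivity)]; linarith
  have hC16 : 16 ≤ C := by
    rw [hC, le_div_iff₀ hη0]; linarith
  have hn0 : 0 < n := by linarith
  obtain ⟨hp0, hD, hN, hpC, hL⟩ := param_facts (by linarith) hn hp
  set y := n ^ ((1 : ℝ) / 3) with hy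
  have hy0 : 0 < y := Real.rpow_pos_of_pos hn0 _
  have hy3 : y ^ 3 = n := by
    rw [hy, ← Real.rpow_natCast, ← Real.rpow_mul hn0.le]; norm_num
  have hyi : n ^ (-((1 : ℝ) / 3)) = y⁻¹ := by rw [hy, Real.rpow_neg hn0.le]
  rw [hyi] at hpC
  have hmη : 4 * m * η = ε ^ 2 / 640 := by
    rw [hη]; field_simp; norm_num
  have hηC : η ^ 3 * C ^ 3 = 8 := by
    rw [hC, div_pow]; field_simp; norm_num
  have t1 : n * Real.exp (-(η ^ 3 * (n ^ 2 * p ^ 3) / 4)) ≤ y⁻¹ ^ 3 := by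
    rw [hD, ← mul_assoc, hηC, inv_pow, hy3]
    have : -(8 * Real.log n / 4) = -Real.log n + -Real.log n := by ring
    rw [this, Real.exp_add, Real.exp_neg, Real.exp_log hn0]
    apply le_of_eq
    field_simp
  have t2 : n * Real.exp (-(η * (n * p) / 96)) ≤ y ^ 3 * Real.exp (-((η / 96) * y)) := by
    rw [hy3]
    refine mul_le_mul_of_nonneg_left (Real.exp_le_exp.2 ?_) hn0.le
    have := mul_le_mul_of_nonneg_left hN hη0.le
    linarith
  have hN2 := mul_le_mul_of_nonneg_left hN (show 0 ≤ ε ^ 2 / 640 by positivity)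
  have t3 : Real.exp (4 * m * (η * (n * p)) - ε ^ 2 * (n * p) / 320) ≤
      Real.exp (-(ε ^ 2 / 640 * y)) := by
    apply Real.exp_le_exp.2
    rw [show 4 * m * (η * (n * p)) = (4 * m * η) * (n * p) by ring, hmη]
    linarith
  have t4 : Real.exp (4 * m * (η * (n * p)) - ε * (n * p)) ≤
      Real.exp (-(ε ^ 2 / 640 * y)) := by
    apply Real.exp_le_exp.2
    rw [show 4 * m * (η * (n * p)) = (4 * m * η) * (n * p) by ring, hmη]
    have h1 : ε ^ 2 ≤ ε := by nlinarith
    have h2 : ε ^ 2 * (n * p) ≤ ε * (n * p) := mul_le_mul_of_nonneg_right h1 (by positivity)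
    have h3 : 0 ≤ ε ^ 2 * (n * p) := by positivity
    linarith
  have t5 : Real.exp (-(η * (n * p))) ≤ Real.exp (-(η * y)) := by
    apply Real.exp_le_exp.2
    have := mul_le_mul_of_nonneg_left hN hη0.le
    linarith
  have t6 : Real.exp (-(n * p / 1536)) ≤ Real.exp (-(1 / 1536 * y)) := by
    apply Real.exp_le_exp.2
    linarith
  have t7 : Real.exp (n * p * Real.exp (-(n ^ 2 * p ^ 3 / 2048))) ≤ Real.exp (C * y⁻¹) := by
    apply Real.exp_le_exp.2
    have hC3 : (16 : ℝ) ^ 3 ≤ C ^ 3 := pow_le_pow_left₀ (by norm_num) hC16 3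
    have h1 : Real.exp (-(n ^ 2 * p ^ 3 / 2048)) ≤ n⁻¹ := by
      rw [← Real.exp_log hn0, ← Real.exp_neg, Real.exp_log hn0, hD]
      apply Real.exp_le_exp.2
      have := mul_le_mul_of_nonneg_right hC3 (show 0 ≤ Real.log n by linarith)
      linarith
    calc n * p * Real.exp (-(n ^ 2 * p ^ 3 / 2048)) ≤ n * p * n⁻¹ := by gcongr
      _ = p := by field_simp
      _ ≤ _ := hpC
  unfold failB failY
  rw [mul_add]
  linarith

open Filter Topology in
lemma asym {m ε η C : ℝ} (hm : 1 ≤ m) (hε0 : 0 < ε) (hε1 : ε ≤ 1)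
    (hη : η = ε ^ 2 / (2560 * m)) (hC : C = 2 / η) {δ : ℝ} (hδ : 0 < δ) :
    ∃ n₀ : ℕ, ∀ k : ℕ, n₀ ≤ k → ∀ p : ℝ,
      p = C * Real.log k ^ ((1 : ℝ) / 3) * (k : ℝ) ^ (-(2 : ℝ) / 3) →
      0 < p ∧ p ≤ 1 / 2 ∧ 1 ≤ k * (η * p) ∧ 8 ≤ k * p ∧ 512 ≤ (k : ℝ) ^ 2 * p ^ 3 ∧
        failB m ε η k (k * p) ((k : ℝ) ^ 2 * p ^ 3) ≤ δ := by
  have hε2 : ε ^ 2 ≤ 1 := pow_le_one₀ hε0.le hε1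
  have hη0 : 0 < η := by rw [hη]; positivity
  have hη8 : η ≤ 1 / 8 := by
    rw [hη, div_le_iff₀ (by positivity)]; linarith
  have hC16 : 16 ≤ C := by
    rw [hC, le_div_iff₀ hη0]; linarith
  have hy : Tendsto (fun k : ℕ => (k : ℝ) ^ ((1 : ℝ) / 3)) atTop atTop :=
    (tendsto_rpow_atTop (by norm_num)).comp tendsto_natCast_atTop_atTop
  have e1 := hy.eventually ((failY_tendsto (C := C) hη0
    (show 0 < ε ^ 2 / 640 by positivity)).eventually_le_const hδ)
  have e2 := hy.eventually_ge_atTop (2 * C)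
  have e3 := hy.eventually_ge_atTop (1 / η)
  have e4 := hy.eventually_ge_atTop 8
  have e5 := eventually_ge_atTop (3 : ℕ)
  obtain ⟨n₀, h⟩ := eventually_atTop.1 (e1.and (e2.and (e3.and (e4.and e5))))
  refine ⟨n₀, fun k hk p hp => ?_⟩
  obtain ⟨h1, h2, h3, h4, h5⟩ := h k hk
  have hn : (3 : ℝ) ≤ k := by exact_mod_cast h5
  have hn0 : (0 : ℝ) < k := by linarith
  obtain ⟨hp0, hD, hN, hpC, hL⟩ := param_facts (by linarith) hn hp
  refine ⟨hp0, ?_, ?_, h4.trans hN, ?_, (failB_le hm hε0 hε1 hη hC hn hp).trans h1⟩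
  · refine hpC.trans ?_
    rw [Real.rpow_neg hn0.le, ← div_eq_mul_inv, div_le_iff₀ (by linarith)]
    linarith
  · have := (h3.trans hN)
    rw [div_le_iff₀ hη0] at this
    linarith
  · rw [hD]
    have hC3 : (16 : ℝ) ^ 3 ≤ C ^ 3 := pow_le_pow_left₀ (by norm_num) hC16 3
    have := mul_le_mul hC3 hL zero_le_one (by positivity)
    linarith

lemma exists_net : ∃ T : Finset ℂ, (∀ t ∈ T, ‖t‖ = 1) ∧
    (∀ z : ℂ, ‖z‖ = 1 → ∃ t ∈ T, ‖z - t‖ ≤ 1 / 48) ∧ (1 : ℝ) ≤ T.card := by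
  obtain ⟨t, ht1, ht2, ht3⟩ := finite_cover_balls_of_compact (isCompact_sphere (0 : ℂ) 1)
    (show (0 : ℝ) < 1 / 48 by norm_num)
  have hcov : ∀ z : ℂ, ‖z‖ = 1 → ∃ s ∈ ht2.toFinset, ‖z - s‖ ≤ 1 / 48 := by
    intro z hz
    have := ht3 (show z ∈ Metric.sphere (0 : ℂ) 1 by simpa using hz)
    simp only [Set.mem_iUnion, Metric.mem_ball, dist_eq_norm] at this
    obtain ⟨s, hs, h⟩ := this
    exact ⟨s, by simpa using hs, h.le⟩
  refine ⟨ht2.toFinset, ?_, hcov, ?_⟩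
  · intro s hs
    have := ht1 ((Set.Finite.mem_toFinset _).1 hs)
    simpa using this
  · obtain ⟨s, hs, _⟩ := hcov 1 (by simp)
    exact_mod_cast Finset.card_pos.2 ⟨s, hs⟩

theorem freiman_hom_extends_random_subset :
    ∃ C : ℝ, 0 < C ∧ ∀ δ : ℝ, 0 < δ → ∃ n₀ : ℕ,
      ∀ (G : Type) [AddCommGroup G] [Fintype G], n₀ ≤ Fintype.card G →
        1 - δ ≤ randomSubsetProb G
            (C * Real.log (Fintype.card G) ^ ((1 : ℝ) / 3) *
              (Fintype.card G : ℝ) ^ (-(2 : ℝ) / 3))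
            (fun U => ∀ (H : Type) [AddCommGroup H], ∀ φ : G → H, FreimanHomOn U φ →
              ∃ (ψ : G →+ H) (h : H), ∀ u ∈ U, φ u = ψ u + h) := by
  obtain ⟨T, hT1, hT, hm⟩ := exists_net
  obtain ⟨ε, hε⟩ : ∃ ε : ℝ, ε = 1 / 10 ^ 7 := ⟨_, rfl⟩
  obtain ⟨η, hη⟩ : ∃ η : ℝ, η = ε ^ 2 / (2560 * (T.card : ℝ)) := ⟨_, rfl⟩
  have hε0 : 0 < ε := by rw [hε]; norm_num
  have hε1 : ε ≤ 1 := by rw [hε]; norm_num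
  have hη0 : 0 < η := by rw [hη]; positivity
  have hηε : η ≤ ε / 2560 := by
    rw [hη, div_le_div_iff₀ (by positivity) (by norm_num)]
    nlinarith [mul_le_mul hε1 hm (by norm_num) (by norm_num), mul_pos hε0 hε0,
      mul_le_mul_of_nonneg_left hm hε0.le, mul_le_mul_of_nonneg_left hε1 hε0.le]
  have hη8 : η ≤ 1 / 8 := by linarith
  refine ⟨2 / η, by positivity, fun δ hδ => ?_⟩
  obtain ⟨n₀, hn₀⟩ := asym hm hε0 hε1 hη rfl hδ
  refine ⟨n₀, fun G _ _ hG => ?_⟩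
  obtain ⟨p, hpd⟩ : ∃ p : ℝ, p = 2 / η * Real.log (Fintype.card G) ^ ((1 : ℝ) / 3) *
      (Fintype.card G : ℝ) ^ (-(2 : ℝ) / 3) := ⟨_, rfl⟩
  rw [← hpd]
  obtain ⟨hp0, hp1, hN1, hN, hD, hF⟩ := hn₀ _ hG p hpd
  obtain ⟨p2, hc, hp8, hp2⟩ := exists_p2 hp0 hp1 hη0 hη8
  have hn : (0 : ℝ) ≤ Fintype.card G := Nat.cast_nonneg _
  have hN2 : (1 : ℝ) ≤ Fintype.card G * p2 := by
    have := mul_le_mul_of_nonneg_left hp8 hn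
    linarith
  have hD2 : (1 : ℝ) ≤ (Fintype.card G : ℝ) ^ 2 * p2 ^ 3 := by
    have h3 : (p / 8) ^ 3 ≤ p2 ^ 3 := pow_le_pow_left₀ (by positivity) hp8 3
    have := mul_le_mul_of_nonneg_left h3 (sq_nonneg (Fintype.card G : ℝ))
    have e : (Fintype.card G : ℝ) ^ 2 * (p / 8) ^ 3 = (Fintype.card G : ℝ) ^ 2 * p ^ 3 / 512 := by
      ring
    linarith
  have key := prob_good (G := G) T 1 hη0 (by linarith) hp0 (by linarith) hc hp8 hp2 rfl hε0 hε1
    hN1 hN2 hD2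
  rw [randomSubsetProb_eq, coupling hc]
  refine le_trans (by linarith) (key.trans ?_)
  refine Ex_mono (by positivity) (by nlinarith) fun S => Ex_mono (by linarith) (by linarith)
    fun R => ind_mono fun hg => ?_
  intro H _ φ hφ
  exact general_ext hT1 hT (by rw [hε]; norm_num) hε0 (by rw [hε] at *; linarith)
    (by positivity) hg φ hφ

end
end

section
/- For every 0 < ε ≤ 1 there exists a constant C > 0 with the following property. For every δ > 0 there exists n_0 such that for every Abelian group G of order n ≥ n_0, if U_1, U_2, U_3 are independent random subsets of G with each element chosen independently with probability p = C n^{-2/3} (log n)^{1/3}, and μ_i = p^{-1} χ_{U_i} where χ_{U_i} is the characteristic function of U_i, and μ_3^-(x) = μ_3(−x), then with probability at least 1 − δ n^{-3}, every value of the function μ_1 * μ_2 * μ_3^- lies between 1 − ε and 1 + ε. -/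
open scoped Classical
open Finset

noncomputable section

/-- The probability that a triple of independent random subsets of `G`, each with
elements chosen independently with probability `p`, satisfies the event `E`. -/
def randomSubsetProb3 (G : Type*) [Fintype G] (p : ℝ)
    (E : Finset G → Finset G → Finset G → Prop) : ℝ :=
  ∑ A : Finset G, ∑ B : Finset G, ∑ C : Finset G,
    if E A B C then bernWeight p A * bernWeight p B * bernWeight p C else 0

/-- The rescaled indicator `p⁻¹ χ_U`. -/
def chMu {G : Type*} (p : ℝ) (U : Finset G) (x : G) : ℝ :=
  if x ∈ U then p⁻¹ else 0

/-- The value at `x` of the convolution `f * g * h⁻`, where `h⁻(t) = h(-t)` and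
`f * g (x) = E_{y+z=x} f(y) g(z)`. -/
def conv3minus {G : Type*} [AddCommGroup G] [Fintype G] (f g h : G → ℝ) (x : G) : ℝ :=
  (∑ y : G, ∑ z : G, f y * g z * h (y + z - x)) / ((Fintype.card G : ℝ) ^ 2)

/-- Number of representations of `w` as `a + b`. -/
def repCount {G : Type*} [AddCommGroup G] (A B : Finset G) (w : G) : ℕ :=
  (A.filter (fun y => w - y ∈ B)).card

lemma bern_nonneg {G : Type*} [Fintype G] {p : ℝ} (h0 : 0 ≤ p) (h1 : p ≤ 1) (A : Finset G) :
    0 ≤ bernWeight p A := by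
  unfold bernWeight
  have : 0 ≤ 1 - p := by linarith
  positivity

lemma bern_prod {G : Type*} [Fintype G] (p : ℝ) (g : G → ℝ) :
    ∑ A : Finset G, bernWeight p A * ∏ a ∈ A, g a = ∏ a : G, (1 - p + p * g a) := by
  have h := Finset.prod_add (fun a => p * g a) (fun _ : G => 1 - p) univ
  rw [Finset.powerset_univ] at h
  have h2 : ∏ a : G, (1 - p + p * g a) = ∏ a : G, (p * g a + (1 - p)) :=
    Finset.prod_congr rfl (fun a _ => by ring)
  rw [h2, h]
  refine Finset.sum_congr rfl (fun A _ => ?_)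
  rw [Finset.prod_mul_distrib, Finset.prod_const, Finset.prod_const, Finset.card_univ_sdiff]
  unfold bernWeight
  ring

lemma bern_total {G : Type*} [Fintype G] (p : ℝ) :
    ∑ A : Finset G, bernWeight p A = 1 := by
  have h := bern_prod (G := G) p (fun _ => 1)
  simpa using h

lemma bern_mgf {G : Type*} [Fintype G] {p : ℝ} (h0 : 0 ≤ p) (h1 : p ≤ 1) (f : G → ℝ) (K s : ℝ)
    (hf0 : ∀ a, 0 ≤ f a) (hfK : ∀ a, f a ≤ K) (hs : |s| * K ≤ 1) :
    ∑ A : Finset G, bernWeight p A * Real.exp (s * ∑ a ∈ A, f a)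
      ≤ Real.exp (p * (∑ a, f a) * (s + K * s ^ 2)) := by
  have e1 : ∀ A : Finset G, Real.exp (s * ∑ a ∈ A, f a) = ∏ a ∈ A, Real.exp (s * f a) := by
    intro A
    rw [Finset.mul_sum, Real.exp_sum]
  simp_rw [e1]
  rw [bern_prod]
  have e2 : Real.exp (p * (∑ a, f a) * (s + K * s ^ 2))
      = ∏ a : G, Real.exp (p * f a * (s + K * s ^ 2)) := by
    rw [← Real.exp_sum, Finset.mul_sum, Finset.sum_mul]
  rw [e2]
  refine Finset.prod_le_prod (fun a _ => ?_) (fun a _ => ?_)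
  · have : 0 ≤ 1 - p := by linarith
    positivity
  · have hle : |s * f a| ≤ 1 := by
      rw [abs_mul, abs_of_nonneg (hf0 a)]
      exact le_trans (mul_le_mul_of_nonneg_left (hfK a) (abs_nonneg s)) hs
    have h3 := (abs_le.mp (Real.abs_exp_sub_one_sub_id_le hle)).2
    have h4 : (s * f a) ^ 2 ≤ f a * (K * s ^ 2) := by
      have : f a * f a ≤ f a * K := mul_le_mul_of_nonneg_left (hfK a) (hf0 a)
      nlinarith [sq_nonneg s]
    have h5 : Real.exp (s * f a) - 1 ≤ f a * (s + K * s ^ 2) := by nlinarith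
    have h6 := Real.add_one_le_exp (p * f a * (s + K * s ^ 2))
    nlinarith [mul_le_mul_of_nonneg_left h5 h0]

/-- Two-sided Chernoff bound for weighted sums. -/
lemma bern_tail {G : Type*} [Fintype G] {p : ℝ} (h0 : 0 ≤ p) (h1 : p ≤ 1) (f : G → ℝ)
    (K M ε : ℝ) (hK : 1 ≤ K) (hM : 0 ≤ M) (hε : 0 < ε) (hε1 : ε ≤ 1)
    (hf0 : ∀ a, 0 ≤ f a) (hfK : ∀ a, f a ≤ K)
    (hl : (1 - ε / 3) * M ≤ p * ∑ a, f a) (hu : p * ∑ a, f a ≤ (1 + ε / 3) * M) :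
    ∑ A : Finset G, bernWeight p A *
      (if (1 - ε) * M ≤ ∑ a ∈ A, f a ∧ ∑ a ∈ A, f a ≤ (1 + ε) * M then 0 else 1)
      ≤ 2 * Real.exp (-(M * ε ^ 2 / (18 * K))) := by
  have hK0 : 0 < K := by linarith
  obtain ⟨t, ht⟩ : ∃ t, t = ε / (6 * K) := ⟨_, rfl⟩
  have ht0 : 0 < t := by rw [ht]; positivity
  have htK : t * K = ε / 6 := by rw [ht]; field_simp
  have hval : M * ε ^ 2 / (18 * K) = M * (2 * ε * t / 3 - 2 * K * t ^ 2) := by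
    rw [ht]; field_simp; ring
  have hS : ∀ A : Finset G, bernWeight p A *
      (if (1 - ε) * M ≤ ∑ a ∈ A, f a ∧ ∑ a ∈ A, f a ≤ (1 + ε) * M then 0 else 1)
      ≤ bernWeight p A * Real.exp (t * ∑ a ∈ A, f a) * Real.exp (-(t * ((1 + ε) * M)))
       + bernWeight p A * Real.exp (-t * ∑ a ∈ A, f a) * Real.exp (t * ((1 - ε) * M)) := by
    intro A
    rw [mul_assoc, mul_assoc, ← mul_add, ← Real.exp_add, ← Real.exp_add]
    refine mul_le_mul_of_nonneg_left ?_ (bern_nonneg h0 h1 A)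
    split_ifs with h
    · positivity
    · by_cases h2 : (1 - ε) * M ≤ ∑ a ∈ A, f a
      · have h3 : (1 + ε) * M < ∑ a ∈ A, f a := by
          by_contra h4
          exact h ⟨h2, not_lt.mp h4⟩
        have h5 : (1 : ℝ) ≤ Real.exp (t * ∑ a ∈ A, f a + -(t * ((1 + ε) * M))) := by
          apply Real.one_le_exp
          nlinarith
        have := Real.exp_pos (-t * ∑ a ∈ A, f a + t * ((1 - ε) * M))
        linarith
      · have h5 : (1 : ℝ) ≤ Real.exp (-t * ∑ a ∈ A, f a + t * ((1 - ε) * M)) := by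
          apply Real.one_le_exp
          nlinarith [not_le.mp h2]
        have := Real.exp_pos (t * ∑ a ∈ A, f a + -(t * ((1 + ε) * M)))
        linarith
  refine (Finset.sum_le_sum (fun A _ => hS A)).trans ?_
  rw [Finset.sum_add_distrib, ← Finset.sum_mul, ← Finset.sum_mul]
  have m1 := bern_mgf h0 h1 f K t hf0 hfK (by rw [abs_of_pos ht0, htK]; linarith)
  have m2 := bern_mgf h0 h1 f K (-t) hf0 hfK (by rw [abs_neg, abs_of_pos ht0, htK]; linarith)
  have b1 : (∑ A : Finset G, bernWeight p A * Real.exp (t * ∑ a ∈ A, f a))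
      * Real.exp (-(t * ((1 + ε) * M))) ≤ Real.exp (-(M * ε ^ 2 / (18 * K))) := by
    refine (mul_le_mul_of_nonneg_right m1 (Real.exp_pos _).le).trans ?_
    rw [← Real.exp_add, Real.exp_le_exp, hval]
    have q : 0 ≤ t + K * t ^ 2 := by positivity
    have q1 := mul_le_mul_of_nonneg_right hu q
    have q2 : 0 ≤ (1 - ε / 3) * (M * (K * t ^ 2)) :=
      mul_nonneg (by linarith) (by positivity)
    nlinarith
  have b2 : (∑ A : Finset G, bernWeight p A * Real.exp (-t * ∑ a ∈ A, f a))
      * Real.exp (t * ((1 - ε) * M)) ≤ Real.exp (-(M * ε ^ 2 / (18 * K))) := by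
    refine (mul_le_mul_of_nonneg_right m2 (Real.exp_pos _).le).trans ?_
    rw [← Real.exp_add, Real.exp_le_exp, hval]
    have q : 0 ≤ t - K * t ^ 2 := by
      have : K * t ^ 2 = t * (t * K) := by ring
      rw [this, htK]
      nlinarith
    have q1 := mul_le_mul_of_nonneg_right hl q
    have q2 : 0 ≤ (1 + ε / 3) * (M * (K * t ^ 2)) :=
      mul_nonneg (by linarith) (by positivity)
    nlinarith
  linarith

lemma sum_repCount {G : Type*} [AddCommGroup G] [Fintype G] (A B : Finset G) (x : G) :
    ∑ c : G, (repCount A B (c + x) : ℝ) = (A.card : ℝ) * B.card := by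
  have h1 : ∀ w, (repCount A B w : ℝ) = ∑ y ∈ A, if w - y ∈ B then (1 : ℝ) else 0 := by
    intro w
    unfold repCount
    rw [Finset.card_filter]
    push_cast
    rfl
  simp_rw [h1]
  rw [Finset.sum_comm]
  have h2 : ∀ y ∈ A, ∑ c : G, (if c + x - y ∈ B then (1 : ℝ) else 0) = B.card := by
    intro y _
    have := Equiv.sum_comp (Equiv.addRight (x - y)) (fun b => if b ∈ B then (1 : ℝ) else 0)
    simp only [Equiv.coe_addRight, ← add_sub_assoc] at this
    rw [this]
    simp
  rw [Finset.sum_congr rfl h2]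
  simp

lemma conv_eq {G : Type*} [AddCommGroup G] [Fintype G] (p : ℝ) (A B C : Finset G) (x : G) :
    conv3minus (chMu p A) (chMu p B) (chMu p C) x
      = (∑ c ∈ C, (repCount A B (c + x) : ℝ)) * (p⁻¹) ^ 3 / (Fintype.card G : ℝ) ^ 2 := by
  unfold conv3minus
  congr 1
  have h0 : ∀ y : G, ∑ z : G, chMu p A y * chMu p B z * chMu p C (y + z - x)
      = ∑ c : G, chMu p A y * chMu p B (c + x - y) * chMu p C c := by
    intro y
    have := Equiv.sum_comp (Equiv.addRight (x - y))
      (fun z => chMu p A y * chMu p B z * chMu p C (y + z - x))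
    rw [← this]
    refine Finset.sum_congr rfl (fun c _ => ?_)
    simp only [Equiv.coe_addRight]
    congr 2
    · congr 1
      abel
    · abel
  simp_rw [h0]
  rw [Finset.sum_comm]
  have h1 : ∀ w, (repCount A B w : ℝ) = ∑ y ∈ A, if w - y ∈ B then (1 : ℝ) else 0 := by
    intro w
    unfold repCount
    rw [Finset.card_filter]
    push_cast
    rfl
  have h2 : ∀ c : G, ∑ y : G, chMu p A y * chMu p B (c + x - y) * chMu p C c
      = if c ∈ C then (repCount A B (c + x) : ℝ) * (p⁻¹) ^ 3 else 0 := by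
    intro c
    unfold chMu
    rw [h1]
    by_cases hc : c ∈ C
    · simp only [hc, if_true]
      rw [Finset.sum_mul, ← Finset.sum_filter_add_sum_filter_not univ (fun y => y ∈ A)]
      have z : ∑ y ∈ univ.filter (fun y => y ∉ A), ((if y ∈ A then p⁻¹ else 0) *
          (if c + x - y ∈ B then p⁻¹ else 0) * p⁻¹) = 0 := by
        refine Finset.sum_eq_zero (fun y hy => ?_)
        rw [Finset.mem_filter] at hy
        simp [hy.2]
      rw [z, add_zero]
      have hA : univ.filter (fun y => y ∈ A) = A := by ext; simp
      rw [hA]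
      refine Finset.sum_congr rfl (fun y hy => ?_)
      simp only [hy, if_true]
      split_ifs <;> ring
    · simp [hc]
  simp_rw [h2]
  rw [Finset.sum_mul, ← Finset.sum_filter]
  congr 1
  ext; simp

/-- Tail of the representation count. -/
lemma rep_tail {G : Type*} [AddCommGroup G] [Fintype G] {p : ℝ} (h0 : 0 < p) (h1 : p ≤ 1)
    (hq : (Fintype.card G : ℝ) * p ^ 2 ≤ 1) (w : G) :
    ∑ A : Finset G, ∑ B : Finset G, bernWeight p A * bernWeight p B *
      (if repCount A B w ≤ 15 then 0 else 1)
      ≤ Real.exp 1 * ((Fintype.card G : ℝ) * p ^ 2) ^ 15 := by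
  have hn : (0 : ℝ) < Fintype.card G := by
    have : 0 < Fintype.card G := Fintype.card_pos
    exact_mod_cast this
  obtain ⟨q, hqd⟩ : ∃ q, q = (Fintype.card G : ℝ) * p ^ 2 := ⟨_, rfl⟩
  have hq0 : 0 < q := by rw [hqd]; positivity
  rw [← hqd] at hq ⊢
  have hθ : 1 ≤ q⁻¹ := (one_le_inv₀ hq0).mpr hq
  have hθ0 : 0 < q⁻¹ := by positivity
  have hB : ∀ A : Finset G, ∑ B : Finset G, bernWeight p B * (q⁻¹) ^ repCount A B w
      ≤ ∏ a ∈ A, (1 + p * q⁻¹) := by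
    intro A
    have e1 : ∀ B : Finset G, (q⁻¹) ^ repCount A B w
        = ∏ b ∈ B, (if w - b ∈ A then q⁻¹ else 1) := by
      intro B
      rw [Finset.prod_ite, Finset.prod_const, Finset.prod_const_one, mul_one]
      congr 1
      unfold repCount
      refine Finset.card_bij' (fun y _ => w - y) (fun y _ => w - y) ?_ ?_ ?_ ?_ <;> simp <;> tauto
    simp_rw [e1]
    rw [bern_prod]
    have e2 : ∏ b : G, (1 - p + p * (if w - b ∈ A then q⁻¹ else 1))
        = ∏ a : G, (1 - p + p * (if a ∈ A then q⁻¹ else 1)) :=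
      Equiv.prod_comp (Equiv.subLeft w) (fun a => 1 - p + p * (if a ∈ A then q⁻¹ else 1))
    rw [e2]
    have e3 : ∏ a ∈ A, (1 + p * q⁻¹) = ∏ a : G, (if a ∈ A then 1 + p * q⁻¹ else 1) := by
      rw [← Finset.prod_filter]
      congr 1
      ext; simp
    rw [e3]
    have hp : 0 ≤ 1 - p := by linarith
    refine Finset.prod_le_prod (fun a _ => ?_) (fun a _ => ?_)
    · split_ifs <;> positivity
    · split_ifs <;> linarith
  have step : ∀ A : Finset G, ∑ B : Finset G, bernWeight p A * bernWeight p B *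
      (if repCount A B w ≤ 15 then 0 else 1)
      ≤ (bernWeight p A * ∏ a ∈ A, (1 + p * q⁻¹)) * q ^ 15 := by
    intro A
    have hw := bern_nonneg h0.le h1 A
    calc _ ≤ ∑ B : Finset G, bernWeight p A * (bernWeight p B * (q⁻¹) ^ repCount A B w) * q ^ 15 := by
          refine Finset.sum_le_sum (fun B _ => ?_)
          have hwB := bern_nonneg h0.le h1 B
          have : (if repCount A B w ≤ 15 then (0 : ℝ) else 1) ≤ (q⁻¹) ^ repCount A B w * q ^ 15 := by
            split_ifs with h
            · positivity
            · have h3 : (q⁻¹) ^ 15 ≤ (q⁻¹) ^ repCount A B w :=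
                pow_le_pow_right₀ hθ (by omega)
              calc (1 : ℝ) = (q⁻¹) ^ 15 * q ^ 15 := by
                    rw [← mul_pow, inv_mul_cancel₀ hq0.ne', one_pow]
                _ ≤ _ := mul_le_mul_of_nonneg_right h3 (by positivity)
          calc _ ≤ bernWeight p A * bernWeight p B * ((q⁻¹) ^ repCount A B w * q ^ 15) :=
                mul_le_mul_of_nonneg_left this (mul_nonneg hw hwB)
            _ = _ := by ring
      _ = bernWeight p A * (∑ B : Finset G, bernWeight p B * (q⁻¹) ^ repCount A B w) * q ^ 15 := by
          rw [Finset.mul_sum, Finset.sum_mul]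
      _ ≤ _ := by
          refine mul_le_mul_of_nonneg_right ?_ (by positivity)
          exact mul_le_mul_of_nonneg_left (hB A) hw
  refine (Finset.sum_le_sum (fun A _ => step A)).trans ?_
  rw [← Finset.sum_mul, bern_prod]
  refine mul_le_mul_of_nonneg_right ?_ (by positivity)
  rw [Finset.prod_const, Finset.card_univ]
  have e : 1 - p + p * (1 + p * q⁻¹) ≤ Real.exp (p ^ 2 * q⁻¹) := by
    have := Real.add_one_le_exp (p ^ 2 * q⁻¹)
    nlinarith
  have pos : 0 ≤ 1 - p + p * (1 + p * q⁻¹) := by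
    have : 0 ≤ p * (p * q⁻¹) := by positivity
    nlinarith
  refine (pow_le_pow_left₀ pos e _).trans ?_
  rw [← Real.exp_nat_mul, Real.exp_le_exp, ← mul_assoc, ← hqd, mul_inv_cancel₀ hq0.ne']

lemma finite_bound {G : Type*} [AddCommGroup G] [Fintype G] {p ε : ℝ} (h0 : 0 < p) (h1 : p ≤ 1)
    (hε : 0 < ε) (hε1 : ε ≤ 1) (hq : (Fintype.card G : ℝ) * p ^ 2 ≤ 1) :
    1 - (4 * Real.exp (-(p * Fintype.card G * (ε / 10) ^ 2 / 18))
      + Fintype.card G * (Real.exp 1 * ((Fintype.card G : ℝ) * p ^ 2) ^ 15)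
      + Fintype.card G * (2 * Real.exp (-(p ^ 3 * (Fintype.card G : ℝ) ^ 2 * ε ^ 2 / (18 * 15)))))
     ≤ randomSubsetProb3 G p (fun U₁ U₂ U₃ =>
              ∀ x : G,
                1 - ε ≤ conv3minus (chMu p U₁) (chMu p U₂) (chMu p U₃) x ∧
                conv3minus (chMu p U₁) (chMu p U₂) (chMu p U₃) x ≤ 1 + ε) := by
  have hn : (0 : ℝ) < Fintype.card G := by
    have : 0 < Fintype.card G := Fintype.card_pos
    exact_mod_cast this
  obtain ⟨n, hnd⟩ : ∃ n : ℝ, n = Fintype.card G := ⟨_, rfl⟩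
  obtain ⟨M, hMd⟩ : ∃ M : ℝ, M = p ^ 3 * n ^ 2 := ⟨_, rfl⟩
  rw [← hnd] at hn
  have hM : 0 < M := by rw [hMd]; positivity
  -- the size events
  let sz : Finset G → ℝ := fun A =>
    if (1 - ε / 10) * (p * n) ≤ ∑ a ∈ A, (1 : ℝ) ∧ ∑ a ∈ A, (1 : ℝ) ≤ (1 + ε / 10) * (p * n)
    then 0 else 1
  have hsz : ∑ A : Finset G, bernWeight p A * sz A
      ≤ 2 * Real.exp (-(p * n * (ε / 10) ^ 2 / 18)) := by
    have := bern_tail (G := G) h0.le h1 (fun _ => 1) 1 (p * n) (ε / 10) le_rfl (by positivity)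
      (by positivity) (by linarith) (fun _ => zero_le_one) (fun _ => le_rfl)
      (by simp only [Finset.sum_const, Finset.card_univ, nsmul_eq_mul, mul_one, ← hnd]
          have : 0 < p * n := by positivity
          nlinarith)
      (by simp only [Finset.sum_const, Finset.card_univ, nsmul_eq_mul, mul_one, ← hnd]
          have : 0 < p * n := by positivity
          nlinarith)
    rw [mul_one] at this
    exact this
  let rp : Finset G → Finset G → G → ℝ := fun A B w => if repCount A B w ≤ 15 then 0 else 1
  let dv : Finset G → Finset G → Finset G → G → ℝ := fun A B C x =>
    if (1 - ε) * M ≤ ∑ c ∈ C, (repCount A B (c + x) : ℝ) ∧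
      ∑ c ∈ C, (repCount A B (c + x) : ℝ) ≤ (1 + ε) * M then 0 else 1
  obtain ⟨E, hE⟩ : ∃ E : Finset G → Finset G → Finset G → Prop, E = fun U₁ U₂ U₃ =>
              ∀ x : G,
                1 - ε ≤ conv3minus (chMu p U₁) (chMu p U₂) (chMu p U₃) x ∧
                conv3minus (chMu p U₁) (chMu p U₂) (chMu p U₃) x ≤ 1 + ε := ⟨_, rfl⟩
  have hsz0 : ∀ A, 0 ≤ sz A := by intro A; dsimp only [sz]; split_ifs <;> norm_num
  have hrp0 : ∀ A B w, 0 ≤ rp A B w := by intro A B w; dsimp only [rp]; split_ifs <;> norm_num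
  have hdv0 : ∀ A B C x, 0 ≤ dv A B C x := by
    intro A B C x; dsimp only [dv]; split_ifs <;> norm_num
  obtain ⟨T, hT⟩ : ∃ T, T = 2 * Real.exp (-(M * ε ^ 2 / (18 * 15))) := ⟨_, rfl⟩
  have hT0 : 0 ≤ T := by rw [hT]; positivity
  have hcE : ∀ A B C, (if E A B C then (0 : ℝ) else 1) ≤ ∑ x : G, dv A B C x := by
    intro A B C
    split_ifs with h
    · exact Finset.sum_nonneg (fun x _ => hdv0 A B C x)
    · simp only [hE, not_forall] at h
      obtain ⟨x, hx⟩ := h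
      refine le_trans ?_ (Finset.single_le_sum (fun x _ => hdv0 A B C x) (Finset.mem_univ x))
      dsimp only [dv]
      rw [if_neg]
      rintro ⟨l, u⟩
      apply hx
      rw [conv_eq, ← hnd]
      have e : (∑ c ∈ C, (repCount A B (c + x) : ℝ)) * (p⁻¹) ^ 3 / n ^ 2
          = (∑ c ∈ C, (repCount A B (c + x) : ℝ)) / M := by
        rw [hMd]; field_simp
      rw [e, le_div_iff₀ hM, div_le_iff₀ hM]
      exact ⟨l, u⟩
  have inner : ∀ A B, ∑ C : Finset G, bernWeight p C * (if E A B C then (0 : ℝ) else 1)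
      ≤ sz A + sz B + ∑ w : G, rp A B w + n * T := by
    intro A B
    have hle1 : ∑ C : Finset G, bernWeight p C * (if E A B C then (0 : ℝ) else 1) ≤ 1 := by
      refine le_trans ?_ (bern_total (G := G) p).le
      refine Finset.sum_le_sum (fun C _ => ?_)
      have := bern_nonneg h0.le h1 C
      split_ifs
      · simpa using this
      · simp
    have hrps : 0 ≤ ∑ w : G, rp A B w := Finset.sum_nonneg (fun w _ => hrp0 A B w)
    have hnT : 0 ≤ n * T := by positivity
    by_cases hA : (1 - ε / 10) * (p * n) ≤ ∑ a ∈ A, (1 : ℝ) ∧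
        ∑ a ∈ A, (1 : ℝ) ≤ (1 + ε / 10) * (p * n)
    swap
    · have : sz A = 1 := if_neg hA
      linarith [hsz0 B]
    by_cases hB : (1 - ε / 10) * (p * n) ≤ ∑ a ∈ B, (1 : ℝ) ∧
        ∑ a ∈ B, (1 : ℝ) ≤ (1 + ε / 10) * (p * n)
    swap
    · have : sz B = 1 := if_neg hB
      linarith [hsz0 A]
    by_cases hr : ∀ w, repCount A B w ≤ 15
    swap
    · push Not at hr
      obtain ⟨w, hw⟩ := hr
      have h2 : rp A B w = 1 := if_neg (by omega)
      have h3 : rp A B w ≤ ∑ w : G, rp A B w :=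
        Finset.single_le_sum (fun w _ => hrp0 A B w) (Finset.mem_univ w)
      linarith [hsz0 A, hsz0 B]
    have hmain : ∑ C : Finset G, bernWeight p C * (if E A B C then (0 : ℝ) else 1) ≤ n * T := by
      calc _ ≤ ∑ C : Finset G, bernWeight p C * ∑ x : G, dv A B C x :=
            Finset.sum_le_sum (fun C _ =>
              mul_le_mul_of_nonneg_left (hcE A B C) (bern_nonneg h0.le h1 C))
        _ = ∑ x : G, ∑ C : Finset G, bernWeight p C * dv A B C x := by
            simp_rw [Finset.mul_sum]
            rw [Finset.sum_comm]
        _ ≤ ∑ x : G, T := by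
            refine Finset.sum_le_sum (fun x _ => ?_)
            rw [hT]
            simp only [Finset.sum_const, nsmul_eq_mul, mul_one] at hA hB
            have hpn : 0 < p * n := by positivity
            have a0 : 0 ≤ (1 - ε / 10) * (p * n) := mul_nonneg (by linarith) hpn.le
            have lo := mul_le_mul hA.1 hB.1 a0 (by positivity)
            have hi := mul_le_mul hA.2 hB.2 (by positivity)
              (mul_nonneg (by linarith) hpn.le)
            have lo' := mul_le_mul_of_nonneg_left lo h0.le
            have hi' := mul_le_mul_of_nonneg_left hi h0.le
            refine bern_tail (G := G) h0.le h1 (fun c => (repCount A B (c + x) : ℝ)) 15 M ε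
              (by norm_num) hM.le hε hε1 (fun _ => by positivity)
              (fun c => by exact_mod_cast hr (c + x)) ?_ ?_
            · rw [sum_repCount]
              refine le_trans ?_ lo'
              have : p * ((1 - ε / 10) * (p * n) * ((1 - ε / 10) * (p * n)))
                = (1 - ε / 10) ^ 2 * M := by rw [hMd]; ring
              rw [this]
              refine mul_le_mul_of_nonneg_right ?_ hM.le
              nlinarith
            · rw [sum_repCount]
              refine le_trans hi' ?_
              have : p * ((1 + ε / 10) * (p * n) * ((1 + ε / 10) * (p * n)))
                = (1 + ε / 10) ^ 2 * M := by rw [hMd]; ring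
              rw [this]
              refine mul_le_mul_of_nonneg_right ?_ hM.le
              nlinarith
        _ = n * T := by
            rw [Finset.sum_const, Finset.card_univ, nsmul_eq_mul, hnd]
    linarith [hsz0 A, hsz0 B]
  have key : ∀ A B C : Finset G, (if E A B C then bernWeight p A * bernWeight p B * bernWeight p C else 0)
      = bernWeight p A * (bernWeight p B * bernWeight p C)
        - bernWeight p A * (bernWeight p B * (bernWeight p C * (if E A B C then (0 : ℝ) else 1))) := by
    intro A B C
    split_ifs <;> ring
  have hprob : randomSubsetProb3 G p E
      = 1 - ∑ A : Finset G, bernWeight p A * ∑ B : Finset G, bernWeight p B *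
        ∑ C : Finset G, bernWeight p C * (if E A B C then (0 : ℝ) else 1) := by
    unfold randomSubsetProb3
    simp_rw [key, Finset.sum_sub_distrib, ← Finset.mul_sum, bern_total, mul_one, bern_total, mul_one, bern_total]
  rw [← hE, hprob, ← hnd, ← hMd, ← hT]
  refine sub_le_sub_left ?_ 1
  calc _ ≤ ∑ A : Finset G, bernWeight p A * ∑ B : Finset G, bernWeight p B *
        (sz A + sz B + ∑ w : G, rp A B w + n * T) := by
        refine Finset.sum_le_sum (fun A _ => ?_)
        refine mul_le_mul_of_nonneg_left ?_ (bern_nonneg h0.le h1 A)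
        refine Finset.sum_le_sum (fun B _ => ?_)
        exact mul_le_mul_of_nonneg_left (inner A B) (bern_nonneg h0.le h1 B)
    _ = (∑ A : Finset G, bernWeight p A * sz A) + (∑ B : Finset G, bernWeight p B * sz B)
        + (∑ w : G, ∑ A : Finset G, ∑ B : Finset G, bernWeight p A * bernWeight p B * rp A B w)
        + n * T := by
        have r1 : (∑ w : G, ∑ A : Finset G, ∑ B : Finset G,
            bernWeight p A * bernWeight p B * rp A B w)
            = ∑ A : Finset G, bernWeight p A * ∑ B : Finset G, bernWeight p B * ∑ w : G, rp A B w := by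
          rw [Finset.sum_comm]
          refine Finset.sum_congr rfl (fun A _ => ?_)
          rw [Finset.sum_comm, Finset.mul_sum]
          refine Finset.sum_congr rfl (fun B _ => ?_)
          rw [← Finset.mul_sum, mul_assoc]
        rw [r1]
        simp_rw [mul_add, Finset.sum_add_distrib, ← Finset.sum_mul, bern_total, mul_add,
          Finset.sum_add_distrib, ← Finset.sum_mul, bern_total, one_mul]
    _ ≤ 2 * Real.exp (-(p * n * (ε / 10) ^ 2 / 18)) + 2 * Real.exp (-(p * n * (ε / 10) ^ 2 / 18))
        + n * (Real.exp 1 * (n * p ^ 2) ^ 15) + n * T := by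
        have r2 : (∑ w : G, ∑ A : Finset G, ∑ B : Finset G,
            bernWeight p A * bernWeight p B * rp A B w)
            ≤ ∑ w : G, Real.exp 1 * (n * p ^ 2) ^ 15 := by
          refine Finset.sum_le_sum (fun w _ => ?_)
          rw [hnd]
          exact rep_tail h0 h1 hq w
        rw [Finset.sum_const, Finset.card_univ, nsmul_eq_mul, ← hnd] at r2
        linarith
    _ = _ := by ring


lemma tail_arith {δ n c : ℝ} (hn : 0 < n) (h : 16 ≤ δ * n) (hc : c ≤ 4) :
    c / n ^ 4 ≤ (δ / n ^ 3) / 4 := by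
  rw [div_div, div_le_div_iff₀ (by positivity) (by positivity)]
  have h3 : 0 < n ^ 3 := by positivity
  have h1 := mul_le_mul_of_nonneg_right h h3.le
  have e3 : δ * n * n ^ 3 = δ * n ^ 4 := by ring
  have h2 := mul_le_mul_of_nonneg_right hc h3.le
  linarith

theorem triple_convolution_almost_constant (ε : ℝ) (hε0 : 0 < ε) (hε1 : ε ≤ 1) :
    ∃ C : ℝ, 0 < C ∧ ∀ δ : ℝ, 0 < δ → ∃ n₀ : ℕ,
      ∀ (G : Type) [AddCommGroup G] [Fintype G], n₀ ≤ Fintype.card G →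
        ∀ p : ℝ,
          p = C * (Fintype.card G : ℝ) ^ (-(2 : ℝ) / 3) *
            Real.log (Fintype.card G) ^ ((1 : ℝ) / 3) →
          1 - δ / (Fintype.card G : ℝ) ^ 3 ≤
            randomSubsetProb3 G p (fun U₁ U₂ U₃ =>
              ∀ x : G,
                1 - ε ≤ conv3minus (chMu p U₁) (chMu p U₂) (chMu p U₃) x ∧
                conv3minus (chMu p U₁) (chMu p U₂) (chMu p U₃) x ≤ 1 + ε) := by
  obtain ⟨C, hCd⟩ : ∃ C : ℝ, C = 1350 / ε ^ 2 := ⟨_, rfl⟩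
  have hε2 : ε ^ 2 ≤ 1 := by nlinarith
  have hC1 : 1 ≤ C := by
    rw [hCd, le_div_iff₀ (by positivity)]
    linarith
  have hCε : C * ε ^ 2 = 1350 := by rw [hCd]; field_simp
  have hC0 : 0 < C := by linarith
  refine ⟨C, hC0, fun δ hδ => ?_⟩
  obtain ⟨a, had⟩ : ∃ a : ℝ, a = 7200 / ε ^ 2 := ⟨_, rfl⟩
  have ha0 : 0 < a := by rw [had]; positivity
  have haε : a * ε ^ 2 = 7200 := by rw [had]; field_simp
  obtain ⟨D, hDd⟩ : ∃ D : ℝ, D = C ^ 6 + a ^ 3 + 4 * Real.exp 1 * C ^ 30 / δ + 16 / δ := ⟨_, rfl⟩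
  have p1 : 0 < C ^ 6 := by positivity
  have p2 : 0 < a ^ 3 := by positivity
  have p3 : 0 < 4 * Real.exp 1 * C ^ 30 / δ := by positivity
  have p4 : 0 < 16 / δ := by positivity
  have hD0 : 0 < D := by linarith
  have ev1 : ∀ᶠ x : ℝ in Filter.atTop, ‖Real.log x ^ 10‖ ≤ D⁻¹ * ‖x‖ :=
    (Real.isLittleO_pow_log_id_atTop (n := 10)).bound (inv_pos.mpr hD0)
  have ev2 : ∀ᶠ x : ℝ in Filter.atTop, 1 ≤ Real.log x :=
    Real.tendsto_log_atTop.eventually_ge_atTop 1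
  have ev := (ev1.and (ev2.and (Filter.eventually_ge_atTop (1 : ℝ))))
  obtain ⟨n₀, hn₀⟩ := Filter.eventually_atTop.mp
    ((tendsto_natCast_atTop_atTop (R := ℝ)).eventually ev)
  refine ⟨n₀, fun G _ _ hG p hp => ?_⟩
  obtain ⟨c1, hL, hn1⟩ := hn₀ _ hG
  obtain ⟨n, hnd⟩ : ∃ n : ℝ, n = Fintype.card G := ⟨_, rfl⟩
  obtain ⟨L, hLd⟩ : ∃ L : ℝ, L = Real.log n := ⟨_, rfl⟩
  rw [← hnd] at c1 hL hn1 hp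
  rw [← hLd] at c1 hL hp
  have hn0 : 0 < n := by linarith
  have hL0 : 0 < L := by linarith
  have c2 : D * L ^ 10 ≤ n := by
    rw [Real.norm_of_nonneg (by positivity), Real.norm_of_nonneg hn0.le] at c1
    calc D * L ^ 10 ≤ D * (D⁻¹ * n) := mul_le_mul_of_nonneg_left c1 hD0.le
      _ = n := by rw [← mul_assoc, mul_inv_cancel₀ hD0.ne', one_mul]
  have hp0 : 0 < p := by rw [hp]; positivity
  have hp3 : p ^ 3 = C ^ 3 * L / n ^ 2 := by
    have e1 : (n ^ (-(2 : ℝ) / 3)) ^ 3 = (n ^ 2)⁻¹ := by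
      rw [← Real.rpow_natCast, ← Real.rpow_mul hn0.le]
      norm_num
    have e2 : (L ^ ((1 : ℝ) / 3)) ^ 3 = L := by
      rw [← Real.rpow_natCast, ← Real.rpow_mul hL0.le]
      norm_num
    rw [hp, mul_pow, mul_pow, e1, e2]
    field_simp
  have hL2 : L ^ 2 ≤ L ^ 10 := pow_le_pow_right₀ hL (by norm_num)
  have hL10 : 1 ≤ L ^ 10 := one_le_pow₀ hL
  have d1 : C ^ 6 * L ^ 2 ≤ n := by
    calc C ^ 6 * L ^ 2 ≤ D * L ^ 10 :=
          mul_le_mul (by linarith) hL2 (by positivity) hD0.le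
      _ ≤ n := c2
  have d2 : a ^ 3 * L ^ 2 ≤ n := by
    calc a ^ 3 * L ^ 2 ≤ D * L ^ 10 :=
          mul_le_mul (by linarith) hL2 (by positivity) hD0.le
      _ ≤ n := c2
  have d3 : 4 * Real.exp 1 * C ^ 30 * L ^ 10 ≤ δ * n := by
    have : 4 * Real.exp 1 * C ^ 30 / δ * L ^ 10 ≤ n := 
      (mul_le_mul_of_nonneg_right (by linarith) (by positivity)).trans c2
    rw [div_mul_eq_mul_div, div_le_iff₀ hδ] at this
    linarith
  have d4 : 16 ≤ δ * n := by
    have : 16 / δ * 1 ≤ n := 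
      (mul_le_mul (by linarith) hL10 (by norm_num) hD0.le).trans c2
    rw [div_mul_eq_mul_div, div_le_iff₀ hδ] at this
    linarith
  have hq3 : (n * p ^ 2) ^ 3 = C ^ 6 * L ^ 2 / n := by
    have : (n * p ^ 2) ^ 3 = n ^ 3 * (p ^ 3) ^ 2 := by ring
    rw [this, hp3]
    field_simp
  have hq : n * p ^ 2 ≤ 1 := by
    have : (n * p ^ 2) ^ 3 ≤ 1 := by
      rw [hq3, div_le_one hn0]
      exact d1
    exact (pow_le_one_iff_of_nonneg (by positivity) (by norm_num)).mp this
  have hp1 : p ≤ 1 := by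
    have : p ^ 2 ≤ 1 := by nlinarith [sq_nonneg p]
    exact (pow_le_one_iff_of_nonneg hp0.le (by norm_num)).mp this
  have hpn : a * L ≤ p * n := by
    refine le_of_pow_le_pow_left₀ (n := 3) (by norm_num) (by positivity) ?_
    have e : (p * n) ^ 3 = C ^ 3 * L * n := by
      rw [mul_pow, hp3]; field_simp
    rw [e]
    have hC3 : 1 ≤ C ^ 3 := one_le_pow₀ hC1
    calc (a * L) ^ 3 = (a ^ 3 * L ^ 2) * L := by ring
      _ ≤ n * L := mul_le_mul_of_nonneg_right d2 hL0.le
      _ ≤ C ^ 3 * (n * L) := le_mul_of_one_le_left (by positivity) hC3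
      _ = _ := by ring
  have hexp : ∀ k : ℕ, Real.exp (-(k * L)) = (n ^ k)⁻¹ := by
    intro k
    rw [Real.exp_neg, Real.exp_nat_mul, hLd, Real.exp_log hn0]
  have main := finite_bound (G := G) hp0 hp1 hε0 hε1 (by rw [← hnd]; exact hq)
  refine le_trans ?_ main
  rw [← hnd]
  refine sub_le_sub_left ?_ 1
  have t1 : 4 * Real.exp (-(p * n * (ε / 10) ^ 2 / 18)) ≤ (δ / n ^ 3) / 4 := by
    have : Real.exp (-(p * n * (ε / 10) ^ 2 / 18)) ≤ (n ^ 4)⁻¹ := by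
      rw [← hexp 4, Real.exp_le_exp]
      have := mul_le_mul_of_nonneg_right hpn (sq_nonneg ε)
      push_cast
      nlinarith
    calc _ ≤ 4 * (n ^ 4)⁻¹ := by linarith
      _ ≤ _ := by
        rw [← div_eq_mul_inv]
        exact tail_arith hn0 d4 le_rfl
  have t2 : n * (Real.exp 1 * (n * p ^ 2) ^ 15) ≤ (δ / n ^ 3) / 4 := by
    have e : n * (Real.exp 1 * (n * p ^ 2) ^ 15) = Real.exp 1 * C ^ 30 * L ^ 10 / n ^ 4 := by
      have : (n * p ^ 2) ^ 15 = ((n * p ^ 2) ^ 3) ^ 5 := by rw [← pow_mul]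
      rw [this, hq3]
      field_simp
    rw [e, div_div, div_le_div_iff₀ (by positivity) (by positivity)]
    have := mul_le_mul_of_nonneg_right d3 (by positivity : 0 ≤ n ^ 3)
    have e3 : δ * n * n ^ 3 = δ * n ^ 4 := by ring
    linarith
  have t3 : n * (2 * Real.exp (-(p ^ 3 * n ^ 2 * ε ^ 2 / (18 * 15)))) ≤ (δ / n ^ 3) / 4 := by
    have : Real.exp (-(p ^ 3 * n ^ 2 * ε ^ 2 / (18 * 15))) ≤ (n ^ 5)⁻¹ := by
      rw [← hexp 5, Real.exp_le_exp]
      have e : p ^ 3 * n ^ 2 = C ^ 3 * L := by rw [hp3]; field_simp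
      rw [e]
      have hC3 : C ≤ C ^ 3 := le_self_pow₀ hC1 (by norm_num)
      have := mul_le_mul_of_nonneg_right hC3 (by positivity : 0 ≤ L * ε ^ 2)
      have e2 : C * (L * ε ^ 2) = 1350 * L := by rw [← hCε]; ring
      push_cast
      linarith
    calc _ ≤ n * (2 * (n ^ 5)⁻¹) := by
          refine mul_le_mul_of_nonneg_left ?_ hn0.le
          linarith
      _ = 2 / n ^ 4 := by field_simp
      _ ≤ _ := by
        exact tail_arith hn0 d4 (by norm_num)
  have : 0 < δ / n ^ 3 := by positivity
  linarith

end
end
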